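/- arXiv:cs/0204037 — 3 statements merged into one kernel-verified Lean document; each statement's English description precedes it below -/
import Mathlib

section
/- There is a constant c such that for every binary string x of length n with complexity k = K(x), and every natural number i with K(n) + c ≤ i ≤ k: λ_x(i + c·log n) ≤ β_x(i) + k + c·log n. Together with the reverse inequality β_x(i) + k ≤ λ_x(i) + O(1), this says that a model witnessing the minimal two-part MDL code length λ_x essentially also witnesses the minimal randomness deficiency β_x. -/
open scoped Classical

/-- Binary strings. -/
abbrev BStr : Type := List Bool

/-- A prefix (Turing) machine: a partial computable map taking a program and an
auxiliary input to an output, such that for each auxiliary input the set of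
halting programs is prefix-free. -/
structure PrefixMachine where
  eval : BStr → BStr → Part BStr
  partrec' : Partrec fun p : BStr × BStr => eval p.1 p.2
  prefixFree : ∀ y p q, (eval p y).Dom → (eval q y).Dom → p <+: q → p = q

/-- A universal prefix machine: it simulates every prefix machine via a fixed
self-delimiting prefix. -/
structure UniversalPrefixMachine extends PrefixMachine where
  universal : ∀ M : PrefixMachine, ∃ s : BStr, ∀ p y,
    toPrefixMachine.eval (s ++ p) y = M.eval p y

/-- Canonical binary-string encoding of an encodable object (e.g. a natural
number, a pair, or a finite set of strings, the latter representing a literal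
listing of the set). -/
def code {α : Type} [Encodable α] (a : α) : BStr := Nat.bits (Encodable.encode a)

namespace UniversalPrefixMachine

variable (U : UniversalPrefixMachine)

/-- Conditional prefix Kolmogorov complexity `K(x|y)` of a string given a string. -/
noncomputable def Kc (x y : BStr) : ℕ :=
  sInf {n | ∃ p : BStr, p.length = n ∧ x ∈ U.eval p y}

/-- Prefix Kolmogorov complexity `K(x)`. -/
noncomputable def K (x : BStr) : ℕ := U.Kc x []

/-- `K(x|S)`: conditional complexity of `x` given a literal listing of the finite set `S`. -/
noncomputable def KcS (x : BStr) (S : Finset BStr) : ℕ := U.Kc x (code S)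

/-- `K(S)`: complexity of a listing of the finite set `S`. -/
noncomputable def Kset (S : Finset BStr) : ℕ := U.K (code S)

/-- `K(P|S)`: conditional complexity of a listing of `P` given a listing of `S`. -/
noncomputable def KsetCond (P S : Finset BStr) : ℕ := U.Kc (code P) (code S)

/-- `K(S|x)`: conditional complexity of a listing of `S` given the string `x`. -/
noncomputable def KsetGivenStr (S : Finset BStr) (x : BStr) : ℕ := U.Kc (code S) x

/-- `K(n)` for a natural number `n`. -/
noncomputable def Knat (n : ℕ) : ℕ := U.K (code n)

/-- `K(a|b)` for natural numbers `a`, `b`. -/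
noncomputable def KnatCond (a b : ℕ) : ℕ := U.Kc (code a) (code b)

/-- Randomness deficiency `δ(x|S) = log|S| - K(x|S)` (logarithm base 2). -/
noncomputable def deficiency (x : BStr) (S : Finset BStr) : ℝ :=
  Real.logb 2 (S.card : ℝ) - (U.KcS x S : ℝ)

/-- `Λ(S) = K(S) + log|S|`. -/
noncomputable def Lam (S : Finset BStr) : ℝ :=
  (U.Kset S : ℝ) + Real.logb 2 (S.card : ℝ)

/-- Kolmogorov structure function `h_x(α) = min{log|S| : x ∈ S, K(S) ≤ α}`
(the minimum of the empty set being `⊤`). -/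
noncomputable def h (x : BStr) (α : ℕ) : EReal :=
  sInf {r : EReal | ∃ S : Finset BStr,
    x ∈ S ∧ U.Kset S ≤ α ∧ r = ((Real.logb 2 (S.card : ℝ)) : EReal)}

/-- MDL structure function `λ_x(α) = min{Λ(S) : x ∈ S, K(S) ≤ α}`. -/
noncomputable def lambdaF (x : BStr) (α : ℕ) : EReal :=
  sInf {r : EReal | ∃ S : Finset BStr,
    x ∈ S ∧ U.Kset S ≤ α ∧ r = ((U.Lam S) : EReal)}

/-- Best-fit structure function `β_x(α) = min{δ(x|S) : x ∈ S, K(S) ≤ α}`. -/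
noncomputable def betaF (x : BStr) (α : ℕ) : EReal :=
  sInf {r : EReal | ∃ S : Finset BStr,
    x ∈ S ∧ U.Kset S ≤ α ∧ r = ((U.deficiency x S) : EReal)}

end UniversalPrefixMachine

/-- `f` is `(ε,δ)`-close to `g` on `{0,…,k}`. -/
def IsClose (k : ℕ) (ε δ : ℕ → ℕ) (f g : ℕ → EReal) : Prop :=
  ∀ i, ε 0 ≤ i → i ≤ k →
    sInf {r : EReal | ∃ j, ε 0 ≤ j ∧ j ≤ k ∧ Nat.dist j i ≤ ε i ∧ r = g j}
        - (((δ i : ℕ) : ℝ) : EReal) ≤ f i ∧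
    f i ≤ sSup {r : EReal | ∃ j, ε 0 ≤ j ∧ j ≤ k ∧ Nat.dist j i ≤ ε i ∧ r = g j}
        + (((δ i : ℕ) : ℝ) : EReal)


namespace VV
open Encodable

section prim
variable {α β γ : Type*} [Primcodable α] [Primcodable β] [Primcodable γ]

theorem filterP {f : α → List β} {p : α → β → Prop} [∀ a, DecidablePred (p a)]
    (hf : Primrec f) (hp : PrimrecPred fun z : α × β => p z.1 z.2) :
    Primrec fun a => (f a).filter (fun b => decide (p a b)) := by
  have h1 : Primrec₂ fun (a : α) (b : β) => if p a b then some b else none := by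
    have := Primrec.ite (c := fun z : α × β => p z.1 z.2) hp
      (Primrec.option_some.comp (Primrec.snd (α := α) (β := β))) (Primrec.const none)
    exact this
  refine (Primrec.listFilterMap hf h1).of_eq fun a => ?_
  induction f a with
  | nil => rfl
  | cons b l ih => by_cases h : p a b <;> simp [h, ih]

theorem exP {f : α → List β} {p : α → β → Prop}
    (hf : Primrec f) (hp : PrimrecPred fun z : α × β => p z.1 z.2) :
    PrimrecPred fun a => ∃ b ∈ f a, p a b := by
  have h1 := Primrec.list_length.comp (filterP hf hp)
  have h2 := (Primrec.nat_lt).comp (Primrec.const (α := α) 0) h1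
  refine h2.of_eq fun a => ?_
  simp [List.length_pos_iff_exists_mem]

theorem allP {f : α → List β} {p : α → β → Prop}
    (hf : Primrec f) (hp : PrimrecPred fun z : α × β => p z.1 z.2) :
    PrimrecPred fun a => ∀ b ∈ f a, p a b := by
  refine ((exP (p := fun a b => ¬ p a b) hf hp.not).not).of_eq fun a => ?_
  push Not
  rfl

theorem impP {p q : α → Prop} (hp : PrimrecPred p) (hq : PrimrecPred q) :
    PrimrecPred fun a => (p a → q a) :=
  (hp.not.or hq).of_eq fun a => by tauto

theorem pow2 {f : α → ℕ} (hf : Primrec f) : Primrec fun a => 2 ^ f a := by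
  have : Primrec fun n : ℕ => 2 ^ n := by
    refine (Primrec.nat_rec₁ (f := fun _ m => 2 * m) 1
      ((Primrec.nat_mul.comp (Primrec.const 2) Primrec.snd).to₂)).of_eq fun n => ?_
    induction n with
    | zero => rfl
    | succ n ih => simp only [pow_succ, ← ih]; ring
  exact this.comp hf

end prim

/-- value of a bit string -/
def val (s : BStr) : ℕ := s.foldr (fun b n => Nat.bit b n) 0

theorem val_bits (n : ℕ) : val (Nat.bits n) = n := by
  induction n using Nat.binaryRec' with
  | zero => simp [val]
  | bit b n h ih =>
    rw [Nat.bits_append_bit n b h]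
    simp only [val, List.foldr_cons] at ih ⊢
    rw [ih]

theorem val_primrec : Primrec val := by
  have h : Primrec₂ fun (_ : BStr) (z : Bool × ℕ) => Nat.bit z.1 z.2 := by
    have : Primrec fun z : BStr × (Bool × ℕ) => (2 * z.2.2 + cond z.2.1 1 0) :=
      Primrec.nat_add.comp (Primrec.nat_mul.comp (Primrec.const 2)
        (Primrec.snd.comp Primrec.snd))
        (Primrec.cond (Primrec.fst.comp Primrec.snd) (Primrec.const 1) (Primrec.const 0))
    refine this.of_eq fun z => ?_
    obtain ⟨_, b, m⟩ := z
    cases b <;> simp [Nat.bit]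
  exact Primrec.list_foldr Primrec.id (Primrec.const 0) h

theorem bits_primrec : Primrec Nat.bits := by
  have hg : Primrec₂ fun (_ : Unit) (l : List (List Bool)) =>
      (some (if l.length = 0 then [] else
        (Nat.bodd l.length) :: (l.getD (l.length / 2) [])) : Option (List Bool)) := by
    have hl : Primrec fun z : Unit × List (List Bool) => z.2.length :=
      Primrec.list_length.comp Primrec.snd
    refine Primrec.option_some.comp (Primrec.ite
      (Primrec.eq.comp hl (Primrec.const 0)) (Primrec.const []) ?_)
    exact Primrec.list_cons.comp (Primrec.nat_bodd.comp hl)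
      ((Primrec.list_getD []).comp Primrec.snd (Primrec.nat_div.comp hl (Primrec.const 2)))
  have := Primrec.nat_strong_rec (fun (_ : Unit) n => Nat.bits n) hg (fun _ n => by
    simp only [List.length_map, List.length_range]
    rcases Nat.eq_zero_or_pos n with rfl | h
    · simp
    · rw [if_neg (by omega)]
      have h2 : n / 2 < n := by omega
      simp only [List.getD_eq_getElem?_getD, List.getElem?_map, List.getElem?_range h2,
        Option.map_some, Option.getD_some]
      congr 1
      conv_rhs => rw [← Nat.bit_bodd_div2 n]
      rw [Nat.bits_append_bit, Nat.div2_val]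
      intro h0
      by_contra hb
      have := Nat.bit_bodd_div2 n
      rw [h0] at this
      simp at hb
      rw [hb] at this
      simp at this; omega)
  exact this.comp (Primrec.const ()) Primrec.id

theorem val_le_encode (s : BStr) : val s ≤ encode s := by
  induction s with
  | nil => simp [val]
  | cons b s ih =>
    rw [encode_list_cons]
    change Nat.bit b (val s) ≤ _
    have h1 : Nat.bit b (val s) ≤ 2 * encode s + encode b := by
      cases b <;> simp [Nat.bit] <;> omega
    refine h1.trans ?_
    have hb : encode b ≤ 1 := by cases b <;> simp
    generalize encode s = m at *
    generalize encode b = e at *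
    rw [Nat.pair]
    split_ifs with h
    · simp; nlinarith [Nat.zero_le ((m-1)*(m-1)), mul_self_nonneg ((m:ℤ)-1)]
    · have : m ≤ 1 := by omega
      interval_cases m <;> interval_cases e <;> simp_all

theorem encode_le_of_mem {α : Type*} [Encodable α] {a : α} {l : List α} (h : a ∈ l) :
    encode a < encode l := by
  induction l with
  | nil => simp at h
  | cons b l ih =>
    rw [encode_list_cons]
    rcases List.mem_cons.1 h with rfl | h
    · exact Nat.lt_succ_of_le (Nat.left_le_pair _ _)
    · exact (ih h).trans_le ((Nat.right_le_pair _ _).trans (Nat.le_succ _))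

/-- strings with code below `t`. -/
def strs (t : ℕ) : List BStr := (List.range t).filterMap (decode₂ BStr)

theorem strs_primrec : Primrec strs :=
  Primrec.listFilterMap Primrec.list_range (Primrec.decode₂.comp Primrec.snd).to₂

theorem mem_strs {t : ℕ} {s : BStr} : s ∈ strs t ↔ encode s < t := by
  simp [strs, decode₂_eq_some]

theorem strs_sorted (t : ℕ) : (strs t).Pairwise (fun a b => encode a < encode b) := by
  unfold strs
  rw [List.pairwise_filterMap]
  refine List.Pairwise.imp ?_ (List.pairwise_lt_range (n := t))
  intro a b hab s hs s' hs'
  rw [decode₂_eq_some] at hs hs'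
  omega

theorem strs_nodup (t : ℕ) : (strs t).Nodup :=
  (strs_sorted t).imp (fun h e => by subst e; omega)

theorem encode_finset (S : Finset BStr) : ∃ l : List BStr, encode S = encode l ∧ l.Nodup ∧
    l.toFinset = S := by
  refine ⟨S.val.sort (Order.Preimage (Encodable.encode' BStr) (· ≤ ·)), rfl, ?_, ?_⟩
  · have := S.nodup
    rw [← Multiset.sort_eq S.val (Order.Preimage (Encodable.encode' BStr) (· ≤ ·))] at this
    exact this
  · ext a
    simp

theorem encode_toFinset (l : List BStr) (h : l.Pairwise (fun a b => encode a < encode b)) :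
    encode l.toFinset = encode l := by
  have : encode l.toFinset = encode (l.toFinset.val.sort (Order.Preimage (Encodable.encode' BStr) (· ≤ ·))) := rfl
  rw [this]
  congr 1
  have hn : l.Nodup := h.imp (fun h e => by subst e; omega)
  have hv : l.toFinset.val = (l : Multiset BStr) := by
    rw [List.toFinset_val, List.dedup_eq_self.2 hn]
  rw [hv]
  refine List.Perm.eq_of_pairwise' (r := (Order.Preimage (Encodable.encode' BStr) (· ≤ ·))) ?_ ?_ ?_
  · exact Multiset.pairwise_sort _ _
  · exact h.imp (fun h => le_of_lt h)
  · rw [← Multiset.coe_eq_coe, Multiset.sort_eq]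

end VV

namespace VV
open Encodable

theorem exists_ev (U : UniversalPrefixMachine) : ∃ ev : ℕ → BStr → BStr → Option BStr,
    Primrec (fun z : ℕ × BStr × BStr => ev z.1 z.2.1 z.2.2) ∧
    (∀ t t' p y x, t ≤ t' → ev t p y = some x → ev t' p y = some x) ∧
    (∀ p y x, x ∈ U.eval p y ↔ ∃ t, ev t p y = some x) := by
  obtain ⟨c, hc⟩ := Nat.Partrec.Code.exists_code.1 U.partrec'
  refine ⟨fun t p y => (Nat.Partrec.Code.evaln t c (encode (p, y))).bind decode, ?_, ?_, ?_⟩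
  · refine Primrec.option_bind ?_ (Primrec.decode.comp Primrec.snd).to₂
    exact Nat.Partrec.Code.primrec_evaln.comp
      ((Primrec.fst.pair (Primrec.const c)).pair (Primrec.encode.comp Primrec.snd))
  · intro t t' p y x ht h
    rw [Option.bind_eq_some_iff] at h ⊢
    obtain ⟨m, h1, h2⟩ := h
    exact ⟨m, Nat.Partrec.Code.evaln_mono ht h1, h2⟩
  · intro p y x
    have key : ∀ m, (∃ t, Nat.Partrec.Code.evaln t c (encode (p, y)) = some m) ↔
        ∃ x' ∈ U.eval p y, encode x' = m := by
      intro m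
      have := @Nat.Partrec.Code.evaln_complete c (encode (p, y)) m
      rw [hc] at this
      simp only [Option.mem_def] at this
      rw [← this]
      simp
    constructor
    · intro h
      obtain ⟨t, ht⟩ := (key (encode x)).2 ⟨x, h, rfl⟩
      exact ⟨t, by simp only [ht]; exact encodek x⟩
    · rintro ⟨t, ht⟩
      rw [Option.bind_eq_some_iff] at ht
      obtain ⟨m, h1, h2⟩ := ht
      obtain ⟨x', hx', rfl⟩ := (key m).1 ⟨t, h1⟩
      rw [encodek] at h2
      cases h2
      exact hx'

theorem machine (U : UniversalPrefixMachine) (g : BStr → BStr → ℕ → Option BStr)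
    (hg : Primrec fun z : (BStr × BStr) × ℕ => g z.1.1 z.1.2 z.2)
    (hu : ∀ y p p' n n' a a', g p y n = some a → g p' y n' = some a' → p <+: p' →
      p = p' ∧ a = a') :
    ∃ c : ℕ, ∀ p y n a, g p y n = some a → ∃ p', p'.length = p.length + c ∧ a ∈ U.eval p' y := by
  let M : PrefixMachine :=
    { eval := fun p y => Nat.rfindOpt (g p y)
      partrec' := Partrec.rfindOpt (f := fun z : BStr × BStr => g z.1 z.2) hg.to_comp
      prefixFree := by
        intro y p q hp hq hpq
        rw [Nat.rfindOpt_dom] at hp hq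
        obtain ⟨n, a, h⟩ := hp
        obtain ⟨n', a', h'⟩ := hq
        exact (hu y p q n n' a a' h h' hpq).1 }
  obtain ⟨s, hs⟩ := U.universal M
  refine ⟨s.length, fun p y n a h => ⟨s ++ p, by simp [add_comm], ?_⟩⟩
  rw [hs]
  change a ∈ Nat.rfindOpt (g p y)
  have hd : (Nat.rfindOpt (g p y)).Dom := Nat.rfindOpt_dom.2 ⟨n, a, h⟩
  obtain ⟨b, hb⟩ := Part.dom_iff_mem.1 hd
  obtain ⟨n', hn'⟩ := Nat.rfindOpt_spec hb
  have := (hu y p p n n' a b h hn' List.prefix_rfl).2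
  rw [this]; exact hb

theorem exists_val (q : ℕ) : ∀ r < 2 ^ q, ∃ v : BStr, v.length = q ∧ val v = r := by
  induction q with
  | zero => intro r hr; exact ⟨[], rfl, by simp [val]; omega⟩
  | succ q ih =>
    intro r hr
    obtain ⟨v, h1, h2⟩ := ih r.div2 (by rw [Nat.div2_val]; omega)
    refine ⟨r.bodd :: v, by simp [h1], ?_⟩
    change Nat.bit r.bodd (val v) = r
    rw [h2, Nat.bit_bodd_div2]

/-- self-delimiting code -/
def sd (u v : BStr) : BStr := u.map (fun _ => true) ++ (false :: (u ++ v))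

theorem sd_length (u v : BStr) : (sd u v).length = 2 * u.length + 1 + v.length := by
  simp [sd]; ring

theorem sd_primrec : Primrec₂ sd := by
  refine Primrec.list_append.comp (Primrec.list_map Primrec.fst (Primrec.const true).to₂)
    (Primrec.list_cons.comp (Primrec.const false)
      (Primrec.list_append.comp Primrec.fst Primrec.snd))

theorem rep_pfx : ∀ (a b x y : BStr),
    a.map (fun _ => true) ++ (false :: x) <+: b.map (fun _ => true) ++ (false :: y) →
    a.length = b.length ∧ x <+: y
  | [], [], x, y, h => by simpa using h
  | [], _ :: b, x, y, h => by simp at h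
  | _ :: a, [], x, y, h => by simp at h
  | _ :: a, _ :: b, x, y, h => by
    simp only [List.map_cons, List.cons_append, List.cons_prefix_cons, true_and] at h
    obtain ⟨h1, h2⟩ := rep_pfx a b x y h
    exact ⟨by simp [h1], h2⟩

theorem sd_pfx {u v u' v' : BStr} (h : sd u v <+: sd u' v') : u = u' ∧ v <+: v' := by
  obtain ⟨h1, t, ht⟩ := rep_pfx _ _ _ _ h
  rw [List.append_assoc] at ht
  obtain ⟨h2, h3⟩ := List.append_inj ht h1
  exact ⟨h2, t, h3⟩

/-- first occurrence -/
def isNew (f : ℕ → Option BStr) (j : ℕ) : Prop := ∀ i ∈ List.range j, f i ≠ f j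

noncomputable def rank (f : ℕ → Option BStr) (j : ℕ) : ℕ :=
  ((List.range j).filter (fun i => decide (f i ≠ none ∧ isNew f i))).length

theorem rank_eq (f : ℕ → Option BStr) (j : ℕ) :
    rank f j = ((Finset.range j).filter (fun i => f i ≠ none ∧ isNew f i)).card := by
  rw [rank, ← List.toFinset_card_of_nodup (List.nodup_range.filter _)]
  congr 1
  ext i
  simp

theorem rank_lt (f : ℕ → Option BStr) {j j' : ℕ} (h : j < j') (h1 : f j ≠ none) (h2 : isNew f j) :
    rank f j < rank f j' := by
  rw [rank_eq, rank_eq]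
  apply Finset.card_lt_card
  rw [Finset.ssubset_iff_of_subset]
  · exact ⟨j, by simp only [Finset.mem_filter, Finset.mem_range]; exact ⟨h, h1, h2⟩, by simp⟩
  · intro i; simp only [Finset.mem_filter, Finset.mem_range]
    rintro ⟨a, b⟩; exact ⟨by omega, b⟩

theorem rank_bound (f : ℕ → Option BStr) (q : ℕ)
    (hV : ∀ V : Finset BStr, (∀ v ∈ V, ∃ j, f j = some v) → V.card ≤ 2 ^ q)
    {j : ℕ} (h1 : f j ≠ none) (h2 : isNew f j) : rank f j < 2 ^ q := by
  refine (rank_lt f (Nat.lt_succ_self j) h1 h2).trans_le ?_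
  rw [rank_eq]
  set I := (Finset.range (j + 1)).filter (fun i => f i ≠ none ∧ isNew f i) with hI
  have hinj : Set.InjOn (fun i => (f i).getD []) I := by
    intro a ha b hb hab
    simp only [hI, Finset.coe_filter, Set.mem_ofPred_eq] at ha hb
    obtain ⟨x, hx⟩ := Option.ne_none_iff_exists'.1 ha.2.1
    obtain ⟨y, hy⟩ := Option.ne_none_iff_exists'.1 hb.2.1
    simp only [hx, hy, Option.getD_some] at hab
    subst hab
    rcases lt_trichotomy a b with h | h | h
    · exact absurd (hx.trans hy.symm) (hb.2.2 a (List.mem_range.2 h))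
    · exact h
    · exact absurd (hy.trans hx.symm) (ha.2.2 b (List.mem_range.2 h))
  rw [← Finset.card_image_of_injOn hinj]
  apply hV
  intro v hv
  obtain ⟨i, hi, rfl⟩ := Finset.mem_image.1 hv
  simp only [hI, Finset.mem_filter] at hi
  obtain ⟨x, hx⟩ := Option.ne_none_iff_exists'.1 hi.2.1
  exact ⟨i, by simp [hx]⟩

theorem new_primrec {α : Type} [Primcodable α] (f : α → BStr → ℕ → Option BStr)
    (hf : Primrec fun z : (α × BStr) × ℕ => f z.1.1 z.1.2 z.2) :
    PrimrecPred fun z : (α × BStr) × ℕ => isNew (f z.1.1 z.1.2) z.2 := by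
    refine allP (f := fun z : (α × BStr) × ℕ => List.range z.2)
      (p := fun z i => f z.1.1 z.1.2 i ≠ f z.1.1 z.1.2 z.2)
      (Primrec.list_range.comp Primrec.snd) ?_
    refine PrimrecPred.not (Primrec.eq.comp ?_ ?_)
    · exact hf.comp ((Primrec.fst.comp Primrec.fst).pair Primrec.snd)
    · exact hf.comp Primrec.fst

theorem rank_primrec {α : Type} [Primcodable α] (f : α → BStr → ℕ → Option BStr)
    (hf : Primrec fun z : (α × BStr) × ℕ => f z.1.1 z.1.2 z.2) :
    Primrec fun z : (α × BStr) × ℕ => rank (f z.1.1 z.1.2) z.2 := by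
    refine Primrec.list_length.comp (filterP
      (p := fun (z : (α × BStr) × ℕ) i => f z.1.1 z.1.2 i ≠ none ∧ isNew (f z.1.1 z.1.2) i)
      (Primrec.list_range.comp Primrec.snd) ?_)
    have h1 : Primrec fun z : ((α × BStr) × ℕ) × ℕ => (z.1.1, z.2) :=
      (Primrec.fst.comp Primrec.fst).pair Primrec.snd
    exact (PrimrecPred.not (Primrec.eq.comp (hf.comp h1) (Primrec.const none))).and ((new_primrec f hf).comp h1)

set_option maxHeartbeats 1600000 in
theorem enum_lemma (U : UniversalPrefixMachine) {α : Type} [Primcodable α]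
    (f : α → BStr → ℕ → Option BStr)
    (hf : Primrec fun z : (α × BStr) × ℕ => f z.1.1 z.1.2 z.2) :
    ∃ c : ℕ, ∀ w y q,
      (∀ V : Finset BStr, (∀ v ∈ V, ∃ j, f w y j = some v) → V.card ≤ 2 ^ q) →
      ∀ j v, f w y j = some v →
      ∃ p, p.length ≤ q + 2 * Nat.size (encode (q, w)) + c ∧ v ∈ U.eval p y := by
  let g : BStr → BStr → ℕ → Option BStr := fun p y N =>
    (decode (α := BStr × BStr × ℕ) N).bind fun z =>
      (decode (α := ℕ × α) (val z.1)).bind fun qw =>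
        if sd z.1 z.2.1 = p ∧ z.2.1.length = qw.1 ∧ isNew (f qw.2 y) z.2.2 ∧
          rank (f qw.2 y) z.2.2 = val z.2.1 then f qw.2 y z.2.2 else none
  have gspec : ∀ p y N a, g p y N = some a ↔ ∃ u v j q w,
      decode (α := BStr × BStr × ℕ) N = some (u, v, j) ∧
      decode (α := ℕ × α) (val u) = some (q, w) ∧ sd u v = p ∧ v.length = q ∧ 
      isNew (f w y) j ∧ rank (f w y) j = val v ∧ f w y j = some a := by
    intro p y N a
    simp only [g, Option.bind_eq_some_iff, Option.ite_none_right_eq_some]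
    constructor
    · rintro ⟨⟨u, v, j⟩, h1, ⟨q, w⟩, h2, ⟨h3, h4, h5, h6⟩, h7⟩
      exact ⟨u, v, j, q, w, h1, h2, h3, h4, h5, h6, h7⟩
    · rintro ⟨u, v, j, q, w, h1, h2, h3, h4, h5, h6, h7⟩
      exact ⟨⟨u, v, j⟩, h1, ⟨q, w⟩, h2, ⟨h3, h4, h5, h6⟩, h7⟩
  have hnew := new_primrec f hf
  have hrank := rank_primrec f hf
  have hg : Primrec fun z : (BStr × BStr) × ℕ => g z.1.1 z.1.2 z.2 := by
    refine Primrec.option_bind (Primrec.decode.comp Primrec.snd) ?_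
    refine Primrec.option_bind (Primrec.decode.comp (val_primrec.comp
      (Primrec.fst.comp Primrec.snd))) ?_
    have hz : Primrec fun x : (((BStr × BStr) × ℕ) × (BStr × BStr × ℕ)) × (ℕ × α) =>
        ((x.2.2, x.1.1.1.2), x.1.2.2.2) :=
      ((Primrec.snd.comp Primrec.snd).pair (Primrec.snd.comp (Primrec.fst.comp
        (Primrec.fst.comp Primrec.fst)))).pair
        (Primrec.snd.comp (Primrec.snd.comp (Primrec.snd.comp Primrec.fst)))
    have hu : Primrec fun x : (((BStr × BStr) × ℕ) × (BStr × BStr × ℕ)) × (ℕ × α) => x.1.2.1 :=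
      Primrec.fst.comp (Primrec.snd.comp Primrec.fst)
    have hv : Primrec fun x : (((BStr × BStr) × ℕ) × (BStr × BStr × ℕ)) × (ℕ × α) => x.1.2.2.1 :=
      Primrec.fst.comp (Primrec.snd.comp (Primrec.snd.comp Primrec.fst))
    have k1 : PrimrecPred fun x : (((BStr × BStr) × ℕ) × (BStr × BStr × ℕ)) × (ℕ × α) => sd x.1.2.1 x.1.2.2.1 = x.1.1.1.1 :=
      Primrec.eq.comp (sd_primrec.comp hu hv) (Primrec.fst.comp
        (Primrec.fst.comp (Primrec.fst.comp Primrec.fst)))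
    have k2 : PrimrecPred fun x : (((BStr × BStr) × ℕ) × (BStr × BStr × ℕ)) × (ℕ × α) => x.1.2.2.1.length = x.2.1 :=
      Primrec.eq.comp (Primrec.list_length.comp hv) (Primrec.fst.comp Primrec.snd)
    have k3 : PrimrecPred fun x : (((BStr × BStr) × ℕ) × (BStr × BStr × ℕ)) × (ℕ × α) => isNew (f x.2.2 x.1.1.1.2) x.1.2.2.2 :=
      hnew.comp hz
    have k4' : Primrec fun x : (((BStr × BStr) × ℕ) × (BStr × BStr × ℕ)) × (ℕ × α) => rank (f x.2.2 x.1.1.1.2) x.1.2.2.2 :=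
      hrank.comp hz
    have k4 : PrimrecPred fun x : (((BStr × BStr) × ℕ) × (BStr × BStr × ℕ)) × (ℕ × α) =>
        rank (f x.2.2 x.1.1.1.2) x.1.2.2.2 = val x.1.2.2.1 :=
      Primrec.eq.comp k4' (val_primrec.comp hv)
    have k5 : Primrec fun x : (((BStr × BStr) × ℕ) × (BStr × BStr × ℕ)) × (ℕ × α) => f x.2.2 x.1.1.1.2 x.1.2.2.2 := hf.comp hz
    exact Primrec.ite (k1.and (k2.and (k3.and k4))) k5 (Primrec.const none)
  obtain ⟨c, hc⟩ := machine U g hg (by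
    intro y p p' n n' a a' h h' hp
    obtain ⟨u, v, j, q, w, h1, h2, h3, h4, h5, h6, h7⟩ := (gspec _ _ _ _).1 h
    obtain ⟨u', v', j', q', w', h1', h2', h3', h4', h5', h6', h7'⟩ := (gspec _ _ _ _).1 h'
    subst h3 h3'
    obtain ⟨rfl, hv⟩ := sd_pfx hp
    rw [h2] at h2'
    cases h2'
    have hvv : v = v' := hv.eq_of_length (by omega)
    subst hvv
    refine ⟨rfl, ?_⟩
    have hjj : j = j' := by
      rcases lt_trichotomy j j' with hl | hl | hl
      · have := rank_lt (f w y) hl (by simp [h7]) h5; omega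
      · exact hl
      · have := rank_lt (f w y) hl (by simp [h7']) h5'; omega
    subst hjj
    rw [h7] at h7'
    exact Option.some.inj h7')
  refine ⟨c + 1, fun w y q hV j v hj => ?_⟩
  have hex : ∃ j, f w y j = some v := ⟨j, hj⟩
  have hj0 := Nat.find_spec hex
  have hmin := fun i => Nat.find_min hex (m := i)
  set j0 := Nat.find hex
  have hn : isNew (f w y) j0 := by
    intro i hi
    rw [hj0]
    exact hmin i (List.mem_range.1 hi)
  obtain ⟨v', h1, h2⟩ := exists_val q _ (rank_bound (f w y) q hV (by simp [hj0]) hn)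
  obtain ⟨p', hp', hpU⟩ := hc (sd (Nat.bits (encode (q, w))) v') y
    (encode (Nat.bits (encode (q, w)), v', j0)) v
    ((gspec _ _ _ _).2 ⟨_, v', j0, q, w, encodek _, by rw [val_bits, encodek], rfl, h1, hn,
      h2.symm, hj0⟩)
  refine ⟨p', ?_, hpU⟩
  rw [hp', sd_length, h1, ← Nat.size_eq_bits_len]
  omega

theorem concat_lemma (U : UniversalPrefixMachine) : ∃ c : ℕ, ∀ p1 p2 s x,
    s ∈ U.eval p1 [] → x ∈ U.eval p2 s →
    ∃ p, p.length = p1.length + p2.length + c ∧ x ∈ U.eval p [] := by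
  obtain ⟨ev, hev, hmono, hspec⟩ := exists_ev U
  let g : BStr → BStr → ℕ → Option BStr := fun p _ N =>
    (decode (α := BStr × BStr × BStr × ℕ) N).bind fun z =>
      if z.1 ++ z.2.1 = p ∧ ev z.2.2.2 z.1 [] = some z.2.2.1 then ev z.2.2.2 z.2.1 z.2.2.1
      else none
  have gspec : ∀ p y N a, g p y N = some a ↔ ∃ p1 p2 s t,
      decode (α := BStr × BStr × BStr × ℕ) N = some (p1, p2, s, t) ∧ p1 ++ p2 = p ∧
        ev t p1 [] = some s ∧ ev t p2 s = some a := by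
    intro p y N a
    simp only [g, Option.bind_eq_some_iff, Option.ite_none_right_eq_some]
    constructor
    · rintro ⟨⟨p1, p2, s, t⟩, h1, ⟨h2, h3⟩, h4⟩
      exact ⟨p1, p2, s, t, h1, h2, h3, h4⟩
    · rintro ⟨p1, p2, s, t, h1, h2, h3, h4⟩
      exact ⟨⟨p1, p2, s, t⟩, h1, ⟨h2, h3⟩, h4⟩
  have hg : Primrec fun z : (BStr × BStr) × ℕ => g z.1.1 z.1.2 z.2 := by
    refine Primrec.option_bind (Primrec.decode.comp Primrec.snd) ?_
    have h1 : Primrec fun x : ((BStr × BStr) × ℕ) × (BStr × BStr × BStr × ℕ) => x.2.1 :=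
      Primrec.fst.comp Primrec.snd
    have h2 : Primrec fun x : ((BStr × BStr) × ℕ) × (BStr × BStr × BStr × ℕ) => x.2.2.1 :=
      Primrec.fst.comp (Primrec.snd.comp Primrec.snd)
    have h3 : Primrec fun x : ((BStr × BStr) × ℕ) × (BStr × BStr × BStr × ℕ) => x.2.2.2.1 :=
      Primrec.fst.comp (Primrec.snd.comp (Primrec.snd.comp Primrec.snd))
    have h4 : Primrec fun x : ((BStr × BStr) × ℕ) × (BStr × BStr × BStr × ℕ) => x.2.2.2.2 :=
      Primrec.snd.comp (Primrec.snd.comp (Primrec.snd.comp Primrec.snd))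
    exact Primrec.ite ((Primrec.eq.comp (Primrec.list_append.comp h1 h2)
      (Primrec.fst.comp (Primrec.fst.comp Primrec.fst))).and
      (Primrec.eq.comp (hev.comp (h4.pair (h1.pair (Primrec.const []))))
        (Primrec.option_some.comp h3)))
      (hev.comp (h4.pair (h2.pair h3))) (Primrec.const none)
  obtain ⟨c, hc⟩ := machine U g hg (by
    intro y p p' n n' a a' h h' hp
    obtain ⟨p1, p2, s, t, -, rfl, h3, h4⟩ := (gspec _ y _ _).1 h
    obtain ⟨p1', p2', s', t', -, rfl, h3', h4'⟩ := (gspec _ y _ _).1 h'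
    have e1 : s ∈ U.eval p1 [] := (hspec _ _ _).2 ⟨_, h3⟩
    have e2 : s' ∈ U.eval p1' [] := (hspec _ _ _).2 ⟨_, h3'⟩
    have e3 : a ∈ U.eval p2 s := (hspec _ _ _).2 ⟨_, h4⟩
    have e4 : a' ∈ U.eval p2' s' := (hspec _ _ _).2 ⟨_, h4'⟩
    have hpp : p1 = p1' := by
      rcases List.prefix_or_prefix_of_prefix ((List.prefix_append p1 p2).trans hp)
        (List.prefix_append p1' p2') with hh | hh
      · exact U.prefixFree _ _ _ (Part.dom_iff_mem.2 ⟨_, e1⟩) (Part.dom_iff_mem.2 ⟨_, e2⟩) hh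
      · exact (U.prefixFree _ _ _ (Part.dom_iff_mem.2 ⟨_, e2⟩) (Part.dom_iff_mem.2 ⟨_, e1⟩) hh).symm
    subst hpp
    have hs := Part.mem_unique e1 e2
    subst hs
    have h22 : p2 = p2' := U.prefixFree _ _ _ (Part.dom_iff_mem.2 ⟨_, e3⟩)
      (Part.dom_iff_mem.2 ⟨_, e4⟩) ((List.prefix_append_right_inj p1).1 hp)
    subst h22
    exact ⟨rfl, Part.mem_unique e3 e4⟩)
  refine ⟨c, fun p1 p2 s x h1 h2 => ?_⟩
  obtain ⟨t1, ht1⟩ := (hspec _ _ _).1 h1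
  obtain ⟨t2, ht2⟩ := (hspec _ _ _).1 h2
  obtain ⟨p, hp, hx⟩ := hc (p1 ++ p2) [] (encode (p1, p2, s, max t1 t2)) x
    ((gspec _ [] _ _).2 ⟨p1, p2, s, max t1 t2, encodek _, rfl,
      hmono _ _ _ _ _ (le_max_left _ _) ht1, hmono _ _ _ _ _ (le_max_right _ _) ht2⟩)
  exact ⟨p, by rw [hp]; simp, hx⟩

theorem card_len (n : ℕ) (V : Finset BStr) (h : ∀ v ∈ V, v.length = n) : V.card ≤ 2 ^ n := by
  have h1 : V ⊆ (Finset.univ : Finset (List.Vector Bool n)).image (fun v => v.1) := by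
    intro v hv
    exact Finset.mem_image.2 ⟨⟨v, h v hv⟩, Finset.mem_univ _, rfl⟩
  refine (Finset.card_le_card h1).trans (Finset.card_image_le.trans ?_)
  simp [card_vector]

theorem len_lemma (U : UniversalPrefixMachine) : ∃ c : ℕ, ∀ x y : BStr,
    ∃ p, p.length ≤ x.length + 2 * Nat.size (encode (x.length, x.length)) + c ∧ x ∈ U.eval p y := by
  obtain ⟨c, hc⟩ := enum_lemma U (α := ℕ) (fun n _ j => (decode (α := BStr) j).bind fun v =>
    if v.length = n then some v else none) (by
      refine Primrec.option_bind (Primrec.decode.comp Primrec.snd) ?_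
      exact Primrec.ite (Primrec.eq.comp (Primrec.list_length.comp Primrec.snd)
        (Primrec.fst.comp (Primrec.fst.comp Primrec.fst))) (Primrec.option_some.comp Primrec.snd)
        (Primrec.const none))
  refine ⟨c, fun x y => hc x.length y x.length (fun V hV => ?_) (encode x) x (by simp)⟩
  apply card_len
  intro v hv
  obtain ⟨j, hj⟩ := hV v hv
  simp only [Option.bind_eq_some_iff, Option.ite_none_right_eq_some] at hj
  obtain ⟨a, _, h, h'⟩ := hj
  cases h'; exact h

theorem Kc_le (U : UniversalPrefixMachine) {x y p : BStr} (h : x ∈ U.eval p y) :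
    U.Kc x y ≤ p.length := Nat.sInf_le ⟨p, rfl, h⟩

theorem Kc_spec (U : UniversalPrefixMachine) (x y : BStr) :
    ∃ p : BStr, p.length = U.Kc x y ∧ x ∈ U.eval p y := by
  obtain ⟨c, hc⟩ := len_lemma U
  obtain ⟨p, -, hp⟩ := hc x y
  exact Nat.sInf_mem (s := {n | ∃ p : BStr, p.length = n ∧ x ∈ U.eval p y}) ⟨_, p, rfl, hp⟩

end VV

namespace VV
open Encodable

/-- decoded list -/
def dl (s : BStr) : List BStr := (decode₂ (List BStr) (val s)).getD []

def Rel (n l : ℕ) (s x : BStr) : Prop :=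
  x ∈ dl s ∧ x.length = n ∧ ((dl s).filter (fun y => decide (y.length = n))).length ≤ 2 ^ l

def isOut (ev : ℕ → BStr → BStr → Option BStr) (a t : ℕ) (s : BStr) : Prop :=
  encode s < t ∧ ∃ p ∈ strs t, p.length = a ∧ ev t p [] = some s

noncomputable def outs (ev : ℕ → BStr → BStr → Option BStr) (a t : ℕ) : List BStr :=
  (strs t).filter (fun s => decide (isOut ev a t s))

noncomputable def cnt (ev : ℕ → BStr → BStr → Option BStr) (a t : ℕ) : ℕ := (outs ev a t).length

noncomputable def mulL (ev : ℕ → BStr → BStr → Option BStr) (n l a t : ℕ) (x : BStr) : List BStr :=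
  (outs ev a t).filter (fun s => decide (Rel n l s x))

noncomputable def mult (ev : ℕ → BStr → BStr → Option BStr) (n l a t : ℕ) (x : BStr) : ℕ :=
  (mulL ev n l a t x).length

def chk (ev : ℕ → BStr → BStr → Option BStr) (a r t : ℕ) : Prop :=
  cnt ev a (t - 1) / 2 ^ r < cnt ev a t / 2 ^ r

noncomputable def Dl (ev : ℕ → BStr → BStr → Option BStr) (n l a r t : ℕ) : List BStr :=
  (strs t).filter (fun x => decide (2 ^ r ≤ mult ev n l a t x ∧
    ∀ t' ∈ List.range t, chk ev a r t' → mult ev n l a t' x < 2 ^ r))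

def prd (ev : ℕ → BStr → BStr → Option BStr) (n l k a r t : ℕ) (x s : BStr) : Prop :=
  isOut ev k t x ∧ isOut ev a t s ∧ Rel n l s x ∧ mult ev n l a t x < 2 ^ (r + 2)

noncomputable def Wl (ev : ℕ → BStr → BStr → Option BStr) (n l k a r T : ℕ) (s : BStr) :
    List BStr :=
  (strs T).filter (fun x => decide (∃ t ∈ List.range (T + 1), prd ev n l k a r t x s))

section prim
variable {α : Type} [Primcodable α]

theorem dl_pr : Primrec dl :=
  Primrec.option_getD.comp (Primrec.decode₂.comp val_primrec) (Primrec.const [])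

theorem Rel_pr {n l : α → ℕ} {s x : α → BStr} (hn : Primrec n) (hl : Primrec l)
    (hs : Primrec s) (hx : Primrec x) : PrimrecPred fun z => Rel (n z) (l z) (s z) (x z) := by
  have h1 : PrimrecPred fun z => x z ∈ dl (s z) := by
    refine (exP (f := fun z => dl (s z)) (p := fun z y => x z = y) (dl_pr.comp hs)
      (Primrec.eq.comp (hx.comp Primrec.fst) Primrec.snd)).of_eq fun z => ?_
    simp
  have h2 : PrimrecPred fun z => (x z).length = n z :=
    Primrec.eq.comp (Primrec.list_length.comp hx) hn
  have h3 : Primrec fun z => ((dl (s z)).filter (fun y => decide (y.length = n z))) :=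
    filterP (p := fun z (y : BStr) => y.length = n z) (dl_pr.comp hs)
      (Primrec.eq.comp (Primrec.list_length.comp Primrec.snd) (hn.comp Primrec.fst))
  exact h1.and (h2.and (Primrec.nat_le.comp (Primrec.list_length.comp h3) (pow2 hl)))

variable {ev : ℕ → BStr → BStr → Option BStr}
  (hev : Primrec (fun z : ℕ × BStr × BStr => ev z.1 z.2.1 z.2.2))
include hev

theorem isOut_pr {a t : α → ℕ} {s : α → BStr} (ha : Primrec a) (ht : Primrec t)
    (hs : Primrec s) : PrimrecPred fun z => isOut ev (a z) (t z) (s z) := by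
  have h1 : PrimrecPred fun z => encode (s z) < t z :=
    Primrec.nat_lt.comp (Primrec.encode.comp hs) ht
  have h3 : Primrec fun y : α × BStr => ev (t y.1) y.2 [] :=
    hev.comp ((ht.comp Primrec.fst).pair (Primrec.snd.pair (Primrec.const [])))
  have h2 : PrimrecPred fun z => ∃ p ∈ strs (t z), p.length = a z ∧ ev (t z) p [] = some (s z) :=
    exP (p := fun z (p : BStr) => p.length = a z ∧ ev (t z) p [] = some (s z))
      (strs_primrec.comp ht)
      ((Primrec.eq.comp (Primrec.list_length.comp Primrec.snd) (ha.comp Primrec.fst)).and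
        (Primrec.eq.comp h3 (Primrec.option_some.comp (hs.comp Primrec.fst))))
  exact h1.and h2

theorem outs_pr {a t : α → ℕ} (ha : Primrec a) (ht : Primrec t) :
    Primrec fun z => outs ev (a z) (t z) :=
  filterP (p := fun z s => isOut ev (a z) (t z) s) (strs_primrec.comp ht)
    (isOut_pr hev (ha.comp Primrec.fst) (ht.comp Primrec.fst) Primrec.snd)

theorem cnt_pr {a t : α → ℕ} (ha : Primrec a) (ht : Primrec t) :
    Primrec fun z => cnt ev (a z) (t z) := Primrec.list_length.comp (outs_pr hev ha ht)

theorem mult_pr {n l a t : α → ℕ} {x : α → BStr} (hn : Primrec n) (hl : Primrec l)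
    (ha : Primrec a) (ht : Primrec t) (hx : Primrec x) :
    Primrec fun z => mult ev (n z) (l z) (a z) (t z) (x z) :=
  Primrec.list_length.comp (filterP (p := fun z s => Rel (n z) (l z) s (x z)) (outs_pr hev ha ht)
    (Rel_pr (hn.comp Primrec.fst) (hl.comp Primrec.fst) Primrec.snd (hx.comp Primrec.fst)))

theorem chk_pr {a r t : α → ℕ} (ha : Primrec a) (hr : Primrec r) (ht : Primrec t) :
    PrimrecPred fun z => chk ev (a z) (r z) (t z) :=
  Primrec.nat_lt.comp
    (Primrec.nat_div.comp (cnt_pr hev ha (Primrec.nat_sub.comp ht (Primrec.const 1))) (pow2 hr))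
    (Primrec.nat_div.comp (cnt_pr hev ha ht) (pow2 hr))

theorem Dl_pr {n l a r t : α → ℕ} (hn : Primrec n) (hl : Primrec l)
    (ha : Primrec a) (hr : Primrec r) (ht : Primrec t) :
    Primrec fun z => Dl ev (n z) (l z) (a z) (r z) (t z) := by
  have h1 : PrimrecPred fun z : α × BStr =>
      2 ^ r z.1 ≤ mult ev (n z.1) (l z.1) (a z.1) (t z.1) z.2 :=
    Primrec.nat_le.comp (pow2 (hr.comp Primrec.fst)) (mult_pr hev (hn.comp Primrec.fst)
      (hl.comp Primrec.fst) (ha.comp Primrec.fst) (ht.comp Primrec.fst) Primrec.snd)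
  have f2 : Primrec fun z : (α × BStr) × ℕ => z.1.1 := Primrec.fst.comp Primrec.fst
  have h2 : PrimrecPred fun z : α × BStr => ∀ t' ∈ List.range (t z.1),
      (chk ev (a z.1) (r z.1) t' → mult ev (n z.1) (l z.1) (a z.1) t' z.2 < 2 ^ r z.1) :=
    allP (p := fun (z : α × BStr) t' =>
        (chk ev (a z.1) (r z.1) t' → mult ev (n z.1) (l z.1) (a z.1) t' z.2 < 2 ^ r z.1))
      (Primrec.list_range.comp (ht.comp Primrec.fst))
      (impP (chk_pr hev (ha.comp f2) (hr.comp f2) Primrec.snd)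
        (Primrec.nat_lt.comp (mult_pr hev (hn.comp f2) (hl.comp f2) (ha.comp f2) Primrec.snd
          (Primrec.snd.comp Primrec.fst)) (pow2 (hr.comp f2))))
  exact filterP (p := fun z x => 2 ^ r z ≤ mult ev (n z) (l z) (a z) (t z) x ∧
    ∀ t' ∈ List.range (t z), chk ev (a z) (r z) t' → mult ev (n z) (l z) (a z) t' x < 2 ^ r z)
    (strs_primrec.comp ht) (h1.and h2)

theorem prd_pr {n l k a r t : α → ℕ} {x s : α → BStr} (hn : Primrec n) (hl : Primrec l)
    (hk : Primrec k) (ha : Primrec a) (hr : Primrec r) (ht : Primrec t) (hx : Primrec x)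
    (hs : Primrec s) :
    PrimrecPred fun z => prd ev (n z) (l z) (k z) (a z) (r z) (t z) (x z) (s z) :=
  (isOut_pr hev hk ht hx).and ((isOut_pr hev ha ht hs).and ((Rel_pr hn hl hs hx).and
    (Primrec.nat_lt.comp (mult_pr hev hn hl ha ht hx)
      (pow2 (Primrec.nat_add.comp hr (Primrec.const 2))))))

theorem Wl_pr {n l k a r t : α → ℕ} {s : α → BStr} (hn : Primrec n) (hl : Primrec l)
    (hk : Primrec k) (ha : Primrec a) (hr : Primrec r) (ht : Primrec t)
    (hs : Primrec s) :
    Primrec fun z => Wl ev (n z) (l z) (k z) (a z) (r z) (t z) (s z) := by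
  have f2 : Primrec fun z : (α × BStr) × ℕ => z.1.1 := Primrec.fst.comp Primrec.fst
  refine filterP (p := fun z x => ∃ t' ∈ List.range (t z + 1),
    prd ev (n z) (l z) (k z) (a z) (r z) t' x (s z)) (strs_primrec.comp ht) ?_
  refine exP (p := fun (z : α × BStr) t' =>
    prd ev (n z.1) (l z.1) (k z.1) (a z.1) (r z.1) t' z.2 (s z.1))
    (Primrec.list_range.comp (Primrec.succ.comp (ht.comp Primrec.fst))) ?_
  exact prd_pr hev (hn.comp f2) (hl.comp f2) (hk.comp f2) (ha.comp f2) (hr.comp f2) Primrec.snd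
    (Primrec.snd.comp Primrec.fst) (hs.comp f2)
end prim

section comb
variable {ev : ℕ → BStr → BStr → Option BStr}
  (hmono : ∀ t t' p y x, t ≤ t' → ev t p y = some x → ev t' p y = some x)

theorem mem_outs {a t : ℕ} {s : BStr} : s ∈ outs ev a t ↔ isOut ev a t s := by
  simp only [outs, List.mem_filter, mem_strs, decide_eq_true_eq]
  exact ⟨fun h => h.2, fun h => ⟨h.1, h⟩⟩

theorem outs_nodup {a t : ℕ} : (outs ev a t).Nodup := (strs_nodup t).filter _

theorem mem_mulL {n l a t : ℕ} {x s : BStr} :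
    s ∈ mulL ev n l a t x ↔ isOut ev a t s ∧ Rel n l s x := by
  simp only [mulL, List.mem_filter, mem_outs, decide_eq_true_eq]

theorem mulL_nodup {n l a t : ℕ} {x : BStr} : (mulL ev n l a t x).Nodup := outs_nodup.filter _

theorem cnt_eq {a t : ℕ} : cnt ev a t = (outs ev a t).toFinset.card :=
  (List.toFinset_card_of_nodup outs_nodup).symm

theorem mult_eq {n l a t : ℕ} {x : BStr} :
    mult ev n l a t x = (mulL ev n l a t x).toFinset.card :=
  (List.toFinset_card_of_nodup mulL_nodup).symm

theorem outs_len {a t : ℕ} : cnt ev a t ≤ 2 ^ a := by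
  rw [cnt_eq]
  have h1 : (outs ev a t).toFinset ⊆
      ((strs t).toFinset.filter (fun p => p.length = a)).image (fun p => (ev t p []).getD []) := by
    intro s hs
    rw [List.mem_toFinset, mem_outs] at hs
    obtain ⟨-, p, hp, hl, he⟩ := hs
    refine Finset.mem_image.2 ⟨p, ?_, by simp [he]⟩
    simp [hp, hl]
  refine (Finset.card_le_card h1).trans (Finset.card_image_le.trans (card_len a _ ?_))
  simp

theorem mult_le_cnt {n l a t : ℕ} {x : BStr} : mult ev n l a t x ≤ cnt ev a t :=
  List.length_filter_le _ _

theorem encode_lt_of_Rel {n l : ℕ} {s x : BStr} (h : Rel n l s x) : encode x < encode s := by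
  have h1 := h.1
  unfold dl at h1
  cases hd : decode₂ (List BStr) (val s) with
  | none => simp [hd] at h1
  | some L =>
    simp only [hd, Option.getD_some] at h1
    have := encode_le_of_mem h1
    rw [decode₂_eq_some] at hd
    have := val_le_encode s
    omega

theorem mult_pos_spec {n l a t : ℕ} {x : BStr} (h : 0 < mult ev n l a t x) :
    encode x < t ∧ x.length = n := by
  obtain ⟨s, hs⟩ := List.length_pos_iff_exists_mem.1 h
  rw [mem_mulL] at hs
  exact ⟨(encode_lt_of_Rel hs.2).trans hs.1.1, hs.2.2.1⟩

theorem Rel_card {n l : ℕ} {s : BStr} (G : Finset BStr) (h : ∀ x ∈ G, Rel n l s x) :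
    G.card ≤ 2 ^ l := by
  rcases G.eq_empty_or_nonempty with rfl | ⟨x, hx⟩
  · simp
  · refine le_trans ?_ (h x hx).2.2
    have : G ⊆ ((dl s).filter (fun y => decide (y.length = n))).toFinset := by
      intro y hy
      have := h y hy
      simp [this.1, this.2.1]
    exact (Finset.card_le_card this).trans (List.toFinset_card_le _)

include hmono

theorem isOut_mono {a t t' : ℕ} {s : BStr} (h : t ≤ t') (hs : isOut ev a t s) :
    isOut ev a t' s := by
  obtain ⟨h1, p, hp, hl, he⟩ := hs
  rw [mem_strs] at hp
  exact ⟨by omega, p, mem_strs.2 (by omega), hl, hmono _ _ _ _ _ h he⟩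

theorem cnt_mono {a t t' : ℕ} (h : t ≤ t') : cnt ev a t ≤ cnt ev a t' := by
  rw [cnt_eq, cnt_eq]
  apply Finset.card_le_card
  intro s
  simp only [List.mem_toFinset, mem_outs]
  exact isOut_mono hmono h

theorem mult_mono {n l a t t' : ℕ} {x : BStr} (h : t ≤ t') :
    mult ev n l a t x ≤ mult ev n l a t' x := by
  rw [mult_eq, mult_eq]
  apply Finset.card_le_card
  intro s
  simp only [List.mem_toFinset, mem_mulL]
  exact fun hs => ⟨isOut_mono hmono h hs.1, hs.2⟩

theorem mult_diff {n l a t t' : ℕ} {x : BStr} (h : t ≤ t') :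
    mult ev n l a t' x + cnt ev a t ≤ mult ev n l a t x + cnt ev a t' := by
  have h1 : (mulL ev n l a t' x).toFinset ⊆ (mulL ev n l a t x).toFinset ∪
      ((outs ev a t').toFinset \ (outs ev a t).toFinset) := by
    intro s
    simp only [List.mem_toFinset, mem_mulL, Finset.mem_union, Finset.mem_sdiff, mem_outs]
    tauto
  have h2 : (outs ev a t).toFinset ⊆ (outs ev a t').toFinset := by
    intro s
    simp only [List.mem_toFinset, mem_outs]
    exact isOut_mono hmono h
  have h3 := (Finset.card_le_card h1).trans (Finset.card_union_le _ _)
  have h4 := Finset.card_sdiff_add_card_eq_card h2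
  rw [mult_eq, mult_eq, cnt_eq, cnt_eq]
  omega

omit hmono in
theorem bdd_max (u : ℕ → ℕ) (B : ℕ) (h : ∀ t, u t ≤ B) : ∃ t0, ∀ t, u t ≤ u t0 := by
  have hb : BddAbove (Set.range u) := ⟨B, by rintro _ ⟨t, rfl⟩; exact h t⟩
  obtain ⟨t0, h0⟩ := Nat.sSup_mem (Set.range_nonempty u) hb
  exact ⟨t0, fun t => by rw [h0]; exact le_csSup hb ⟨t, rfl⟩⟩

theorem exists_D {n l a r t0 : ℕ} {x : BStr}
    (hN : 2 * 2 ^ r ≤ mult ev n l a t0 x + 1) :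
    ∃ t, chk ev a r t ∧ x ∈ Dl ev n l a r t := by
  have hpos : 1 ≤ 2 ^ r := Nat.one_le_two_pow
  obtain ⟨t1', ht1'⟩ := bdd_max (fun t => cnt ev a t / 2 ^ r) (2 ^ a)
    (fun t => (Nat.div_le_self _ _).trans outs_len)
  have hex : ∃ t, cnt ev a t / 2 ^ r = cnt ev a t1' / 2 ^ r := ⟨t1', rfl⟩
  have hs := Nat.find_spec hex
  have hm := fun i => Nat.find_min hex (m := i)
  set t1 := Nat.find hex
  rw [← hs] at ht1' hm
  have hcnt0 : cnt ev a 0 = 0 := by simp [cnt, outs, strs]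
  have ht1 : 0 < t1 := by
    rcases Nat.eq_zero_or_pos t1 with h0 | h0
    · exfalso
      have h1 := ht1' t0
      rw [h0, hcnt0, Nat.zero_div] at h1
      have h2 : 1 ≤ cnt ev a t0 / 2 ^ r := by
        rw [Nat.le_div_iff_mul_le (by omega)]
        have := mult_le_cnt (ev := ev) (n := n) (l := l) (a := a) (t := t0) (x := x)
        omega
      omega
    · exact h0
  have hchk : chk ev a r t1 := by
    have h1 := hm (t1 - 1) (by omega)
    have h2 := ht1' (t1 - 1)
    unfold chk
    omega
  have hmult : 2 ^ r ≤ mult ev n l a t1 x := by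
    have h1 := ht1' (max t0 t1)
    have h2 := mult_diff hmono (n := n) (l := l) (a := a) (x := x) (le_max_right t0 t1)
    have h3 := mult_mono hmono (n := n) (l := l) (a := a) (x := x) (le_max_left t0 t1)
    have h4 : cnt ev a (max t0 t1) < 2 ^ r * (cnt ev a t1 / 2 ^ r) + 2 ^ r := by
      have := Nat.div_add_mod (cnt ev a (max t0 t1)) (2 ^ r)
      have h5 := Nat.mod_lt (cnt ev a (max t0 t1)) (y := 2 ^ r) (by omega)
      have h6 := Nat.mul_le_mul_left (2 ^ r) h1
      omega
    have h5 := Nat.mul_div_le (cnt ev a t1) (2 ^ r)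
    omega
  have hex2 : ∃ t, chk ev a r t ∧ 2 ^ r ≤ mult ev n l a t x := ⟨t1, hchk, hmult⟩
  have hs2 := Nat.find_spec hex2
  have hm2 := fun i => Nat.find_min hex2 (m := i)
  set t2 := Nat.find hex2
  refine ⟨t2, hs2.1, ?_⟩
  simp only [Dl, List.mem_filter, decide_eq_true_eq, mem_strs, List.mem_range]
  refine ⟨(mult_pos_spec (by omega : 0 < mult ev n l a t2 x)).1, hs2.2, ?_⟩
  intro t' ht' hc
  by_contra hcon
  exact hm2 t' ht' ⟨hc, by omega⟩

theorem chk_card {a r : ℕ} (I : Finset ℕ) (hI : ∀ t ∈ I, chk ev a r t) :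
    I.card * 2 ^ r ≤ 2 ^ a := by
  have hinj : Set.InjOn (fun t => cnt ev a t / 2 ^ r) I := by
    have key : ∀ t t', t < t' → t' ∈ I → cnt ev a t / 2 ^ r < cnt ev a t' / 2 ^ r := by
      intro t t' h h'
      have h1 := hI t' h'
      unfold chk at h1
      exact lt_of_le_of_lt (Nat.div_le_div_right (cnt_mono hmono (by omega))) h1
    intro t ht t' ht' he
    simp only at he
    rcases lt_trichotomy t t' with h | h | h
    · have := key t t' h ht'; omega
    · exact h
    · have := key t' t h ht; omega
  have h1 : I.image (fun t => cnt ev a t / 2 ^ r) ⊆ Finset.Icc 1 (2 ^ a / 2 ^ r) := by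
    intro m hm
    obtain ⟨t, ht, rfl⟩ := Finset.mem_image.1 hm
    have := hI t ht
    unfold chk at this
    rw [Finset.mem_Icc]
    exact ⟨Nat.succ_le_of_lt (lt_of_le_of_lt (Nat.zero_le _) this), Nat.div_le_div_right outs_len⟩
  have h2 := Finset.card_le_card h1
  rw [Finset.card_image_of_injOn hinj, Nat.card_Icc] at h2
  have h3 : I.card ≤ 2 ^ a / 2 ^ r := by simpa only [Nat.add_sub_cancel] using h2
  calc I.card * 2 ^ r ≤ (2 ^ a / 2 ^ r) * 2 ^ r := Nat.mul_le_mul_right _ h3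
    _ ≤ 2 ^ a := Nat.div_mul_le_self _ _

omit hmono in
theorem Dl_nodup {n l a r t : ℕ} : (Dl ev n l a r t).Nodup := (strs_nodup t).filter _

omit hmono in
theorem mem_Dl {n l a r t : ℕ} {x : BStr} (h : x ∈ Dl ev n l a r t) :
    2 ^ r ≤ mult ev n l a t x ∧ ∀ t' < t, chk ev a r t' → mult ev n l a t' x < 2 ^ r := by
  simp only [Dl, List.mem_filter, decide_eq_true_eq, List.mem_range] at h
  exact h.2

theorem D_card {n l a r σ : ℕ} (I : Finset ℕ) (hI : ∀ t ∈ I, chk ev a r t)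
    (hσ : ∀ t ∈ I, 2 ^ σ ≤ (Dl ev n l a r t).length) :
    I.card * 2 ^ σ * 2 ^ r ≤ 2 ^ a * 2 ^ l := by
  set G := I.biUnion (fun t => (Dl ev n l a r t).toFinset) with hG
  have hdisj : (I : Set ℕ).PairwiseDisjoint (fun t => (Dl ev n l a r t).toFinset) := by
    have key : ∀ t ∈ I, ∀ t' ∈ I, t < t' →
        Disjoint (Dl ev n l a r t).toFinset (Dl ev n l a r t').toFinset := by
      intro t ht t' ht' h
      rw [Finset.disjoint_left]
      intro x hx hx'
      rw [List.mem_toFinset] at hx hx'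
      have h1 := (mem_Dl hx).1
      have h2 := (mem_Dl hx').2 t h (hI t ht)
      omega
    intro t ht t' ht' hne
    rcases lt_or_gt_of_ne hne with h | h
    · exact key t ht t' ht' h
    · exact (key t' ht' t ht h).symm
  have h1 : I.card * 2 ^ σ ≤ G.card := by
    rw [hG, Finset.card_biUnion hdisj, ← smul_eq_mul]
    refine Finset.card_nsmul_le_sum _ _ _ fun t ht => ?_
    rw [List.toFinset_card_of_nodup Dl_nodup]
    exact hσ t ht
  set T := I.sup id
  have h2 : G.card * 2 ^ r ≤ (outs ev a T).toFinset.card * 2 ^ l := by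
    refine Finset.card_mul_le_card_mul (fun x s => Rel n l s x) ?_ ?_
    · intro x hx
      obtain ⟨t, ht, hx⟩ := Finset.mem_biUnion.1 hx
      rw [List.mem_toFinset] at hx
      refine (mem_Dl hx).1.trans ((mult_mono hmono (Finset.le_sup (f := id) ht)).trans ?_)
      rw [mult_eq]
      apply Finset.card_le_card
      intro s hs
      simp only [List.mem_toFinset, mem_mulL] at hs
      simp only [Finset.mem_bipartiteAbove, List.mem_toFinset, mem_outs]
      exact hs
    · intro s hs
      apply Rel_card (n := n) (s := s)
      intro x hx
      exact (Finset.mem_bipartiteBelow _).1 hx |>.2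
  rw [← cnt_eq] at h2
  calc _ ≤ G.card * 2 ^ r := Nat.mul_le_mul_right _ h1
    _ ≤ _ := h2.trans (Nat.mul_le_mul_right _ outs_len)

omit hmono in
theorem mem_Wl {n l k a r T : ℕ} {x s : BStr} :
    x ∈ Wl ev n l k a r T s ↔ ∃ t ≤ T, prd ev n l k a r t x s := by
  simp only [Wl, List.mem_filter, decide_eq_true_eq, List.mem_range, mem_strs, Nat.lt_succ_iff]
  constructor
  · exact fun h => h.2
  · rintro ⟨t, ht, h⟩
    exact ⟨h.1.1.trans_le ht, t, ht, h⟩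

omit hmono in
theorem Wl_nodup {n l k a r T : ℕ} {s : BStr} : (Wl ev n l k a r T s).Nodup :=
  (strs_nodup T).filter _

theorem Wl_le {n l k a r T : ℕ} {s : BStr} : (Wl ev n l k a r T s).length ≤ 2 ^ k := by
  rw [← List.toFinset_card_of_nodup Wl_nodup]
  refine le_trans (Finset.card_le_card ?_) ((cnt_eq (ev := ev) (a := k) (t := T)).symm.le.trans
    outs_len)
  intro x
  simp only [List.mem_toFinset, mem_Wl, mem_outs]
  rintro ⟨t, ht, h⟩
  exact isOut_mono hmono ht h.1

theorem heavy_card {n l k a r q : ℕ} (V : Finset BStr)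
    (hV : ∀ s ∈ V, ∃ T, 2 ^ q ≤ (Wl ev n l k a r T s).length) :
    V.card * 2 ^ q ≤ 2 ^ k * 2 ^ (r + 2) := by
  choose! τ hτ using hV
  set T := V.sup τ
  refine le_trans ?_ (Nat.mul_le_mul_right _ (outs_len (ev := ev) (a := k) (t := T)))
  rw [cnt_eq]
  refine Finset.card_mul_le_card_mul (fun s x => x ∈ Wl ev n l k a r T s) ?_ ?_
  · intro s hs
    refine (hτ s hs).trans ?_
    rw [← List.toFinset_card_of_nodup Wl_nodup]
    apply Finset.card_le_card
    intro x
    simp only [List.mem_toFinset, mem_Wl, mem_outs, Finset.mem_bipartiteAbove]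
    rintro ⟨t, ht, h⟩
    have ht' := ht.trans (Finset.le_sup (f := τ) hs)
    exact ⟨isOut_mono hmono ht' h.1, t, ht', h⟩
  · intro x _
    set Z := Finset.bipartiteBelow (fun s x => x ∈ Wl ev n l k a r T s) V x with hZ
    rcases Z.eq_empty_or_nonempty with h0 | h0
    · simp [h0]
    · have hz : ∀ s ∈ Z, ∃ t ≤ T, prd ev n l k a r t x s := by
        intro s hs
        rw [hZ, Finset.mem_bipartiteBelow] at hs
        exact mem_Wl.1 hs.2
      choose! θ hθ using hz
      obtain ⟨s0, hs0, hmax⟩ := Finset.exists_max_image Z θ h0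
      refine le_trans ?_ (hθ s0 hs0).2.2.2.2.le
      rw [mult_eq]
      apply Finset.card_le_card
      intro s hs
      rw [List.mem_toFinset, mem_mulL]
      exact ⟨isOut_mono hmono (hmax s hs) (hθ s hs).2.2.1, (hθ s hs).2.2.2.1⟩

end comb
end VV

namespace VV
open Encodable

theorem pair_bd {B m a b : ℕ} (ha : a + 1 ≤ (B + 1) ^ m) (hb : b + 1 ≤ (B + 1) ^ m) :
    Nat.pair a b + 1 ≤ (B + 1) ^ (2 * m) := by
  have h := Nat.pair_lt_max_add_one_sq a b
  have h2 : max a b + 1 ≤ (B + 1) ^ m := by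
    rcases le_total a b with h | h
    · rw [max_eq_right h]; exact hb
    · rw [max_eq_left h]; exact ha
  calc Nat.pair a b + 1 ≤ (max a b + 1) ^ 2 := h
    _ ≤ ((B + 1) ^ m) ^ 2 := Nat.pow_le_pow_left h2 2
    _ = (B + 1) ^ (2 * m) := by rw [← pow_mul, mul_comm]

theorem size_bd {B e n l k a r q : ℕ} (he : e ≤ B) (hn : n ≤ B) (hl : l ≤ B) (hk : k ≤ B)
    (ha : a ≤ B) (hr : r ≤ B) (hq : q ≤ B) :
    Nat.size (encode (e, (n, l, k, a, r, q))) ≤ 64 * Nat.size (B + 1) := by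
  have up : ∀ {m m' : ℕ} {v : ℕ}, m ≤ m' → v + 1 ≤ (B + 1) ^ m → v + 1 ≤ (B + 1) ^ m' := by
    intro m m' v h hv
    exact hv.trans (Nat.pow_le_pow_right (by omega) h)
  have one : ∀ {v m : ℕ}, 1 ≤ m → v ≤ B → v + 1 ≤ (B + 1) ^ m := by
    intro v m h hv
    exact up (m := 1) h (by simpa using hv)
  have h : encode (e, (n, l, k, a, r, q)) + 1 ≤ (B + 1) ^ (2 * 32) := by
    refine pair_bd (one (by norm_num) he) ?_
    refine pair_bd (m := 16) (one (by norm_num) hn) ?_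
    refine pair_bd (m := 8) (one (by norm_num) hl) ?_
    refine pair_bd (m := 4) (one (by norm_num) hk) ?_
    refine pair_bd (m := 2) (one (by norm_num) ha) ?_
    exact pair_bd (m := 1) (one (by norm_num) hr) (one (by norm_num) hq)
  rw [Nat.size_le]
  have h2 : (B + 1) ^ (2 * 32) ≤ (2 ^ Nat.size (B + 1)) ^ 64 :=
    Nat.pow_le_pow_left (Nat.lt_size_self _).le 64
  rw [← pow_mul, mul_comm (Nat.size _)] at h2
  exact Nat.lt_of_succ_le (h.trans h2)

abbrev Par := ℕ × ℕ × ℕ × ℕ × ℕ × ℕ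

section
variable {α : Type} [Primcodable α] {w : α → Par} (hw : Primrec w)
include hw
theorem p1 : Primrec fun z => (w z).1 := Primrec.fst.comp hw
theorem p2 : Primrec fun z => (w z).2.1 := Primrec.fst.comp (Primrec.snd.comp hw)
theorem p3 : Primrec fun z => (w z).2.2.1 :=
  Primrec.fst.comp (Primrec.snd.comp (Primrec.snd.comp hw))
theorem p4 : Primrec fun z => (w z).2.2.2.1 :=
  Primrec.fst.comp (Primrec.snd.comp (Primrec.snd.comp (Primrec.snd.comp hw)))
theorem p5 : Primrec fun z => (w z).2.2.2.2.1 :=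
  Primrec.fst.comp (Primrec.snd.comp (Primrec.snd.comp (Primrec.snd.comp (Primrec.snd.comp hw))))
theorem p6 : Primrec fun z => (w z).2.2.2.2.2 :=
  Primrec.snd.comp (Primrec.snd.comp (Primrec.snd.comp (Primrec.snd.comp (Primrec.snd.comp hw))))
end

/-- decode the search index into a stage and a string -/
def sidx (j : ℕ) : ℕ × BStr := (decode (α := ℕ × BStr) j).getD (0, [])

theorem sidx_pr : Primrec sidx :=
  Primrec.option_getD.comp Primrec.decode (Primrec.const (0, []))

theorem sidx_encode (z : ℕ × BStr) : sidx (encode z) = z := by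
  simp [sidx]

section
variable (U : UniversalPrefixMachine) {ev : ℕ → BStr → BStr → Option BStr}
  (hev : Primrec (fun z : ℕ × BStr × BStr => ev z.1 z.2.1 z.2.2))
  (hmono : ∀ t t' p y x, t ≤ t' → ev t p y = some x → ev t' p y = some x)
include hev hmono

theorem M1 : ∃ c, ∀ n l k a r q T B (s : BStr), n ≤ B → l ≤ B → a ≤ B → k + r + 2 ≤ B → q ≤ k →
    2 ^ q ≤ (Wl ev n l k a r T s).length →
    ∃ p, p.length ≤ k + r + 2 - q + 128 * Nat.size (B + 1) + c ∧ s ∈ U.eval p [] := by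
  let f : Par → BStr → ℕ → Option BStr := fun w _ j =>
    if 2 ^ w.2.2.2.2.2 ≤ (Wl ev w.1 w.2.1 w.2.2.1 w.2.2.2.1 w.2.2.2.2.1 (sidx j).1 (sidx j).2).length
      then some (sidx j).2 else none
  have hf : Primrec fun z : (Par × BStr) × ℕ => f z.1.1 z.1.2 z.2 := by
    have hw : Primrec fun z : (Par × BStr) × ℕ => z.1.1 := Primrec.fst.comp Primrec.fst
    have hs : Primrec fun z : (Par × BStr) × ℕ => sidx z.2 := sidx_pr.comp Primrec.snd
    have hs1 := Primrec.fst.comp hs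
    have hs2 := Primrec.snd.comp hs
    exact Primrec.ite (Primrec.nat_le.comp (pow2 (p6 hw)) (Primrec.list_length.comp
      (Wl_pr hev (p1 hw) (p2 hw) (p3 hw) (p4 hw) (p5 hw) hs1 hs2)))
      (Primrec.option_some.comp hs2) (Primrec.const none)
  obtain ⟨c, hc⟩ := enum_lemma U f hf
  refine ⟨c, ?_⟩
  intro n l k a r q T B s hn hl ha hk hq hT
  have := hc (n, l, k, a, r, q) [] (k + r + 2 - q) ?_ (encode (T, s)) s ?_
  · obtain ⟨p, hp, hv⟩ := this
    refine ⟨p, ?_, hv⟩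
    have := size_bd (B := B) (e := k + r + 2 - q) (n := n) (l := l) (k := k) (a := a) (r := r)
      (q := q) (by omega) hn hl (by omega) ha (by omega) (by omega)
    omega
  · intro V hV
    have h1 := heavy_card hmono (n := n) (l := l) (k := k) (a := a) (r := r) (q := q) V ?_
    · rw [← pow_add] at h1
      have h2 : k + (r + 2) = (k + r + 2 - q) + q := by omega
      rw [h2, pow_add] at h1
      exact Nat.le_of_mul_le_mul_right h1 (by positivity)
    · intro v hv
      obtain ⟨j, hj⟩ := hV v hv
      simp only [f] at hj
      split_ifs at hj with h
      simp only [Option.some.injEq] at hj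
      rw [hj] at h
      exact ⟨_, h⟩
  · simp only [f, sidx_encode]
    rw [if_pos hT]

omit hmono in
theorem M2 : ∃ c, ∀ n l k a r q t B (x y : BStr), n ≤ B → l ≤ B → a ≤ B → k ≤ B → r ≤ B →
    q + 1 ≤ B → (∀ T, (Wl ev n l k a r T y).length < 2 ^ (q + 1)) → prd ev n l k a r t x y →
    ∃ p, p.length ≤ q + 1 + 128 * Nat.size (B + 1) + c ∧ x ∈ U.eval p y := by
  let f : Par → BStr → ℕ → Option BStr := fun w y j =>
    if prd ev w.1 w.2.1 w.2.2.1 w.2.2.2.1 w.2.2.2.2.1 (sidx j).1 (sidx j).2 y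
      then some (sidx j).2 else none
  have hf : Primrec fun z : (Par × BStr) × ℕ => f z.1.1 z.1.2 z.2 := by
    have hw : Primrec fun z : (Par × BStr) × ℕ => z.1.1 := Primrec.fst.comp Primrec.fst
    have hs : Primrec fun z : (Par × BStr) × ℕ => sidx z.2 := sidx_pr.comp Primrec.snd
    have hs1 := Primrec.fst.comp hs
    have hs2 := Primrec.snd.comp hs
    exact Primrec.ite
      (prd_pr hev (p1 hw) (p2 hw) (p3 hw) (p4 hw) (p5 hw) hs1 hs2
        (Primrec.snd.comp Primrec.fst))
      (Primrec.option_some.comp hs2) (Primrec.const none)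
  obtain ⟨c, hc⟩ := enum_lemma U f hf
  refine ⟨c, ?_⟩
  intro n l k a r q t B x y hn hl ha hk hr hq hW hT
  have := hc (n, l, k, a, r, 0) y (q + 1) ?_ (encode (t, x)) x ?_
  · obtain ⟨p, hp, hv⟩ := this
    refine ⟨p, ?_, hv⟩
    have := size_bd (B := B) (e := q + 1) (n := n) (l := l) (k := k) (a := a) (r := r)
      (q := 0) (by omega) hn hl (by omega) ha (by omega) (by omega)
    omega
  · intro V hV
    have hz : ∀ v ∈ V, ∃ t, prd ev n l k a r t v y := by
      intro v hv
      obtain ⟨j, hj⟩ := hV v hv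
      simp only [f] at hj
      split_ifs at hj with h
      simp only [Option.some.injEq] at hj
      rw [hj] at h
      exact ⟨_, h⟩
    choose! θ hθ using hz
    refine le_trans ?_ (hW (V.sup θ)).le
    rw [← List.toFinset_card_of_nodup Wl_nodup]
    apply Finset.card_le_card
    intro v hv
    rw [List.mem_toFinset, mem_Wl]
    exact ⟨θ v, Finset.le_sup hv, hθ v hv⟩
  · simp only [f, sidx_encode]
    rw [if_pos hT]

theorem M3 : ∃ c, ∀ n l a r σ t e B, n ≤ B → l ≤ B → a ≤ B → r ≤ B → σ ≤ B → e ≤ B →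
    (a ≤ r + e ∨ a + l ≤ r + σ + e) → chk ev a r t → 2 ^ σ ≤ (Dl ev n l a r t).length →
    ∃ p, p.length ≤ e + 128 * Nat.size (B + 1) + c ∧
      Nat.bits (encode (Dl ev n l a r t)) ∈ U.eval p [] := by
  let f : Par → BStr → ℕ → Option BStr := fun w _ t =>
    if chk ev w.2.2.2.1 w.2.2.2.2.1 t ∧
        2 ^ w.2.2.2.2.2 ≤ (Dl ev w.1 w.2.1 w.2.2.2.1 w.2.2.2.2.1 t).length
      then some (Nat.bits (encode (Dl ev w.1 w.2.1 w.2.2.2.1 w.2.2.2.2.1 t))) else none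
  have hf : Primrec fun z : (Par × BStr) × ℕ => f z.1.1 z.1.2 z.2 := by
    have hw : Primrec fun z : (Par × BStr) × ℕ => z.1.1 := Primrec.fst.comp Primrec.fst
    have hD := Dl_pr hev (p1 hw) (p2 hw) (p4 hw) (p5 hw) Primrec.snd
    exact Primrec.ite ((chk_pr hev (p4 hw) (p5 hw) Primrec.snd).and
      (Primrec.nat_le.comp (pow2 (p6 hw)) (Primrec.list_length.comp hD)))
      (Primrec.option_some.comp (bits_primrec.comp (Primrec.encode.comp hD))) (Primrec.const none)
  obtain ⟨c, hc⟩ := enum_lemma U f hf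
  refine ⟨c, ?_⟩
  intro n l a r σ t e B hn hl ha hr hσ he hor hchk hD
  have := hc (n, l, 0, a, r, σ) [] e ?_ t (Nat.bits (encode (Dl ev n l a r t))) ?_
  · obtain ⟨p, hp, hv⟩ := this
    refine ⟨p, ?_, hv⟩
    have := size_bd (B := B) (e := e) (n := n) (l := l) (k := 0) (a := a) (r := r)
      (q := σ) (by omega) hn hl (by omega) ha (by omega) (by omega)
    omega
  · intro V hV
    have hz : ∀ v ∈ V, ∃ t, (chk ev a r t ∧ 2 ^ σ ≤ (Dl ev n l a r t).length) ∧
        Nat.bits (encode (Dl ev n l a r t)) = v := by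
      intro v hv
      obtain ⟨j, hj⟩ := hV v hv
      simp only [f] at hj
      split_ifs at hj with h
      simp only [Option.some.injEq] at hj
      exact ⟨_, h, hj⟩
    choose! θ hθ using hz
    have hinj : Set.InjOn θ V := by
      intro v hv v' hv' h
      rw [← (hθ v hv).2, ← (hθ v' hv').2, h]
    have hI : ∀ t ∈ V.image θ, chk ev a r t := by
      intro t ht
      obtain ⟨v, hv, rfl⟩ := Finset.mem_image.1 ht
      exact (hθ v hv).1.1
    have hI' : ∀ t ∈ V.image θ, 2 ^ σ ≤ (Dl ev n l a r t).length := by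
      intro t ht
      obtain ⟨v, hv, rfl⟩ := Finset.mem_image.1 ht
      exact (hθ v hv).1.2
    have h1 := chk_card hmono _ hI
    have h2 := D_card hmono _ hI hI'
    rw [Finset.card_image_of_injOn hinj] at h1 h2
    rcases hor with h | h
    · have h3 : V.card * 2 ^ r ≤ 2 ^ e * 2 ^ r := by
        rw [← pow_add]
        exact h1.trans (Nat.pow_le_pow_right (by norm_num) (by omega))
      exact Nat.le_of_mul_le_mul_right h3 (by positivity)
    · have h3 : V.card * (2 ^ σ * 2 ^ r) ≤ 2 ^ e * (2 ^ σ * 2 ^ r) := by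
        rw [← pow_add, ← pow_add, pow_add, ← mul_assoc]
        refine h2.trans ?_
        rw [← pow_add]
        exact (Nat.pow_le_pow_right (by norm_num) (by omega))
      exact Nat.le_of_mul_le_mul_right h3 (by positivity)
  · simp only [f]
    rw [if_pos ⟨hchk, hD⟩]

end
end VV

namespace VV
open Encodable

theorem dl_code (S : Finset BStr) : (dl (code S)).Nodup ∧ (dl (code S)).toFinset = S := by
  obtain ⟨L, h1, h2, h3⟩ := encode_finset S
  have : dl (code S) = L := by
    unfold dl code
    rw [val_bits, h1, encodek₂]
    rfl
  rw [this]
  exact ⟨h2, h3⟩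

theorem K_le (U : UniversalPrefixMachine) : ∃ c, ∀ x : BStr, U.K x ≤ 5 * x.length + 4 + c := by
  obtain ⟨c, hc⟩ := len_lemma U
  refine ⟨c, fun x => ?_⟩
  obtain ⟨p, hp, hx⟩ := hc x []
  have h1 := Kc_le U hx
  have h2 : Nat.size (encode (x.length, x.length)) ≤ 2 * (x.length + 1) := by
    rw [Nat.size_le]
    have h3 : encode (x.length, x.length) < (x.length + 1) ^ 2 := by
      have := Nat.pair_lt_max_add_one_sq x.length x.length
      simpa using this
    refine h3.trans_le ?_
    have h4 := Nat.pow_le_pow_left (Nat.lt_two_pow_self (n := x.length + 1)).le 2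
    rw [← pow_mul, mul_comm (x.length + 1) 2] at h4
    exact h4
  unfold UniversalPrefixMachine.K
  omega

theorem size_const (c0 : ℕ) : ∃ d, ∀ n, 1 ≤ n →
    Nat.size (10 * n + 10 + 2 * c0 + 1) ≤ Nat.log 2 n + d := by
  refine ⟨1 + Nat.size (21 + 2 * c0), fun n hn => ?_⟩
  rw [Nat.size_le]
  have h1 : n < 2 ^ (Nat.log 2 n + 1) := Nat.lt_pow_succ_log_self (by norm_num) n
  have h2 := Nat.lt_size_self (21 + 2 * c0)
  rw [← add_assoc, pow_add]
  have h3 : 10 * n + 10 + 2 * c0 + 1 ≤ n * (21 + 2 * c0) := by nlinarith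
  exact h3.trans_lt (Nat.mul_lt_mul'' h1 h2)

theorem final_arith (d c1 c2 c3 L : ℕ) (hL : 1 ≤ L) :
    3 * (128 * (L + d) + c1 + c2 + c3) + 3 ≤ (3 * (128 * (1 + d) + c1 + c2 + c3) + 3) * L := by
  have h0 := Nat.mul_le_mul_left d hL
  have h1 := Nat.mul_le_mul_left c1 hL
  have h2 := Nat.mul_le_mul_left c2 hL
  have h3 := Nat.mul_le_mul_left c3 hL
  have : (3 * (128 * (1 + d) + c1 + c2 + c3) + 3) * L =
    384 * L + 384 * (d * L) + 3 * (c1 * L) + 3 * (c2 * L) + 3 * (c3 * L) + 3 * L := by ring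
  omega

set_option maxHeartbeats 2000000 in
theorem core (U : UniversalPrefixMachine) : ∃ C, ∀ (x : BStr) (S : Finset BStr),
    2 ≤ x.length → x ∈ S → U.Kset S ≤ U.K x → ∃ R : Finset BStr, x ∈ R ∧
      U.Kset R ≤ U.Kset S + C * Nat.log 2 x.length ∧ ∃ l σ : ℕ, R.card < 2 ^ (σ + 1) ∧
      2 ^ l ≤ 2 * S.card ∧
      U.Kset R + σ + U.KcS x S ≤ l + U.K x + C * Nat.log 2 x.length := by
  obtain ⟨ev, hev, hmono, hspec⟩ := exists_ev U
  obtain ⟨c1, hM1⟩ := M1 U hev hmono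
  obtain ⟨c2, hM2⟩ := M2 U hev
  obtain ⟨c3, hM3⟩ := M3 U hev hmono
  obtain ⟨c0, hK⟩ := K_le U
  obtain ⟨d, hd⟩ := size_const c0
  refine ⟨3 * (128 * (1 + d) + c1 + c2 + c3) + 3, ?_⟩
  intro x S hn hxS hSK
  have hout : ∀ s : BStr, ∃ t0, ∀ t, t0 ≤ t → isOut ev (U.K s) t s := by
    intro s
    obtain ⟨p, hp, hs⟩ := Kc_spec U s []
    obtain ⟨t1, ht1⟩ := (hspec _ _ _).1 hs
    refine ⟨t1 + encode s + encode p + 1, fun t ht => ⟨by omega, p, mem_strs.2 (by omega), hp, ?_⟩⟩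
    exact hmono _ _ _ _ _ (by omega) ht1
  set n := x.length with hndef
  set k := U.K x with hk
  have hkB : k ≤ 5 * n + 4 + c0 := hK x
  set s := code S with hs
  set a := U.Kset S with ha
  have haK : a = U.K s := rfl
  obtain ⟨hnd, htf⟩ := dl_code S
  rw [← hs] at hnd htf
  set F := (dl s).filter (fun y => decide (y.length = n)) with hF
  have hFnd : F.Nodup := hnd.filter _
  have hFx : x ∈ F := by
    rw [hF, List.mem_filter]
    refine ⟨?_, by simp [hndef]⟩
    rw [← List.mem_toFinset, htf]; exact hxS
  have hF1 : 1 ≤ F.length := List.length_pos_of_mem hFx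
  have hFS : F.length ≤ S.card := by
    rw [← htf, List.toFinset_card_of_nodup hnd]
    exact List.length_filter_le _ _
  have hFn : F.length ≤ 2 ^ n := by
    rw [← List.toFinset_card_of_nodup hFnd]
    apply card_len
    intro y hy
    rw [List.mem_toFinset, hF, List.mem_filter] at hy
    simpa using hy.2
  set l := Nat.log 2 F.length + 1 with hl
  have hl1 : F.length < 2 ^ l := Nat.lt_pow_succ_log_self (by norm_num) _
  have hl2 : 2 ^ l ≤ 2 * F.length := by
    have := Nat.pow_log_le_self 2 (x := F.length) (by omega)
    rw [hl, pow_succ]; omega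
  have hln : l ≤ n + 1 := by
    have := (Nat.log_mono_right (b := 2) hFn).trans_eq (Nat.log_pow (by norm_num) n)
    omega
  have hRel : Rel n l s x := ⟨(List.mem_filter.1 hFx).1, rfl, hl1.le⟩
  -- maximal multiplicity
  obtain ⟨t0, ht0⟩ := bdd_max (fun t => mult ev n l a t x) (2 ^ a)
    (fun t => mult_le_cnt.trans outs_len)
  set N := mult ev n l a t0 x with hN
  have hNa : N ≤ 2 ^ a := mult_le_cnt.trans outs_len
  obtain ⟨ts, hts⟩ := hout s
  obtain ⟨tx, htx⟩ := hout x
  have hN1 : 1 ≤ N := by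
    refine le_trans ?_ (ht0 ts)
    exact List.length_pos_of_mem (mem_mulL.2 ⟨hts ts le_rfl, hRel⟩)
  obtain ⟨r, hr⟩ : ∃ r, Nat.log 2 (N + 1) = r + 1 := by
    have : 0 < Nat.log 2 (N + 1) := Nat.log_pos (by norm_num) (by omega)
    exact ⟨Nat.log 2 (N + 1) - 1, by omega⟩
  have hr1 : 2 * 2 ^ r ≤ N + 1 := by
    have := Nat.pow_log_le_self 2 (x := N + 1) (by omega)
    rw [hr, pow_succ] at this; omega
  have hr2 : N + 1 < 2 ^ (r + 2) := by
    have := Nat.lt_pow_succ_log_self (b := 2) (by norm_num) (N + 1)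
    rwa [hr] at this
  have hra : r ≤ a := by
    by_contra h
    have h1 : 2 ^ (a + 1) ≤ 2 ^ r := Nat.pow_le_pow_right (by norm_num) (by omega)
    rw [pow_succ] at h1
    have : 1 ≤ 2 ^ a := Nat.one_le_two_pow
    omega
  -- heavy
  have hprd : prd ev n l k a r (max ts tx) x s :=
    ⟨htx _ (le_max_right _ _), hts _ (le_max_left _ _), hRel, by
      have := ht0 (max ts tx)
      omega⟩
  obtain ⟨T0, hT0⟩ := bdd_max (fun T => (Wl ev n l k a r T s).length) (2 ^ k)
    (fun T => Wl_le hmono)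
  have hW1 : 1 ≤ (Wl ev n l k a r T0 s).length := by
    refine le_trans ?_ (hT0 (max ts tx))
    exact List.length_pos_of_mem (mem_Wl.2 ⟨_, le_rfl, hprd⟩)
  set q := Nat.log 2 (Wl ev n l k a r T0 s).length with hq
  have hq1 : 2 ^ q ≤ (Wl ev n l k a r T0 s).length := Nat.pow_log_le_self 2 (by omega)
  have hq2 : (Wl ev n l k a r T0 s).length < 2 ^ (q + 1) :=
    Nat.lt_pow_succ_log_self (by norm_num) _
  have hqk : q ≤ k :=
    (Nat.log_mono_right (b := 2) (Wl_le hmono)).trans_eq (Nat.log_pow (by norm_num) k)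
  have hdn := hd n (by omega)
  set B := 10 * n + 10 + 2 * c0 with hB
  -- the three descriptions
  obtain ⟨P1, hP1, hP1'⟩ := hM1 n l k a r q T0 B s (by omega) (by omega) (by omega) (by omega)
    hqk hq1
  obtain ⟨P2, hP2, hP2'⟩ := hM2 n l k a r q _ B x s (by omega) (by omega) (by omega) (by omega)
    (by omega) (by omega) (fun T => (hT0 T).trans_lt hq2) hprd
  have hP1'' : a ≤ P1.length := Kc_le U hP1'
  have hP2'' : U.KcS x S ≤ P2.length := Kc_le U hP2'
  obtain ⟨t, hchk, hxD⟩ := exists_D hmono hr1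
  set D := Dl ev n l a r t with hD
  have hD1 : 1 ≤ D.length := List.length_pos_of_mem hxD
  have hDnd : D.Nodup := Dl_nodup
  set σ := Nat.log 2 D.length with hσ
  have hσ1 : 2 ^ σ ≤ D.length := Nat.pow_log_le_self 2 (by omega)
  have hσ2 : D.length < 2 ^ (σ + 1) := Nat.lt_pow_succ_log_self (by norm_num) _
  have hσn : σ ≤ n := by
    have : D.length ≤ 2 ^ n := by
      rw [← List.toFinset_card_of_nodup hDnd]
      apply card_len
      intro y hy
      rw [List.mem_toFinset] at hy
      exact (mult_pos_spec (lt_of_lt_of_le (by positivity) (mem_Dl hy).1)).2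
    exact (Nat.log_mono_right (b := 2) this).trans_eq (Nat.log_pow (by norm_num) n)
  have hσr : r + σ ≤ a + l := by
    have h1 := D_card hmono (n := n) (l := l) (a := a) (r := r) (σ := σ) {t} (by simpa using hchk)
      (by simpa using hσ1)
    rw [Finset.card_singleton, one_mul, ← pow_add, ← pow_add] at h1
    have := (Nat.pow_le_pow_iff_right (by norm_num : 1 < 2)).1 h1
    omega
  obtain ⟨P3, hP3, hP3'⟩ := hM3 n l a r σ t (a - r) B (by omega) (by omega) (by omega) (by omega)
    (by omega) (by omega) (by omega) hchk hσ1
  obtain ⟨P4, hP4, hP4'⟩ := hM3 n l a r σ t (a + l - r - σ) B (by omega) (by omega) (by omega)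
    (by omega) (by omega) (by omega) (by omega) hchk hσ1
  have hcode : code D.toFinset = Nat.bits (encode D) := by
    unfold code
    rw [encode_toFinset D ((strs_sorted t).filter _)]
  rw [← hD, ← hcode] at hP3' hP4'
  have hP3'' : U.Kset D.toFinset ≤ P3.length := Kc_le U hP3'
  have hP4'' : U.Kset D.toFinset ≤ P4.length := Kc_le U hP4'
  have hL : 1 ≤ Nat.log 2 n := Nat.log_pos (by norm_num) hn
  have hbig : 3 * (128 * (Nat.log 2 n + d) + c1 + c2 + c3) + 3 ≤
      (3 * (128 * (1 + d) + c1 + c2 + c3) + 3) * Nat.log 2 n := by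
    exact final_arith _ _ _ _ _ hL
  refine ⟨D.toFinset, List.mem_toFinset.2 hxD, by omega, l, σ, ?_, by omega, by omega⟩
  rw [List.toFinset_card_of_nodup hDnd]
  exact hσ2

end VV

namespace VV
open Encodable

theorem sub_le_coe {a b : EReal} {r : ℝ} : a - (r : EReal) ≤ b ↔ a ≤ b + (r : EReal) :=
  EReal.sub_le_iff_le_add (Or.inl (EReal.coe_ne_bot r)) (Or.inl (EReal.coe_ne_top r))

theorem short_cases (x : BStr) (h : x.length < 2) : x = [] ∨ x = [false] ∨ x = [true] := by
  match x, h with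
  | [], _ => simp
  | [b], _ => cases b <;> simp
  | _ :: _ :: _, h => simp at h

theorem chain (U : UniversalPrefixMachine) : ∃ c, ∀ (x : BStr) (S : Finset BStr),
    U.K x ≤ U.Kset S + U.KcS x S + c := by
  obtain ⟨c, hc⟩ := concat_lemma U
  refine ⟨c, fun x S => ?_⟩
  obtain ⟨p1, h1, h1'⟩ := Kc_spec U (code S) []
  obtain ⟨p2, h2, h2'⟩ := Kc_spec U x (code S)
  obtain ⟨p, hp, hx⟩ := hc p1 p2 _ _ h1' h2'
  have := Kc_le U hx
  unfold UniversalPrefixMachine.Kset UniversalPrefixMachine.K UniversalPrefixMachine.KcS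
  omega

theorem main (U : UniversalPrefixMachine) :
    ∃ c : ℕ, ∀ (x : BStr) (i : ℕ),
      U.Knat x.length + c ≤ i → i ≤ U.K x →
      U.lambdaF x (i + c * Nat.log 2 x.length) ≤
          U.betaF x i + (((U.K x : ℕ) : ℝ) : EReal)
            + (((c * Nat.log 2 x.length : ℕ) : ℝ) : EReal) ∧
      U.betaF x i + (((U.K x : ℕ) : ℝ) : EReal) ≤
          U.lambdaF x i + (((c : ℕ) : ℝ) : EReal) := by
  obtain ⟨C, hC⟩ := core U
  obtain ⟨cc, hcc⟩ := chain U
  refine ⟨C + 2 + cc + (U.K [] + U.K [false] + U.K [true] + 1), ?_⟩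
  set c := C + 2 + cc + (U.K [] + U.K [false] + U.K [true] + 1) with hc
  intro x i hi1 hi2
  have hn : 2 ≤ x.length := by
    by_contra h
    rcases short_cases x (by omega) with rfl | rfl | rfl <;> omega
  have hL : 1 ≤ Nat.log 2 x.length := Nat.log_pos (by norm_num) hn
  constructor
  · rw [← sub_le_coe, ← sub_le_coe]
    refine le_sInf ?_
    rintro _ ⟨S, hxS, hS, rfl⟩
    rw [sub_le_coe, sub_le_coe]
    obtain ⟨R, hxR, hR, l, σ, hRσ, hl, hmain⟩ := hC x S hn hxS (hS.trans hi2)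
    have hCc : C * Nat.log 2 x.length + 2 ≤ c * Nat.log 2 x.length := by
      have : (C + 2) * Nat.log 2 x.length ≤ c * Nat.log 2 x.length :=
        Nat.mul_le_mul_right _ (by omega)
      nlinarith
    refine (sInf_le ⟨R, hxR, by omega, rfl⟩ : U.lambdaF x _ ≤ _).trans ?_
    rw [← EReal.coe_add, ← EReal.coe_add, EReal.coe_le_coe_iff]
    unfold UniversalPrefixMachine.Lam UniversalPrefixMachine.deficiency
    have hR0 : (0 : ℝ) < R.card := by exact_mod_cast Finset.card_pos.2 ⟨x, hxR⟩
    have hS0 : (0 : ℝ) < S.card := by exact_mod_cast Finset.card_pos.2 ⟨x, hxS⟩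
    have h1 : Real.logb 2 R.card ≤ σ + 1 := by
      rw [Real.logb_le_iff_le_rpow (by norm_num) hR0]
      have : (R.card : ℝ) ≤ 2 ^ (σ + 1) := by exact_mod_cast hRσ.le
      exact_mod_cast this
    have h2 : (l : ℝ) - 1 ≤ Real.logb 2 S.card := by
      rw [Real.le_logb_iff_rpow_le (by norm_num) hS0, Real.rpow_sub_one (by norm_num),
        Real.rpow_natCast]
      have : (2 : ℝ) ^ l ≤ 2 * S.card := by exact_mod_cast hl
      linarith
    have h3 : (U.Kset R : ℝ) + σ + U.KcS x S + 2 ≤ l + U.K x + (c * Nat.log 2 x.length : ℕ) := by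
      exact_mod_cast (by omega : U.Kset R + σ + U.KcS x S + 2 ≤
        l + U.K x + c * Nat.log 2 x.length)
    linarith
  · rw [← sub_le_coe]
    refine le_sInf ?_
    rintro _ ⟨S, hxS, hS, rfl⟩
    rw [sub_le_coe]
    refine (add_le_add_left (sInf_le ⟨S, hxS, hS, rfl⟩ : U.betaF x i ≤ _) _).trans ?_
    rw [← EReal.coe_add, ← EReal.coe_add, EReal.coe_le_coe_iff]
    unfold UniversalPrefixMachine.Lam UniversalPrefixMachine.deficiency
    have h3 : (U.K x : ℝ) ≤ U.Kset S + U.KcS x S + c := by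
      have := hcc x S
      exact_mod_cast (by omega : U.K x ≤ U.Kset S + U.KcS x S + c)
    linarith

end VV


/-- There is a constant `c` such that for every string `x` of
length `n` with `k = K(x)` and every `i` with `K(n) + c ≤ i ≤ k`:
`λ_x(i + c·log n) ≤ β_x(i) + k + c·log n`; together with the reverse inequality
`β_x(i) + k ≤ λ_x(i) + O(1)`. -/
theorem statement7 (U : UniversalPrefixMachine) :
    ∃ c : ℕ, ∀ (x : BStr) (i : ℕ),
      U.Knat x.length + c ≤ i → i ≤ U.K x →
      U.lambdaF x (i + c * Nat.log 2 x.length) ≤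
          U.betaF x i + (((U.K x : ℕ) : ℝ) : EReal)
            + (((c * Nat.log 2 x.length : ℕ) : ℝ) : EReal) ∧
      U.betaF x i + (((U.K x : ℕ) : ℝ) : EReal) ≤
          U.lambdaF x i + (((c : ℕ) : ℝ) : EReal) := by
  exact VV.main U
end

section
/- There is a constant c0 such that for every computable permutation f of the set of all finite binary strings (one-one, total, and onto), every binary string x, and every natural number α: h_{f(x)}(α + K(f) + c0) ≤ h_x(α) and h_x(α + K(f) + c0) ≤ h_{f(x)}(α). Hence the structure function is invariant, up to an additive shift K(f) + O(1) in the argument, under computable recoding of the data. -/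
open scoped Classical

/-- `K(f)` for a total function on binary strings: the minimum length of a
program computing `f`. -/
noncomputable def KfunStr (U : UniversalPrefixMachine) (f : BStr → BStr) : ℕ :=
  sInf {m | ∃ p : BStr, p.length = m ∧ ∀ y : BStr, f y ∈ U.eval p y}

/-! ### Listing of finite sets as sorted lists of natural numbers -/

/-- Increasing list of the codes of the elements of `S`. -/
noncomputable def listing (S : Finset BStr) : List ℕ :=
  (S.image (Encodable.encode : BStr → ℕ)).sort (· ≤ ·)

theorem encode_list_map_encode {α : Type} [Encodable α] (l : List α) :
    Encodable.encode l = Encodable.encode (l.map Encodable.encode) := by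
  induction l with
  | nil => rfl
  | cons a l ih => simp [Encodable.encode_list_cons, ih]

theorem sort_spec {α : Type} (s : Multiset α) (r : α → α → Prop) (d : DecidableRel r)
    (h1 : IsTrans α r) (h2 : Std.Antisymm r) (h3 : Std.Total r) :
    ((@Multiset.sort α s r d h1 h2 h3 : List α) : Multiset α) = s ∧
      (@Multiset.sort α s r d h1 h2 h3).Pairwise r :=
  ⟨Multiset.sort_eq _ _, Multiset.pairwise_sort _ _⟩

theorem encode_multiset_spec {α : Type} [Encodable α] (s : Multiset α) :
    ∃ l : List α, Encodable.encode s = Encodable.encode l ∧ (l : Multiset α) = s ∧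
      l.Pairwise (fun a b => Encodable.encode a ≤ Encodable.encode b) := by
  refine ⟨_, rfl, ?_, ?_⟩
  · exact (sort_spec s _ _ _ _ _).1
  · exact (sort_spec s _ _ _ _ _).2

theorem code_eq_listing (S : Finset BStr) :
    code S = Nat.bits (Encodable.encode (listing S)) := by
  obtain ⟨l, h1, h2, h3⟩ := encode_multiset_spec S.val
  have h0 : Encodable.encode S = Encodable.encode S.val := rfl
  unfold code
  rw [h0, h1, encode_list_map_encode]
  congr 2
  unfold listing
  have hnd : l.Nodup := by
    rw [← Multiset.coe_nodup, h2]; exact S.nodup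
  have hnd' : (l.map (Encodable.encode : BStr → ℕ)).Nodup :=
    hnd.map Encodable.encode_injective
  have hs : (l.map (Encodable.encode : BStr → ℕ)).toFinset = S.image Encodable.encode := by
    ext n
    simp only [List.mem_toFinset, List.mem_map, Finset.mem_image]
    have : ∀ a, a ∈ l ↔ a ∈ S := fun a => by
      rw [← Multiset.mem_coe, h2]; rfl
    simp [this]
  rw [← hs, (List.toFinset_sort (· ≤ ·) hnd').2]
  rw [List.pairwise_map]
  exact h3

/-! ### Binary expansion is primitive recursive -/

def incBits (l : List Bool) : List Bool :=
  List.recOn l [true] fun b l ih => if b = true then false :: ih else true :: l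

theorem primrec_incBits : Primrec incBits := by
  unfold incBits
  refine Primrec.list_rec (h := fun (_ : List Bool) (q : Bool × List Bool × List Bool) =>
    if q.1 = true then false :: q.2.2 else true :: q.2.1) Primrec.id (Primrec.const _) ?_
  refine Primrec.ite ?_ ?_ ?_
  · exact Primrec.eq.comp (Primrec.fst.comp Primrec.snd) (Primrec.const true)
  · exact Primrec.list_cons.comp (Primrec.const _)
      (Primrec.snd.comp (Primrec.snd.comp Primrec.snd))
  · exact Primrec.list_cons.comp (Primrec.const _)
      (Primrec.fst.comp (Primrec.snd.comp Primrec.snd))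

theorem bits_succ (n : ℕ) : Nat.bits (n + 1) = incBits (Nat.bits n) := by
  induction n using Nat.binaryRec' with
  | zero => simp [incBits]
  | bit b n h ih =>
    rw [Nat.bits_append_bit n b h]
    cases b with
    | false =>
      have : Nat.bit false n + 1 = Nat.bit true n := by simp [Nat.bit]
      rw [this, Nat.bits_append_bit n true (fun _ => rfl)]
      simp [incBits]
    | true =>
      have : Nat.bit true n + 1 = Nat.bit false (n + 1) := by simp [Nat.bit]; ring
      rw [this, Nat.bits_append_bit _ false (fun h => absurd h (Nat.succ_ne_zero n)), ih]
      simp [incBits]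

theorem primrec_bits : Primrec Nat.bits := by
  have : Primrec (fun n : ℕ => (Nat.rec [] (fun _ l => incBits l) n : List Bool)) :=
    Primrec.nat_rec₁ (f := fun _ l => incBits l) _
      (primrec_incBits.comp Primrec.snd)
  refine this.of_eq fun n => ?_
  induction n with
  | zero => simp
  | succ n ih => rw [bits_succ, ← ih]

/-! ### The simulation -/

/-- Candidate output list at stage `k`. -/
noncomputable def outL (R : ℕ × BStr × ℕ × ℕ → Prop) (k : ℕ) (p : BStr) (L : List ℕ) : List ℕ :=
  (List.range k).filter fun m => ∃ n ∈ L, R (k, p, n, m)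

theorem primrec_outL {R : ℕ × BStr × ℕ × ℕ → Prop} (hR : PrimrecPred R) :
    Primrec fun w : ℕ × BStr × List ℕ => outL R w.1 w.2.1 w.2.2 := by
  have h1 : PrimrecRel fun (n : ℕ) (v : ℕ × ℕ × BStr × List ℕ) => R (v.2.1, v.2.2.1, n, v.1) := by
    refine hR.comp (?_ : Primrec fun q : ℕ × ℕ × ℕ × BStr × List ℕ =>
      (q.2.2.1, q.2.2.2.1, q.1, q.2.1))
    exact (Primrec.fst.comp (Primrec.snd.comp Primrec.snd)).pair
      ((Primrec.fst.comp (Primrec.snd.comp (Primrec.snd.comp Primrec.snd))).pair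
        (Primrec.fst.pair (Primrec.fst.comp Primrec.snd)))
  have h2 : PrimrecRel fun (m : ℕ) (w : ℕ × BStr × List ℕ) =>
      ∃ n ∈ w.2.2, R (w.1, w.2.1, n, m) :=
    PrimrecPred.comp (f := fun q : ℕ × ℕ × BStr × List ℕ => (q.2.2.2, q))
      h1.exists_mem_list
      ((Primrec.snd.comp (Primrec.snd.comp Primrec.snd)).pair Primrec.id)
  have h3 := h2.listFilter
  exact (h3.comp (Primrec.list_range.comp Primrec.fst) Primrec.id).of_eq fun w => by
    simp [outL]

theorem outL_eq {R : ℕ × BStr × ℕ × ℕ → Prop} {S : Finset BStr} {g : BStr → BStr}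
    (hg : Function.Injective g) {p : BStr}
    (hs : ∀ k y m, R (k, p, Encodable.encode y, m) → m = Encodable.encode (g y)) {k : ℕ}
    (hl : (outL R k p (listing S)).length = (listing S).length) :
    outL R k p (listing S) = listing (S.image g) := by
  have hpw : (outL R k p (listing S)).Pairwise (· < ·) :=
    List.Pairwise.filter _ List.pairwise_lt_range
  have hnd : (outL R k p (listing S)).Nodup := hpw.imp (fun h => ne_of_lt h)
  have hsub : (outL R k p (listing S)).toFinset ⊆ (S.image g).image Encodable.encode := by
    intro m hm
    simp only [outL, List.mem_toFinset, List.mem_filter, decide_eq_true_eq] at hm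
    obtain ⟨_, n, hn, hR⟩ := hm
    simp only [listing, Finset.mem_sort, Finset.mem_image] at hn
    obtain ⟨y, hy, rfl⟩ := hn
    rw [hs _ _ _ hR]
    exact Finset.mem_image_of_mem _ (Finset.mem_image_of_mem _ hy)
  have hcard : ((S.image g).image (Encodable.encode : BStr → ℕ)).card ≤
      (outL R k p (listing S)).toFinset.card := by
    rw [List.toFinset_card_of_nodup hnd, hl, listing, Finset.length_sort,
      Finset.card_image_of_injective _ Encodable.encode_injective,
      Finset.card_image_of_injective _ Encodable.encode_injective,
      Finset.card_image_of_injective _ hg]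
  rw [show listing (S.image g) = ((S.image g).image Encodable.encode).sort (· ≤ ·) from rfl,
    ← Finset.eq_of_subset_of_card_le hsub hcard]
  exact ((List.toFinset_sort (· ≤ ·) hnd).2 (hpw.imp fun h => le_of_lt h)).symm

theorem outL_complete {R : ℕ × BStr × ℕ × ℕ → Prop} {S : Finset BStr} {g : BStr → BStr}
    (hg : Function.Injective g) {p : BStr}
    (hs : ∀ k y m, R (k, p, Encodable.encode y, m) → m = Encodable.encode (g y))
    (hc : ∀ y, ∃ k, ∀ k' ≥ k, R (k', p, Encodable.encode y, Encodable.encode (g y))) :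
    ∃ k, ∀ k' ≥ k, (outL R k' p (listing S)).length = (listing S).length := by
  choose K hK using hc
  refine ⟨S.sup (fun y => max (K y) (Encodable.encode (g y) + 1)), fun k hk => ?_⟩
  have hpw : (outL R k p (listing S)).Pairwise (· < ·) :=
    List.Pairwise.filter _ List.pairwise_lt_range
  have hnd : (outL R k p (listing S)).Nodup := hpw.imp (fun h => ne_of_lt h)
  have : (outL R k p (listing S)).toFinset = (S.image g).image Encodable.encode := by
    ext m
    simp only [outL, List.mem_toFinset, List.mem_filter, decide_eq_true_eq, listing,
      Finset.mem_sort, Finset.mem_image, List.mem_range]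
    constructor
    · rintro ⟨_, n, ⟨y, hy, rfl⟩, hR⟩
      exact ⟨g y, ⟨y, hy, rfl⟩, (hs _ _ _ hR).symm⟩
    · rintro ⟨_, ⟨y, hy, rfl⟩, rfl⟩
      have h1 := (Finset.le_sup (f := fun y => max (K y) (Encodable.encode (g y) + 1)) hy).trans hk
      have h2 := max_le_iff.1 h1
      exact ⟨h2.2, _, ⟨y, hy, rfl⟩, hK y k h2.1⟩
  rw [← List.toFinset_card_of_nodup hnd, this, listing, Finset.length_sort,
      Finset.card_image_of_injective _ Encodable.encode_injective,
      Finset.card_image_of_injective _ Encodable.encode_injective,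
      Finset.card_image_of_injective _ hg]

/-- Acceptance of a guess. The guess is `(p, q, L, k)`. -/
def Accepts (c : Nat.Partrec.Code) (R : ℕ × BStr × ℕ × ℕ → Prop) (r : BStr)
    (w : BStr × BStr × List ℕ × ℕ) : Prop :=
  r = w.1 ++ w.2.1 ∧
  (Nat.Partrec.Code.evaln w.2.2.2 c (Encodable.encode (w.1, ([] : BStr)))).isSome = true ∧
  Nat.Partrec.Code.evaln w.2.2.2 c (Encodable.encode (w.2.1, ([] : BStr))) =
    some (Encodable.encode (Nat.bits (Encodable.encode w.2.2.1))) ∧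
  (outL R w.2.2.2 w.1 w.2.2.1).length = w.2.2.1.length

theorem primrec_Accepts (c : Nat.Partrec.Code) {R : ℕ × BStr × ℕ × ℕ → Prop} (hR : PrimrecPred R) :
    PrimrecPred fun v : BStr × (BStr × BStr × List ℕ × ℕ) => Accepts c R v.1 v.2 := by
  have hp : Primrec fun v : BStr × (BStr × BStr × List ℕ × ℕ) => v.2.1 :=
    Primrec.fst.comp Primrec.snd
  have hq : Primrec fun v : BStr × (BStr × BStr × List ℕ × ℕ) => v.2.2.1 :=
    Primrec.fst.comp (Primrec.snd.comp Primrec.snd)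
  have hL : Primrec fun v : BStr × (BStr × BStr × List ℕ × ℕ) => v.2.2.2.1 :=
    Primrec.fst.comp (Primrec.snd.comp (Primrec.snd.comp Primrec.snd))
  have hk : Primrec fun v : BStr × (BStr × BStr × List ℕ × ℕ) => v.2.2.2.2 :=
    Primrec.snd.comp (Primrec.snd.comp (Primrec.snd.comp Primrec.snd))
  have he := fun {f : BStr × (BStr × BStr × List ℕ × ℕ) → BStr} (hf : Primrec f) =>
    Nat.Partrec.Code.primrec_evaln.comp ((hk.pair (Primrec.const c)).pair
      (Primrec.encode.comp (hf.pair (Primrec.const ([] : BStr)))))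
  unfold Accepts
  refine PrimrecPred.and (Primrec.eq.comp Primrec.fst (Primrec.list_append.comp hp hq)) ?_
  refine PrimrecPred.and (Primrec.eq.comp (Primrec.option_isSome.comp (he hp))
    (Primrec.const true)) ?_
  refine PrimrecPred.and (Primrec.eq.comp (he hq) ?_) ?_
  · exact Primrec.option_some.comp (Primrec.encode.comp
      (primrec_bits.comp (Primrec.encode.comp hL)))
  · exact Primrec.eq.comp (Primrec.list_length.comp
      ((primrec_outL hR).comp (hk.pair (hp.pair hL)))) (Primrec.list_length.comp hL)

/-- One stage of the search. -/
noncomputable def stage (c : Nat.Partrec.Code) (R : ℕ × BStr × ℕ × ℕ → Prop) (r : BStr) (t : ℕ) :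
    Option BStr :=
  (Encodable.decode (α := BStr × BStr × List ℕ × ℕ) t).bind fun w =>
    if Accepts c R r w then some (Nat.bits (Encodable.encode (outL R w.2.2.2 w.1 w.2.2.1))) else none

theorem primrec_stage (c : Nat.Partrec.Code) {R : ℕ × BStr × ℕ × ℕ → Prop} (hR : PrimrecPred R) :
    Primrec₂ (stage c R) := by
  unfold stage
  refine Primrec.option_bind (Primrec.decode.comp Primrec.snd) ?_
  refine Primrec.ite ?_ ?_ (Primrec.const _)
  · exact (primrec_Accepts c hR).comp
      ((Primrec.fst.comp Primrec.fst).pair Primrec.snd)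
  · have h1 : Primrec fun v : (BStr × ℕ) × (BStr × BStr × List ℕ × ℕ) =>
      (v.2.2.2.2, v.2.1, v.2.2.2.1) :=
      (Primrec.snd.comp (Primrec.snd.comp (Primrec.snd.comp Primrec.snd))).pair
        ((Primrec.fst.comp Primrec.snd).pair
          (Primrec.fst.comp (Primrec.snd.comp (Primrec.snd.comp Primrec.snd))))
    exact Primrec.option_some.comp (primrec_bits.comp
      (Primrec.encode.comp ((primrec_outL hR).comp h1)))

theorem stage_spec {c : Nat.Partrec.Code} {R : ℕ × BStr × ℕ × ℕ → Prop} {r : BStr} {t : ℕ}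
    {a : BStr} (h : a ∈ stage c R r t) :
    ∃ w, Accepts c R r w ∧ a = Nat.bits (Encodable.encode (outL R w.2.2.2 w.1 w.2.2.1)) := by
  unfold stage at h
  rw [Option.mem_def, Option.bind_eq_some_iff] at h
  obtain ⟨w, _, hw⟩ := h
  split_ifs at hw with hA
  exact ⟨w, hA, (Option.some.inj hw).symm⟩

theorem stage_of_acc {c : Nat.Partrec.Code} {R : ℕ × BStr × ℕ × ℕ → Prop} {r : BStr}
    {w : BStr × BStr × List ℕ × ℕ} (h : Accepts c R r w) :
    ∃ t a, a ∈ stage c R r t := by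
  refine ⟨Encodable.encode w, Nat.bits (Encodable.encode (outL R w.2.2.2 w.1 w.2.2.1)), ?_⟩
  simp [stage, h]

/-- `c` is a code for the machine `M`. -/
def CodeFor (M : PrefixMachine) (c : Nat.Partrec.Code) : Prop :=
  ∀ (p y : BStr) (m : ℕ), m ∈ c.eval (Encodable.encode (p, y)) ↔
    ∃ z : BStr, m = Encodable.encode z ∧ z ∈ M.eval p y

theorem exists_codeFor (M : PrefixMachine) : ∃ c, CodeFor M c := by
  obtain ⟨c, hc⟩ := Nat.Partrec.Code.exists_code.1 M.partrec'
  refine ⟨c, fun p y m => ?_⟩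
  rw [hc]
  simp only [Encodable.encodek, Part.coe_some, Part.bind_some, Part.mem_map_iff]
  constructor
  · rintro ⟨z, hz, rfl⟩
    exact ⟨z, rfl, hz⟩
  · rintro ⟨z, rfl, hz⟩
    exact ⟨z, hz, rfl⟩

theorem CodeFor.evaln_sound {M : PrefixMachine} {c : Nat.Partrec.Code} (hc : CodeFor M c)
    {k : ℕ} {p y : BStr} {m : ℕ}
    (h : Nat.Partrec.Code.evaln k c (Encodable.encode (p, y)) = some m) :
    ∃ z : BStr, m = Encodable.encode z ∧ z ∈ M.eval p y :=
  (hc p y m).1 (Nat.Partrec.Code.evaln_sound h)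

theorem CodeFor.evaln_complete {M : PrefixMachine} {c : Nat.Partrec.Code} (hc : CodeFor M c)
    {p y z : BStr} (h : z ∈ M.eval p y) :
    ∃ k, ∀ k' ≥ k, Nat.Partrec.Code.evaln k' c (Encodable.encode (p, y)) =
      some (Encodable.encode z) := by
  obtain ⟨k, hk⟩ := Nat.Partrec.Code.evaln_complete.1 ((hc p y _).2 ⟨z, rfl, h⟩)
  exact ⟨k, fun k' h' => Nat.Partrec.Code.evaln_mono h' hk⟩

theorem CodeFor.acc_dom {M : PrefixMachine} {c : Nat.Partrec.Code} (hc : CodeFor M c)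
    {R : ℕ × BStr × ℕ × ℕ → Prop} {r : BStr} {w : BStr × BStr × List ℕ × ℕ}
    (h : Accepts c R r w) : r = w.1 ++ w.2.1 ∧ (M.eval w.1 []).Dom ∧
      Nat.bits (Encodable.encode w.2.2.1) ∈ M.eval w.2.1 [] := by
  obtain ⟨h1, h2, h3, _⟩ := h
  refine ⟨h1, ?_, ?_⟩
  · obtain ⟨m, hm⟩ := Option.isSome_iff_exists.1 h2
    obtain ⟨z, _, hz⟩ := hc.evaln_sound hm
    exact Part.dom_iff_mem.2 ⟨z, hz⟩
  · obtain ⟨z, hz, hz'⟩ := hc.evaln_sound h3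
    rwa [Encodable.encode_injective hz]

/-- Two decompositions of comparable strings agree. -/
theorem split_unique (M : PrefixMachine) {p q p' q' : BStr} (hp : (M.eval p []).Dom)
    (hq : (M.eval q []).Dom) (hp' : (M.eval p' []).Dom) (hq' : (M.eval q' []).Dom)
    (h : p ++ q <+: p' ++ q') : p = p' ∧ q = q' := by
  have hpp : p = p' := by
    rcases List.prefix_or_prefix_of_prefix ((List.prefix_append p q).trans h)
      (List.prefix_append p' q') with h1 | h1
    · exact M.prefixFree _ _ _ hp hp' h1
    · exact (M.prefixFree _ _ _ hp' hp h1).symm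
  subst hpp
  exact ⟨rfl, M.prefixFree _ _ _ hq hq' ((List.prefix_append_right_inj p).1 h)⟩

/-- The transformed machine. -/
noncomputable def simMachine (M : PrefixMachine) (c : Nat.Partrec.Code) (hc : CodeFor M c)
    (R : ℕ × BStr × ℕ × ℕ → Prop) (hR : PrimrecPred R) : PrefixMachine where
  eval r _ := Nat.rfindOpt (stage c R r)
  partrec' := Partrec.rfindOpt
    (f := fun (v : BStr × BStr) t => stage c R v.1 t)
    ((primrec_stage c hR).comp (Primrec.fst.comp Primrec.fst) Primrec.snd).to_comp
  prefixFree := by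
    intro _ r r' h h' hpre
    obtain ⟨t, a, ha⟩ := Nat.rfindOpt_dom.1 h
    obtain ⟨t', a', ha'⟩ := Nat.rfindOpt_dom.1 h'
    obtain ⟨w, hw, _⟩ := stage_spec ha
    obtain ⟨w', hw', _⟩ := stage_spec ha'
    obtain ⟨e, hp, hq⟩ := hc.acc_dom hw
    obtain ⟨e', hp', hq'⟩ := hc.acc_dom hw'
    rw [e, e'] at hpre ⊢
    obtain ⟨h1, h2⟩ := split_unique M hp (Part.dom_iff_mem.2 ⟨_, hq⟩) hp'
      (Part.dom_iff_mem.2 ⟨_, hq'⟩) hpre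
    rw [h1, h2]

theorem listing_of_bits {L : List ℕ} {S : Finset BStr}
    (h : Nat.bits (Encodable.encode L) = code S) : L = listing S := by
  rw [code_eq_listing] at h
  refine Encodable.encode_injective ?_
  have hinj : Function.Injective Nat.bits := by
    intro a b hab
    induction a using Nat.binaryRec' generalizing b with
    | zero =>
      induction b using Nat.binaryRec' with
      | zero => rfl
      | bit b n h ih => rw [Nat.bits_append_bit n b h] at hab; simp at hab
    | bit b n hn ih =>
      induction b using Nat.binaryRec' with
      | zero => rw [Nat.bits_append_bit n _ hn] at hab; simp at hab
      | bit b' n' hn' ih' =>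
        rw [Nat.bits_append_bit n _ hn, Nat.bits_append_bit n' _ hn'] at hab
        simp only [List.cons.injEq] at hab
        rw [hab.1, ih hab.2]
  exact hinj h

theorem simMachine_spec (M : PrefixMachine) (c : Nat.Partrec.Code) (hc : CodeFor M c)
    (R : ℕ × BStr × ℕ × ℕ → Prop) (hR : PrimrecPred R) {g : BStr → BStr}
    (hg : Function.Injective g) {p q : BStr} {S : Finset BStr}
    (hs : ∀ k y m, R (k, p, Encodable.encode y, m) → m = Encodable.encode (g y))
    (hcm : ∀ y, ∃ k, ∀ k' ≥ k, R (k', p, Encodable.encode y, Encodable.encode (g y)))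
    (hp : (M.eval p []).Dom) (hq : code S ∈ M.eval q []) :
    code (S.image g) ∈ (simMachine M c hc R hR).eval (p ++ q) [] := by
  have hdom : ((simMachine M c hc R hR).eval (p ++ q) []).Dom := by
    refine Nat.rfindOpt_dom.2 ?_
    obtain ⟨z, hz⟩ := Part.dom_iff_mem.1 hp
    obtain ⟨k1, hk1⟩ := hc.evaln_complete hz
    obtain ⟨k2, hk2⟩ := hc.evaln_complete hq
    obtain ⟨k3, hk3⟩ := outL_complete (S := S) hg hs hcm
    refine stage_of_acc (w := (p, q, listing S, max k1 (max k2 k3))) ⟨rfl, ?_, ?_, ?_⟩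
    · rw [hk1 _ (le_max_left _ _)]; rfl
    · rw [hk2 _ ((le_max_left _ _).trans (le_max_right _ _)), code_eq_listing]
    · exact hk3 _ ((le_max_right _ _).trans (le_max_right _ _))
  obtain ⟨a, ha⟩ := Part.dom_iff_mem.1 hdom
  obtain ⟨t, ht⟩ := Nat.rfindOpt_spec ha
  obtain ⟨w, hw, hwa⟩ := stage_spec ht
  obtain ⟨e, hp', hq'⟩ := hc.acc_dom hw
  obtain ⟨h1, h2⟩ := split_unique M hp (Part.dom_iff_mem.2 ⟨_, hq⟩) hp'
      (Part.dom_iff_mem.2 ⟨_, hq'⟩) (e ▸ List.prefix_rfl)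
  rw [← h2] at hq'
  have hL := listing_of_bits (Part.mem_unique hq' hq)
  have hlen := hw.2.2.2
  rw [hL, ← h1] at hwa hlen
  rw [outL_eq hg hs hlen, ← code_eq_listing] at hwa
  rwa [hwa] at ha

/-- The machine that on the empty program applies `f` to its auxiliary input. -/
noncomputable def funMachine (f : BStr → BStr) (hf : Computable f) : PrefixMachine where
  eval p y := if p = [] then Part.some (f y) else Part.none
  partrec' := by
    have h : Partrec fun v : BStr × BStr =>
        cond (decide (v.1 = [])) (Part.some (f v.2)) Part.none := by
      refine Partrec.cond ?_ (hf.comp Computable.snd) Partrec.none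
      exact (Primrec.eq.comp Primrec.fst (Primrec.const ([] : BStr))).decide.to_comp
    refine h.of_eq fun v => ?_
    by_cases hv : v.1 = [] <;> simp [hv]
  prefixFree := by
    intro y p q hp hq _
    have h0 : ∀ r : BStr, (if r = [] then Part.some (f y) else Part.none).Dom → r = [] := by
      intro r hr
      by_contra hne
      rw [if_neg hne] at hr
      exact hr
    rw [h0 p hp, h0 q hq]

theorem exists_program (U : UniversalPrefixMachine) {f : BStr → BStr} (hf : Computable f) :
    ∃ p : BStr, ∀ y, f y ∈ U.eval p y := by
  obtain ⟨s, hs⟩ := U.universal (funMachine f hf)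
  refine ⟨s ++ [], fun y => ?_⟩
  rw [hs]
  simp [funMachine]

theorem exists_KfunStr (U : UniversalPrefixMachine) {f : BStr → BStr} (hf : Computable f) :
    ∃ p : BStr, p.length = KfunStr U f ∧ ∀ y, f y ∈ U.eval p y := by
  obtain ⟨p, hp⟩ := exists_program U hf
  exact Nat.sInf_mem (s := {m | ∃ p : BStr, p.length = m ∧ ∀ y : BStr, f y ∈ U.eval p y})
    ⟨_, p, rfl, hp⟩

theorem exists_Kset (U : UniversalPrefixMachine) (S : Finset BStr) :
    ∃ q : BStr, q.length = U.Kset S ∧ code S ∈ U.eval q [] := by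
  obtain ⟨p, hp⟩ := exists_program U (f := fun _ => code S) (Computable.const _)
  exact Nat.sInf_mem (s := {n | ∃ p : BStr, p.length = n ∧ code S ∈ U.eval p []})
    ⟨_, p, rfl, hp []⟩

/-- Main complexity bound. -/
theorem Kset_image_le (U : UniversalPrefixMachine) (c : Nat.Partrec.Code)
    (hc : CodeFor U.toPrefixMachine c)
    (R : ℕ × BStr × ℕ × ℕ → Prop) (hR : PrimrecPred R) :
    ∃ d : ℕ, ∀ (g : BStr → BStr), Function.Injective g → ∀ p : BStr,
      (∀ k y m, R (k, p, Encodable.encode y, m) → m = Encodable.encode (g y)) →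
      (∀ y, ∃ k, ∀ k' ≥ k, R (k', p, Encodable.encode y, Encodable.encode (g y))) →
      (U.eval p []).Dom → ∀ S : Finset BStr, U.Kset (S.image g) ≤ U.Kset S + p.length + d := by
  obtain ⟨s, hs⟩ := U.universal (simMachine U.toPrefixMachine c hc R hR)
  refine ⟨s.length, fun g hg p h1 h2 hp S => ?_⟩
  obtain ⟨q, hql, hq⟩ := exists_Kset U S
  refine Nat.sInf_le ⟨s ++ (p ++ q), ?_, ?_⟩
  · simp only [List.length_append, hql]; omega
  · rw [hs]; exact simMachine_spec _ c hc R hR hg h1 h2 hp hq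

/-- Forward relation. -/
def relFwd (c : Nat.Partrec.Code) (v : ℕ × BStr × ℕ × ℕ) : Prop :=
  Nat.Partrec.Code.evaln v.1 c (Nat.pair (Encodable.encode v.2.1) v.2.2.1) = some v.2.2.2

/-- Backward relation. -/
def relBwd (c : Nat.Partrec.Code) (v : ℕ × BStr × ℕ × ℕ) : Prop :=
  (Encodable.decode (α := BStr) v.2.2.2).map Encodable.encode = some v.2.2.2 ∧
  Nat.Partrec.Code.evaln v.1 c (Nat.pair (Encodable.encode v.2.1) v.2.2.2) = some v.2.2.1

theorem primrec_evaln_aux (c : Nat.Partrec.Code) {f : ℕ × BStr × ℕ × ℕ → ℕ} (hf : Primrec f) :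
    Primrec fun v : ℕ × BStr × ℕ × ℕ =>
      Nat.Partrec.Code.evaln v.1 c (Nat.pair (Encodable.encode v.2.1) (f v)) :=
  Nat.Partrec.Code.primrec_evaln.comp ((Primrec.fst.pair (Primrec.const c)).pair
    (Primrec₂.natPair.comp (Primrec.encode.comp (Primrec.fst.comp Primrec.snd)) hf))

theorem primrec_relFwd (c : Nat.Partrec.Code) : PrimrecPred (relFwd c) := by
  unfold relFwd
  exact Primrec.eq.comp
    (primrec_evaln_aux c (Primrec.fst.comp (Primrec.snd.comp Primrec.snd)))
    (Primrec.option_some.comp (Primrec.snd.comp (Primrec.snd.comp Primrec.snd)))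

theorem primrec_relBwd (c : Nat.Partrec.Code) : PrimrecPred (relBwd c) := by
  have h4 : Primrec fun v : ℕ × BStr × ℕ × ℕ => v.2.2.2 :=
    Primrec.snd.comp (Primrec.snd.comp Primrec.snd)
  unfold relBwd
  refine PrimrecPred.and (Primrec.eq.comp ?_ (Primrec.option_some.comp h4)) ?_
  · exact Primrec.option_map (Primrec.decode.comp h4) (Primrec.encode.comp Primrec.snd)
  · exact Primrec.eq.comp (primrec_evaln_aux c h4)
      (Primrec.option_some.comp (Primrec.fst.comp (Primrec.snd.comp Primrec.snd)))

theorem h_le_of_image (U : UniversalPrefixMachine) {g : BStr → BStr} (hg : Function.Injective g)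
    {α β : ℕ} (hK : ∀ S : Finset BStr, U.Kset S ≤ α → U.Kset (S.image g) ≤ β) (x : BStr) :
    U.h (g x) β ≤ U.h x α := by
  refine le_sInf ?_
  rintro r ⟨S, hx, hS, rfl⟩
  refine sInf_le ⟨S.image g, Finset.mem_image_of_mem _ hx, hK S hS, ?_⟩
  rw [Finset.card_image_of_injective _ hg]

/-- There is a constant `c0` such that for every computable
permutation `f` of the binary strings, every `x` and every `α`:
`h_{f(x)}(α + K(f) + c0) ≤ h_x(α)` and `h_x(α + K(f) + c0) ≤ h_{f(x)}(α)`. -/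
theorem statement11 (U : UniversalPrefixMachine) :
    ∃ c0 : ℕ, ∀ f : BStr → BStr, Function.Bijective f → Computable f →
      ∀ (x : BStr) (α : ℕ),
        U.h (f x) (α + KfunStr U f + c0) ≤ U.h x α ∧
        U.h x (α + KfunStr U f + c0) ≤ U.h (f x) α := by
  obtain ⟨c, hc⟩ := exists_codeFor U.toPrefixMachine
  obtain ⟨d1, hd1⟩ := Kset_image_le U c hc _ (primrec_relFwd c)
  obtain ⟨d2, hd2⟩ := Kset_image_le U c hc _ (primrec_relBwd c)
  refine ⟨max d1 d2, fun f hf hcf x α => ?_⟩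
  obtain ⟨p, hpl, hp⟩ := exists_KfunStr U hcf
  have hdom : (U.eval p []).Dom := Part.dom_iff_mem.2 ⟨_, hp []⟩
  constructor
  · refine h_le_of_image U hf.1 (fun S hS => ?_) x
    have h := hd1 f hf.1 p ?_ ?_ hdom S
    · have := le_max_left d1 d2
      omega
    · intro k y m h
      obtain ⟨z, rfl, hz⟩ := hc.evaln_sound (p := p) (y := y) h
      rw [Part.mem_unique hz (hp y)]
    · intro y
      exact hc.evaln_complete (hp y)
  · obtain ⟨g, hgl, hgr⟩ := Function.bijective_iff_has_inverse.1 hf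
    have hx : U.h x = U.h (g (f x)) := by rw [hgl x]
    rw [hx]
    refine h_le_of_image U hgr.injective (fun S hS => ?_) (f x)
    have h := hd2 g hgr.injective p ?_ ?_ hdom S
    · have := le_max_right d1 d2
      omega
    · rintro k y m ⟨hm, h⟩
      obtain ⟨u, _, rfl⟩ := Option.map_eq_some_iff.1 hm
      obtain ⟨z, hyz, hz⟩ := hc.evaln_sound (p := p) (y := u) h
      rw [Encodable.encode_injective hyz, Part.mem_unique hz (hp u), hgl u]
    · intro y
      have hy : y ∈ U.eval p (g y) := by
        have := hp (g y)
        rwa [hgr y] at this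
      obtain ⟨k, hk⟩ := hc.evaln_complete hy
      refine ⟨k, fun k' h' => ⟨?_, hk k' h'⟩⟩
      simp
end

section
/- There is a constant c such that for every binary string x and every finite set S of binary strings with x ∈ S: (a) there is a computable probability density function P with −log P(x) = log|S|, |δ(x|P) − δ(x|S)| ≤ c, and |K(P) − K(S)| ≤ c; and (b) there is a total recursive function p with l_x(p) ≤ log|S|, δ(x|p) ≤ δ(x|S) + c, and |K(p) − K(S)| ≤ c. -/
open scoped Classical

/-- An oracle prefix machine: a machine querying an oracle `O : ℕ → ℕ`, with
prefix-free halting programs; its behaviour is generated, via a partial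
computable function, from finite tables of true oracle values (so the machine
is a computable functional of the oracle). -/
structure OraclePrefixMachine where
  eval : (ℕ → ℕ) → BStr → BStr → Part BStr
  prefixFree : ∀ O y p q, (eval O p y).Dom → (eval O q y).Dom → p <+: q → p = q
  table : List (ℕ × ℕ) × BStr × BStr → Part BStr
  table_partrec : Partrec table
  eval_spec : ∀ O p y x, x ∈ eval O p y ↔
    ∃ T : List (ℕ × ℕ), (∀ q ∈ T, O q.1 = q.2) ∧ x ∈ table (T, p, y)

/-- A universal oracle prefix machine: simulates every oracle prefix machine
via a fixed self-delimiting prefix, uniformly in the oracle. -/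
structure UniversalOracleMachine extends OraclePrefixMachine where
  universal : ∀ M : OraclePrefixMachine, ∃ s : BStr, ∀ O p y,
    toOraclePrefixMachine.eval O (s ++ p) y = M.eval O p y

/-- The oracle (as a function `ℕ → ℕ`) answering queries `(z,ε)` by `A z ε`. -/
def oracleOfApprox (A : BStr → ℚ → ℚ) : ℕ → ℕ := fun m =>
  Encodable.encode ((Encodable.decode (α := BStr × ℚ) m).map fun z => A z.1 z.2)

/-- The oracle (as a function `ℕ → ℕ`) computing the function `f` on strings. -/
def oracleOfFun (f : BStr → BStr) : ℕ → ℕ := fun m =>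
  Encodable.encode ((Encodable.decode (α := BStr) m).map f)

/-- `A` approximates `P`: `|A(z,ε) − P(z)| < ε` for all `z` and rational `ε > 0`. -/
def Approximates (A : BStr → ℚ → ℚ) (P : BStr → ℝ) : Prop :=
  ∀ (z : BStr) (ε : ℚ), 0 < ε → |((A z ε : ℚ) : ℝ) - P z| < (ε : ℝ)

/-- `K(x|P)`: the minimum length of a program that prints `x` given as oracle
any function approximating `P`. -/
noncomputable def KcondPdf (V : UniversalOracleMachine) (x : BStr) (P : BStr → ℝ) : ℕ :=
  sInf {m | ∃ p : BStr, p.length = m ∧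
    ∀ A : BStr → ℚ → ℚ, Approximates A P → x ∈ V.eval (oracleOfApprox A) p []}

/-- `K(x|p)` for a total function `p` on strings: the minimum length of a
program printing `x` given `p` as oracle. -/
noncomputable def KcondFun (V : UniversalOracleMachine) (x : BStr) (f : BStr → BStr) : ℕ :=
  sInf {m | ∃ p : BStr, p.length = m ∧ x ∈ V.eval (oracleOfFun f) p []}

/-- A computable probability density function: nonnegative, sums to 1, and some
algorithm computes `P(z)` to within any positive rational precision `ε`. -/
def IsCPDF (P : BStr → ℝ) : Prop :=
  (∀ z : BStr, 0 ≤ P z) ∧ (∑' z : BStr, P z) = 1 ∧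
    ∃ g : BStr × ℚ → ℚ, Computable g ∧
      ∀ (z : BStr) (ε : ℚ), 0 < ε → |((g (z, ε) : ℚ) : ℝ) - P z| < (ε : ℝ)

/-- `K(P)`: the minimal length of a program that, given `(z,ε)` with rational
`ε > 0`, outputs a rational approximating `P(z)` to precision `ε`. -/
noncomputable def KPdf (U : UniversalPrefixMachine) (P : BStr → ℝ) : ℕ :=
  sInf {m | ∃ p : BStr, p.length = m ∧ ∀ (z : BStr) (ε : ℚ), 0 < ε →
    ∃ q : ℚ, code q ∈ U.eval p (code (z, ε)) ∧ |((q : ℚ) : ℝ) - P z| < (ε : ℝ)}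

/-- `δ(x|P) = -log P(x) - K(x|P)`. -/
noncomputable def deltaPdf (V : UniversalOracleMachine) (x : BStr) (P : BStr → ℝ) : ℝ :=
  -Real.logb 2 (P x) - (KcondPdf V x P : ℝ)

/-- `K(p)` for a total function `p` on strings: the minimal length of a program
computing `p(d)` from any `d`. -/
noncomputable def KFn (U : UniversalPrefixMachine) (f : BStr → BStr) : ℕ :=
  sInf {m | ∃ p : BStr, p.length = m ∧ ∀ d : BStr, f d ∈ U.eval p d}

/-- `l_x(p) = min{|d| : p(d) = x}`. -/
noncomputable def lenx (f : BStr → BStr) (x : BStr) : ℕ :=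
  sInf {m | ∃ d : BStr, d.length = m ∧ f d = x}

/-- `δ(x|p) = l_x(p) - K(x|p)`. -/
noncomputable def deltaFun (V : UniversalOracleMachine) (x : BStr) (f : BStr → BStr) : ℝ :=
  (lenx f x : ℝ) - (KcondFun V x f : ℝ)

open Encodable

namespace S15

/-- inverse of `Nat.bits`. -/
def unbits (l : BStr) : ℕ := l.foldr (fun b n => cond b (2 * n + 1) (2 * n)) 0

@[simp] theorem unbits_cons (b : Bool) (l : BStr) :
    unbits (b :: l) = cond b (2 * unbits l + 1) (2 * unbits l) := rfl

theorem unbits_bits (n : ℕ) : unbits (Nat.bits n) = n := by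
  induction n using Nat.binaryRec' with
  | zero => simp [unbits]
  | bit b n h ih =>
    rw [Nat.bits_append_bit _ _ h, unbits_cons, ih]
    cases b <;> simp [Nat.bit]

theorem unbits_code {α : Type} [Encodable α] (a : α) : unbits (code a) = encode a := unbits_bits _

theorem bits_inj {m n : ℕ} (h : Nat.bits m = Nat.bits n) : m = n := by
  rw [← unbits_bits m, h, unbits_bits]

theorem unbits_prim : Primrec unbits := by
  refine Primrec.list_foldr (f := fun l : BStr => l) (g := fun _ => 0)
    (h := fun _ p => cond p.1 (2 * p.2 + 1) (2 * p.2)) Primrec.id (Primrec.const 0) ?_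
  have h2 : Primrec fun a : BStr × Bool × ℕ => a.2.2 := Primrec.snd.comp Primrec.snd
  exact (Primrec.cond (Primrec.fst.comp Primrec.snd) (Primrec.nat_double_succ.comp h2)
    (Primrec.nat_double.comp h2)).to₂

theorem bits_prim : Primrec Nat.bits := by
  have : Primrec₂ (fun (_ : Unit) (n : ℕ) => Nat.bits n) := by
    refine Primrec.nat_strong_rec _
      (g := fun _ l => if l.length = 0 then some [] else
        (l[l.length / 2]?).map (fun t => Nat.bodd l.length :: t)) ?_ ?_
    · have hl : Primrec fun a : Unit × List BStr => a.2.length := Primrec.list_length.comp Primrec.snd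
      refine Primrec₂.mk (Primrec.ite (Primrec.eq.comp hl (Primrec.const 0)) (Primrec.const _) ?_)
      refine Primrec.option_map (β := BStr)
        (Primrec.list_getElem?.comp Primrec.snd (Primrec.nat_div.comp hl (Primrec.const 2))) ?_
      exact (Primrec.list_cons.comp (Primrec.nat_bodd.comp (hl.comp (Primrec.fst (α := Unit × List BStr) (β := BStr)))) Primrec.snd).to₂
    · intro _ n
      induction n using Nat.binaryRec' with
      | zero => simp
      | bit b n h ih =>
        have hne : Nat.bit b n ≠ 0 := by
          rw [Nat.bit_ne_zero_iff]; exact h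
        have h2 : Nat.bit b n / 2 = n := by
          cases b <;> simp [Nat.bit] ; omega
        have hlt : n < Nat.bit b n := by
          cases b <;> simp [Nat.bit] at * <;> omega
        simp only [List.length_map, List.length_range, if_neg hne, h2]
        rw [List.getElem?_map, List.getElem?_range hlt]
        simp [Nat.bits_append_bit _ _ h]
  exact this.comp (Primrec.const ()) Primrec.id

/-- `n`-th string in length-lexicographic style order -/
def dstr (n : ℕ) : BStr := (Nat.bits (n + 1)).dropLast

def didx (d : BStr) : ℕ := unbits (d ++ [true]) - 1

theorem dropLast_prim : Primrec (fun l : BStr => l.dropLast) := by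
  refine (Primrec.list_reverse.comp (Primrec.list_tail.comp Primrec.list_reverse)).of_eq ?_
  intro l
  simp

theorem dstr_prim : Primrec dstr := dropLast_prim.comp (bits_prim.comp Primrec.succ)

theorem dstr_succ_prim : Primrec (fun n => dstr (n + 1)) := dstr_prim.comp Primrec.succ

theorem didx_prim : Primrec didx :=
  Primrec.pred.comp (unbits_prim.comp (Primrec.list_append.comp Primrec.id (Primrec.const [true])))

theorem dstr_append (n : ℕ) : dstr n ++ [true] = Nat.bits (n + 1) := by
  have : ∀ m : ℕ, m ≠ 0 → (Nat.bits m).dropLast ++ [true] = Nat.bits m := by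
    intro m
    induction m using Nat.binaryRec' with
    | zero => simp
    | bit b m h ih =>
      intro _
      rw [Nat.bits_append_bit _ _ h]
      by_cases hm : m = 0
      · subst hm; simp [h rfl]
      · have := ih hm
        have hne : Nat.bits m ≠ [] := by
          intro h0; rw [h0] at this; simp at this
        rw [List.dropLast_cons_of_ne_nil hne, List.cons_append, this]
  exact this _ (Nat.succ_ne_zero n)

theorem didx_dstr (n : ℕ) : didx (dstr n) = n := by
  rw [didx, dstr_append, unbits_bits]; rfl

theorem pow_le_unbits (d : BStr) : 2 ^ d.length ≤ unbits (d ++ [true]) := by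
  induction d with
  | nil => simp [unbits]
  | cons b d ih =>
    rw [List.cons_append, unbits_cons, List.length_cons, pow_succ]
    cases b <;> simp <;> omega

theorem pow_dstr (n : ℕ) : 2 ^ (dstr n).length ≤ n + 1 := by
  have := pow_le_unbits (dstr n)
  rwa [dstr_append, unbits_bits] at this

attribute [irreducible] dstr

/-- canonical listing -/
theorem exists_listing (S : Finset BStr) : ∃ l : List BStr, encode S = encode l ∧
    l.Pairwise (fun a b => encode a < encode b) ∧ ∀ z, z ∈ l ↔ z ∈ S := by
  have : ∃ l : List BStr, encode S = encode l ∧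
    l.Pairwise (fun a b => encode a ≤ encode b) ∧ (l : Multiset BStr) = S.val := by
    have : IsTrans BStr (fun a b => encode a ≤ encode b) := ⟨fun _ _ _ h h' => le_trans h h'⟩
    have : Std.Total (α := BStr) (fun a b => encode a ≤ encode b) := ⟨fun a b => le_total _ _⟩
    have : Std.Antisymm (α := BStr) (fun a b => encode a ≤ encode b) :=
      ⟨fun a b h h' => encode_injective (le_antisymm h h')⟩
    refine ⟨S.val.sort (fun a b => encode a ≤ encode b), ?_, Multiset.pairwise_sort _ _, Multiset.sort_eq _ _⟩
    rfl
  obtain ⟨l, h1, h2, h3⟩ := this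
  refine ⟨l, h1, ?_, ?_⟩
  · have hn : l.Nodup := by
      rw [← Multiset.coe_nodup, h3]; exact S.nodup
    refine (h2.and hn).imp ?_
    rintro a b ⟨h, h'⟩
    exact lt_of_le_of_ne h (fun h => h' (encode_injective h))
  · intro z
    rw [← Multiset.mem_coe, h3]; rfl

noncomputable def lst (S : Finset BStr) : List BStr := (exists_listing S).choose
theorem encode_lst (S : Finset BStr) : encode (lst S) = encode S := (exists_listing S).choose_spec.1.symm
theorem lst_sorted (S : Finset BStr) : (lst S).Pairwise (fun a b => encode a < encode b) :=
  (exists_listing S).choose_spec.2.1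
theorem mem_lst (S : Finset BStr) {z} : z ∈ lst S ↔ z ∈ S := (exists_listing S).choose_spec.2.2 z
theorem lst_nodup (S : Finset BStr) : (lst S).Nodup := (lst_sorted S).imp (fun h h' => by simp [h'] at h)
theorem lst_length (S : Finset BStr) : (lst S).length = S.card := by
  rw [← List.toFinset_card_of_nodup (lst_nodup S)]
  congr 1; ext z; simp [mem_lst]
theorem eq_lst {S : Finset BStr} {l : List BStr} (h : l.Pairwise (fun a b => encode a < encode b))
    (h' : ∀ z, z ∈ l ↔ z ∈ S) : l = lst S := by
  have hn : l.Nodup := h.imp (fun h h' => by simp [h'] at h)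
  refine List.Perm.eq_of_pairwise (le := fun a b => encode a < encode b) ?_ h (lst_sorted S)
    ((List.perm_ext_iff_of_nodup hn (lst_nodup S)).2 fun z => by rw [h', mem_lst])
  intro a b _ _ h1 h2; omega
theorem code_lst (S : Finset BStr) : code (lst S) = code S := by
  simp only [code, encode_lst]

/-- list represented by a code -/
def rd (w : BStr) : List BStr := (decode (α := List BStr) (unbits w)).getD []
theorem rd_prim : Primrec rd := Primrec.option_getD.comp (Primrec.decode.comp unbits_prim) (Primrec.const [])
theorem rd_code (S : Finset BStr) : rd (code S) = lst S := by
  rw [← code_lst, rd, unbits_code, encodek]; rfl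

theorem exists_step {α σ : Type} [Primcodable α] [Primcodable σ] {F : α →. σ} (hF : Partrec F) :
    ∃ s : α → ℕ → Option σ, Primrec₂ s ∧ (∀ a x, x ∈ F a ↔ ∃ k, s a k = some x) ∧
      ∀ a x k k', k ≤ k' → s a k = some x → s a k' = some x := by
  obtain ⟨c, hc⟩ := Nat.Partrec.Code.exists_code.1 hF
  refine ⟨fun a k => (Nat.Partrec.Code.evaln k c (encode a)).bind (fun n => decode n), ?_, ?_, ?_⟩
  · refine (Primrec.option_bind (Nat.Partrec.Code.primrec_evaln.comp
      (((Primrec.snd).pair (Primrec.const c)).pair (Primrec.encode.comp Primrec.fst)))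
      (Primrec.decode.comp Primrec.snd).to₂).to₂
  · intro a x
    have key : ∀ n, n ∈ c.eval (encode a) ↔ ∃ y ∈ F a, encode y = n := by
      intro n; rw [hc]; simp [encodek]
    constructor
    · intro hx
      obtain ⟨k, hk⟩ := Nat.Partrec.Code.evaln_complete.1 ((key (encode x)).2 ⟨x, hx, rfl⟩)
      refine ⟨k, ?_⟩
      rw [Option.mem_def] at hk
      simp [hk]
    · rintro ⟨k, hk⟩
      obtain ⟨n, hn, hd⟩ := Option.bind_eq_some_iff.1 hk
      obtain ⟨y, hy, rfl⟩ := (key n).1 (Nat.Partrec.Code.evaln_complete.2 ⟨k, hn⟩)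
      rw [encodek] at hd
      cases hd; exact hy
  · intro a x k k' hk h
    obtain ⟨n, hn, hd⟩ := Option.bind_eq_some_iff.1 h
    have := Nat.Partrec.Code.evaln_mono hk hn
    rw [Option.mem_def] at this
    simp [this, hd]

/-! ### generic machines -/

theorem Kc_le (U : UniversalPrefixMachine) {x y p : BStr} (h : x ∈ U.eval p y) : U.Kc x y ≤ p.length :=
  Nat.sInf_le ⟨p, rfl, h⟩

/-- unary machine -/
def unaryMachine : PrefixMachine where
  eval p _ := if p = List.replicate (p.length - 1) true ++ [false] then
      Part.some ((decode (α := BStr) (p.length - 1)).getD []) else Part.none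
  partrec' := by
    have hl : Primrec fun a : BStr × BStr => a.1.length - 1 :=
      Primrec.pred.comp (Primrec.list_length.comp Primrec.fst)
    have hrep : Primrec fun n : ℕ => List.replicate n true ++ [false] := by
      have : Primrec fun n : ℕ => (List.range n).map (fun _ => true) :=
        Primrec.list_map Primrec.list_range (Primrec.const true).to₂
      refine (Primrec.list_append.comp this (Primrec.const [false])).of_eq ?_
      intro n; simp
    have h1 : Primrec fun a : BStr × BStr => if a.1 = List.replicate (a.1.length - 1) true ++ [false] then
        some ((decode (α := BStr) (a.1.length - 1)).getD []) else none := by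
      refine Primrec.ite (Primrec.eq.comp Primrec.fst (hrep.comp hl)) ?_ (Primrec.const none)
      exact Primrec.option_some.comp (Primrec.option_getD.comp (Primrec.decode.comp hl) (Primrec.const []))
    refine (Computable.ofOption h1.to_comp).of_eq ?_
    intro a
    show ((if a.1 = List.replicate (a.1.length - 1) true ++ [false] then
        some ((decode (α := BStr) (a.1.length - 1)).getD []) else none : Option BStr) : Part BStr) = _
    split_ifs <;> rfl
  prefixFree := by
    intro _ p q hp hq h
    have hp' : p = List.replicate (p.length - 1) true ++ [false] := by
      by_contra hc; rw [if_neg hc] at hp; exact hp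
    have hq' : q = List.replicate (q.length - 1) true ++ [false] := by
      by_contra hc; rw [if_neg hc] at hq; exact hq
    refine h.eq_of_length ?_
    by_contra hlt
    have hle := h.length_le
    have hp1 : 1 ≤ p.length := by rw [hp']; simp
    have e : p[p.length - 1]? = q[p.length - 1]? := by
      obtain ⟨t, rfl⟩ := h
      rw [List.getElem?_append_left (by omega)]
    have e1 : p[p.length - 1]? = some false := by
      conv_lhs => rw [hp']
      rw [List.getElem?_append_right (by simp)]; simp
    have e2 : q[p.length - 1]? = some true := by
      conv_lhs => rw [hq']
      rw [List.getElem?_append_left (by simp; omega)]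
      rw [List.getElem?_replicate]; simp; omega
    rw [e1, e2] at e; simp at e

theorem exists_prog (U : UniversalPrefixMachine) (x y : BStr) : ∃ p, x ∈ U.eval p y := by
  obtain ⟨s, hs⟩ := U.universal unaryMachine
  refine ⟨s ++ (List.replicate (encode x) true ++ [false]), ?_⟩
  rw [hs]
  simp [unaryMachine, encodek]

theorem exists_Kc (U : UniversalPrefixMachine) (x y : BStr) : ∃ p, p.length = U.Kc x y ∧ x ∈ U.eval p y := by
  have : U.Kc x y ∈ {n | ∃ p : BStr, p.length = n ∧ x ∈ U.eval p y} := by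
    refine Nat.sInf_mem ?_
    obtain ⟨p, hp⟩ := exists_prog U x y
    exact ⟨_, p, rfl, hp⟩
  exact this

/-- run on empty input, then post-process -/
def mapMachine (U : UniversalPrefixMachine) (G : BStr → BStr → BStr) (hG : Computable₂ G) : PrefixMachine where
  eval p y := (U.eval p []).map (fun w => G w y)
  partrec' := by
    have h : Partrec fun a : BStr × BStr => U.eval a.1 [] :=
      U.partrec'.comp (Computable.fst.pair (Computable.const []))
    exact h.map (hG.comp Computable.snd (Computable.snd.comp Computable.fst)).to₂
  prefixFree := by
    intro y p q hp hq h
    exact U.prefixFree [] p q hp hq h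

theorem mapMachine_spec (U : UniversalPrefixMachine) (G : BStr → BStr → BStr) (hG : Computable₂ G) :
    ∃ c, ∀ w : BStr, ∃ p : BStr, p.length ≤ U.K w + c ∧ ∀ y, G w y ∈ U.eval p y := by
  obtain ⟨s, hs⟩ := U.universal (mapMachine U G hG)
  refine ⟨s.length, fun w => ?_⟩
  obtain ⟨p, hp, h⟩ := exists_Kc U w []
  refine ⟨s ++ p, ?_, fun y => ?_⟩
  · rw [List.length_append, hp, UniversalPrefixMachine.K]; omega
  · rw [hs]
    exact Part.mem_map (fun w => G w y) h

/-- search for repeated value -/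
def repPred (U : UniversalPrefixMachine) (p : BStr) (n : ℕ) : Part Bool :=
  (U.eval p (dstr n)).bind fun a => (U.eval p (dstr (n + 1))).map fun b => decide (a = b)

def repMachine (U : UniversalPrefixMachine) : PrefixMachine where
  eval p _ := (Nat.rfind (repPred U p)).bind fun n => U.eval p (dstr n)
  partrec' := by
    have h1 : Partrec₂ (fun (a : BStr × BStr) (n : ℕ) => repPred U a.1 n) := by
      have a1 : Partrec fun a : (BStr × BStr) × ℕ => U.eval a.1.1 (dstr a.2) :=
        U.partrec'.comp ((Computable.fst.comp Computable.fst).pair (dstr_prim.to_comp.comp Computable.snd))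
      have b1 : Computable fun a : ((BStr × BStr) × ℕ) × BStr => a.1.1.1 :=
        Computable.fst.comp (Computable.fst.comp Computable.fst)
      have b2 : Computable fun a : ((BStr × BStr) × ℕ) × BStr => a.1.2 :=
        Computable.snd.comp Computable.fst
      have b3 : Computable fun a : ((BStr × BStr) × ℕ) × BStr => dstr (a.1.2 + 1) :=
        dstr_succ_prim.to_comp.comp b2
      have a2 : Partrec fun a : ((BStr × BStr) × ℕ) × BStr => U.eval a.1.1.1 (dstr (a.1.2 + 1)) :=
        Partrec.comp (f := fun p : BStr × BStr => U.eval p.1 p.2)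
          (g := fun a : ((BStr × BStr) × ℕ) × BStr => (a.1.1.1, dstr (a.1.2 + 1))) U.partrec' (b1.pair b3)
      have a4 : Primrec₂ fun (a b : BStr) => decide (a = b) := Primrec.eq.decide
      have a3 : Computable₂ fun (a : ((BStr × BStr) × ℕ) × BStr) (b : BStr) => decide (a.2 = b) :=
        Computable₂.comp (f := fun a b : BStr => decide (a = b)) (g := fun q : (((BStr × BStr) × ℕ) × BStr) × BStr => q.1.2)
          (h := fun q : (((BStr × BStr) × ℕ) × BStr) × BStr => q.2) a4.to_comp
          (Computable.snd.comp Computable.fst) Computable.snd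
      have a5 := a2.map a3
      exact a1.bind a5
    have h2 : Partrec₂ fun (a : BStr × BStr) (n : ℕ) => U.eval a.1 (dstr n) :=
      (U.partrec'.comp ((Computable.fst.comp Computable.fst).pair
        (dstr_prim.to_comp.comp Computable.snd))).to₂
    exact (Partrec.rfind h1).bind h2
  prefixFree := by
    intro y p q hp hq h
    have key : ∀ p, ((Nat.rfind (repPred U p)).bind fun n => U.eval p (dstr n)).Dom →
        (U.eval p (dstr 0)).Dom := by
      intro p hp
      obtain ⟨h, _⟩ := hp
      obtain ⟨n, hn, hm⟩ := Nat.rfind_dom.1 h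
      have : (repPred U p 0).Dom := by
        rcases Nat.eq_zero_or_pos n with rfl | h0
        · exact Part.dom_iff_mem.2 ⟨_, hn⟩
        · exact hm h0
      exact this.1
    exact U.prefixFree _ p q (key p hp) (key q hq) h

theorem repMachine_spec (U : UniversalPrefixMachine) : ∃ c, ∀ (l : List BStr) (w p : BStr), l.Nodup →
    (∀ n, (l[n]?).getD w ∈ U.eval p (dstr n)) → U.K w ≤ p.length + c := by
  obtain ⟨s, hs⟩ := U.universal (repMachine U)
  refine ⟨s.length, fun l w p hl h => ?_⟩
  have hpred : ∀ n, decide ((l[n]?).getD w = (l[n+1]?).getD w) ∈ repPred U p n := by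
    intro n
    exact Part.mem_bind_iff.2 ⟨_, h n, Part.mem_map_iff _ |>.2 ⟨_, h (n + 1), rfl⟩⟩
  have : w ∈ U.eval (s ++ p) [] := by
    rw [hs]
    have hdom : (Nat.rfind (repPred U p)).Dom := by
      refine Nat.rfind_dom.2 ⟨l.length, ?_, fun {m} _ => Part.dom_iff_mem.2 ⟨_, hpred m⟩⟩
      have := hpred l.length
      simpa using this
    obtain ⟨n, hn⟩ := Part.dom_iff_mem.1 hdom
    refine Part.mem_bind_iff.2 ⟨n, hn, ?_⟩
    have h1 := (Nat.mem_rfind.1 hn).1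
    have h2 := Part.mem_unique h1 (hpred n)
    have h3 : (l[n]?).getD w = (l[n+1]?).getD w := by simpa using h2.symm
    have hw : (l[n]?).getD w = w := by
      by_cases hlt : n + 1 < l.length
      · exfalso
        rw [List.getElem?_eq_getElem hlt, List.getElem?_eq_getElem (by omega)] at h3
        have := (List.Nodup.getElem_inj_iff hl).1 h3
        omega
      · rw [h3, List.getElem?_eq_none (by omega)]; rfl
    have := h n
    rwa [hw] at this
  have h1 := Kc_le U this
  rw [List.length_append] at h1
  rw [UniversalPrefixMachine.K]; omega

/-! ### simulating an oracle machine -/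

theorem oracle_sim_partrec (V : OraclePrefixMachine) {O : BStr → ℕ → ℕ} (hO : Primrec₂ O) :
    Partrec fun a : BStr × BStr => V.eval (O a.2) a.1 [] := by
  obtain ⟨s, hs, hs1, hs2⟩ := exists_step V.table_partrec
  let g : BStr × BStr → ℕ → Option BStr := fun a n =>
    (decode (α := List (ℕ × ℕ)) n.unpair.1).bind fun T =>
      if ∀ q ∈ T, O a.2 q.1 = q.2 then s (T, a.1, []) n.unpair.2 else none
  have hg : Primrec₂ g := by
    refine Primrec₂.mk (Primrec.option_bind (Primrec.decode.comp (Primrec.fst.comp (Primrec.unpair.comp Primrec.snd))) ?_)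
    have hr : PrimrecRel fun (q : ℕ × ℕ) (y : BStr) => O y q.1 = q.2 :=
      Primrec.eq.comp₂ (hO.comp₂ Primrec₂.right (Primrec.fst.comp Primrec.fst).to₂)
        (Primrec.snd.comp Primrec.fst).to₂
    have hr' := hr.forall_mem_list
    refine Primrec₂.mk (Primrec.ite (hr'.comp (Primrec.snd) (Primrec.snd.comp (Primrec.fst.comp Primrec.fst))) ?_
      (Primrec.const none))
    exact hs.comp (Primrec.snd.pair ((Primrec.fst.comp (Primrec.fst.comp Primrec.fst)).pair (Primrec.const [])))
      (Primrec.snd.comp (Primrec.unpair.comp (Primrec.snd.comp Primrec.fst)))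
  have hspec : ∀ a x, x ∈ V.eval (O a.2) a.1 [] ↔ ∃ n, x ∈ g a n := by
    intro a x
    rw [V.eval_spec]
    constructor
    · rintro ⟨T, hT, hx⟩
      obtain ⟨k, hk⟩ := (hs1 _ _).1 hx
      refine ⟨Nat.pair (encode T) k, ?_⟩
      simp only [g, Nat.unpair_pair, encodek, Option.bind_some]
      rw [if_pos hT]; exact hk
    · rintro ⟨n, hn⟩
      obtain ⟨T, _, hT⟩ := Option.bind_eq_some_iff.1 hn
      split_ifs at hT with hc
      exact ⟨T, hc, (hs1 _ _).2 ⟨_, hT⟩⟩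
  refine (Partrec.rfindOpt hg.to_comp).of_eq ?_
  intro a
  ext x
  constructor
  · intro h
    exact (hspec a x).2 (Nat.rfindOpt_spec h)
  · intro h
    have hd : (Nat.rfindOpt (g a)).Dom := Nat.rfindOpt_dom.2 (by
      obtain ⟨n, hn⟩ := (hspec a x).1 h
      exact ⟨n, x, hn⟩)
    obtain ⟨x', hx'⟩ := Part.dom_iff_mem.1 hd
    have := (hspec a x').2 (Nat.rfindOpt_spec hx')
    rw [Part.mem_unique h this]; exact hx'

def simMachine (V : OraclePrefixMachine) (O : BStr → ℕ → ℕ) (hO : Primrec₂ O) : PrefixMachine where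
  eval p y := V.eval (O y) p []
  partrec' := oracle_sim_partrec V hO
  prefixFree := fun y p q => V.prefixFree (O y) [] p q

theorem simMachine_spec (U : UniversalPrefixMachine) (V : OraclePrefixMachine) {O : BStr → ℕ → ℕ}
    (hO : Primrec₂ O) : ∃ c, ∀ x y p, x ∈ V.eval (O y) p [] → U.Kc x y ≤ p.length + c := by
  obtain ⟨s, hs⟩ := U.universal (simMachine V O hO)
  refine ⟨s.length, fun x y p h => ?_⟩
  have : x ∈ U.eval (s ++ p) y := by rw [hs]; exact h
  have h1 := Kc_le U this
  rw [List.length_append] at h1; omega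

/-- oracle machine ignoring its oracle -/
def constOracle (U : UniversalPrefixMachine) : OraclePrefixMachine where
  eval _ p y := U.eval p y
  prefixFree := fun _ y p q => U.prefixFree y p q
  table a := U.eval a.2.1 a.2.2
  table_partrec := U.partrec'.comp Computable.snd
  eval_spec := by
    intro O p y x
    exact ⟨fun h => ⟨[], by simp, h⟩, fun ⟨_, _, h⟩ => h⟩

theorem exists_oracle_prog (U : UniversalPrefixMachine) (V : UniversalOracleMachine) (O : ℕ → ℕ) (x : BStr) :
    ∃ p, x ∈ V.eval O p [] := by
  obtain ⟨s, hs⟩ := V.universal (constOracle U)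
  obtain ⟨p, hp⟩ := exists_prog U x []
  exact ⟨s ++ p, by rw [hs]; exact hp⟩

/-! ### rational codes -/

theorem encode_rat (q : ℚ) : encode q = Nat.pair (encode q.num) q.den := rfl

theorem encode_int_nonneg {i : ℤ} (h : 0 ≤ i) : encode i = 2 * i.toNat := by
  obtain ⟨n, rfl⟩ := Int.eq_ofNat_of_zero_le h; rfl

theorem encode_int_neg {i : ℤ} (h : i < 0) : encode i % 2 = 1 := by
  obtain ⟨n, rfl⟩ := Int.eq_negSucc_of_lt_zero h
  show (2 * n + 1) % 2 = 1
  omega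

theorem encode_inv (n : ℕ) (hn : 0 < n) : encode ((1 : ℚ) / n) = Nat.pair 2 n := by
  rw [encode_rat]
  have h1 : ((1 : ℚ) / n).num = 1 := by
    rw [one_div]; exact Rat.inv_natCast_num_of_pos hn
  have h2 : ((1 : ℚ) / n).den = n := by
    rw [one_div]; exact Rat.inv_natCast_den_of_pos hn
  rw [h1, h2]; rfl

theorem encode_ratzero : encode (0 : ℚ) = Nat.pair 0 1 := rfl

def eps (n : ℕ) : ℚ := 1 / ((2 * n * (n + 1) : ℕ) : ℚ)

def query (z : BStr) (n : ℕ) : ℕ := Nat.pair (encode z) (Nat.pair 2 (2 * n * (n + 1)))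

theorem encode_query (z : BStr) (n : ℕ) (hn : 0 < n) : encode (z, eps n) = query z n := by
  rw [Encodable.encode_prod_val, eps, encode_inv _ (by positivity)]; rfl

def above (v n : ℕ) : Prop :=
  (v - 1).unpair.1 % 2 = 0 ∧
    (2 * n + 1) * (v - 1).unpair.2 < ((v - 1).unpair.1 / 2) * (2 * n * (n + 1))

theorem above_iff (q : ℚ) (n : ℕ) (hn : 0 < n) :
    above (encode q + 1) n ↔ (2 * n + 1 : ℚ) / (2 * n * (n + 1)) < q := by
  have hd : (0 : ℚ) < q.den := by exact_mod_cast q.den_pos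
  have hn' : (0 : ℚ) < n := by exact_mod_cast hn
  rw [above, Nat.add_sub_cancel, encode_rat, Nat.unpair_pair]
  rcases lt_or_ge q.num 0 with h | h
  · have := encode_int_neg h
    simp only [this]
    have hq : q < 0 := Rat.num_neg.1 h
    have : (0 : ℚ) < (2 * n + 1 : ℚ) / (2 * n * (n + 1)) := by positivity
    constructor
    · rintro ⟨h, _⟩; simp at h
    · intro h; linarith
  · rw [encode_int_nonneg h]
    obtain ⟨m, hm⟩ := Int.eq_ofNat_of_zero_le h
    have hq : q = m / q.den := by
      conv_lhs => rw [← Rat.num_div_den q, hm]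
      simp
    have : (2 * n + 1 : ℚ) / (2 * n * (n + 1)) < q ↔ (2 * n + 1 : ℚ) * q.den < m * (2 * n * (n + 1)) := by
      conv_lhs => rw [hq]
      rw [div_lt_div_iff₀ (by positivity) hd]
    rw [this, hm]
    simp only [Int.toNat_natCast, Nat.mul_mod_right, true_and]
    rw [Nat.mul_div_cancel_left _ (by norm_num)]
    exact_mod_cast Iff.rfl

theorem prim_c {α : Type} [Primcodable α] {f g : α → ℕ} (hf : Primrec f) (hg : Primrec g) :
    Primrec (fun a => f a * g a) := Primrec.nat_mul.comp hf hg

theorem eps_den_prim : Primrec (fun n : ℕ => 2 * n * (n + 1)) :=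
  Primrec.nat_mul.comp Primrec.nat_double Primrec.succ

theorem query_prim : Primrec₂ query := by
  refine Primrec₂.mk (Primrec₂.natPair.comp (Primrec.encode.comp Primrec.fst)
    (Primrec₂.natPair.comp (Primrec.const 2) (eps_den_prim.comp Primrec.snd)))

theorem above_prim : PrimrecRel above := by
  have hv : Primrec fun a : ℕ × ℕ => (a.1 - 1).unpair :=
    Primrec.unpair.comp (Primrec.pred.comp Primrec.fst)
  have h1 := Primrec.fst.comp hv
  have h2 := Primrec.snd.comp hv
  have hp : PrimrecPred fun a : ℕ × ℕ => above a.1 a.2 := by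
    refine PrimrecPred.and (Primrec.eq.comp (Primrec.nat_mod.comp h1 (Primrec.const 2)) (Primrec.const 0)) ?_
    exact Primrec.nat_lt.comp (Primrec.nat_mul.comp (Primrec.nat_double_succ.comp Primrec.snd) h2)
      (Primrec.nat_mul.comp (Primrec.nat_div.comp h1 (Primrec.const 2)) (eps_den_prim.comp Primrec.snd))
  exact hp

/-- sortedness test -/
theorem sorted_prim : PrimrecPred fun l : List BStr => l.Pairwise (fun a b => encode a < encode b) := by
  have hr : PrimrecRel fun (b a : BStr) => encode a < encode b :=
    PrimrecRel.comp₂ Primrec.nat_lt (Primrec.encode.comp Primrec.snd).to₂ (Primrec.encode.comp Primrec.fst).to₂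
  have hr' := hr.forall_mem_list
  have hd : Primrec₂ fun (l : List BStr) (a : BStr) => decide (∀ b ∈ l, encode a < encode b) := hr'.decide
  have h : Primrec fun l : List BStr => (List.recOn l true
      (fun a t ih => (decide (∀ b ∈ t, encode a < encode b)) && ih) : Bool) := by
    refine Primrec.list_rec (f := fun l : List BStr => l) (g := fun _ => true)
      (h := fun _ x => (decide (∀ b ∈ x.2.1, encode x.1 < encode b)) && x.2.2) Primrec.id (Primrec.const true) ?_
    refine Primrec₂.mk (Primrec.and.comp ?_ (Primrec.snd.comp (Primrec.snd.comp Primrec.snd)))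
    exact hd.comp (Primrec.fst.comp (Primrec.snd.comp Primrec.snd)) (Primrec.fst.comp Primrec.snd)
  refine Primrec.primrecPred (h.of_eq ?_)
  intro l
  induction l with
  | nil => simp
  | cons a t ih =>
    show (decide (∀ b ∈ t, encode a < encode b) && (List.recOn t true
      (fun a t ih => (decide (∀ b ∈ t, encode a < encode b)) && ih) : Bool)) = _
    rw [ih]
    simp [List.pairwise_cons]

def good (l : List BStr) (T : List (ℕ × ℕ)) : Prop :=
  l ≠ [] ∧ l.Pairwise (fun a b => encode a < encode b) ∧
    ∀ z ∈ l, ∃ e ∈ T, e.1 = query z l.length ∧ above e.2 l.length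

theorem good_prim : PrimrecRel good := by
  have h0 : PrimrecPred fun a : List BStr × List (ℕ × ℕ) => a.1 ≠ [] :=
    (Primrec.eq.comp Primrec.fst (Primrec.const [])).not
  have h1 : PrimrecPred fun a : List BStr × List (ℕ × ℕ) => a.1.Pairwise (fun a b => encode a < encode b) :=
    sorted_prim.comp Primrec.fst
  have h2 : PrimrecRel fun (e : ℕ × ℕ) (b : BStr × ℕ) => e.1 = query b.1 b.2 ∧ above e.2 b.2 := by
    have hp : PrimrecPred fun a : (ℕ × ℕ) × (BStr × ℕ) => a.1.1 = query a.2.1 a.2.2 ∧ above a.1.2 a.2.2 := by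
      refine PrimrecPred.and (Primrec.eq.comp (Primrec.fst.comp Primrec.fst)
        (query_prim.comp (Primrec.fst.comp Primrec.snd) (Primrec.snd.comp Primrec.snd))) ?_
      exact above_prim.comp (Primrec.snd.comp Primrec.fst) (Primrec.snd.comp Primrec.snd)
    exact hp
  have h3 := h2.exists_mem_list
  have h4 : PrimrecRel fun (z : BStr) (b : ℕ × List (ℕ × ℕ)) =>
      ∃ e ∈ b.2, e.1 = query z b.1 ∧ above e.2 b.1 := by
    have hp : PrimrecPred fun a : BStr × (ℕ × List (ℕ × ℕ)) =>
        ∃ e ∈ a.2.2, e.1 = query a.1 a.2.1 ∧ above e.2 a.2.1 :=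
      h3.comp (Primrec.snd.comp Primrec.snd) (Primrec.fst.pair (Primrec.fst.comp Primrec.snd))
    exact hp
  have h5 := h4.forall_mem_list
  have h6 : PrimrecPred fun a : List BStr × List (ℕ × ℕ) =>
      ∀ z ∈ a.1, ∃ e ∈ a.2, e.1 = query z a.1.length ∧ above e.2 a.1.length :=
    h5.comp Primrec.fst ((Primrec.list_length.comp Primrec.fst).pair Primrec.snd)
  have hp : PrimrecPred fun a : List BStr × List (ℕ × ℕ) => good a.1 a.2 := h0.and (h1.and h6)
  exact hp

/-- uniform density -/
noncomputable def unif (S : Finset BStr) (z : BStr) : ℝ := if z ∈ S then 1 / (S.card : ℝ) else 0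

def Sound (S : Finset BStr) (T : List (ℕ × ℕ)) : Prop :=
  ∀ e ∈ T, ∀ (z : BStr) (ε : ℚ), 0 < ε → e.1 = encode (z, ε) →
    ∃ q : ℚ, |(q : ℝ) - unif S z| < (ε : ℝ) ∧ e.2 = encode q + 1

theorem eps_pos {n : ℕ} (hn : 0 < n) : 0 < eps n := by unfold eps; positivity

theorem good_sound {S : Finset BStr} {T : List (ℕ × ℕ)} (hT : Sound S T) {l : List BStr} (h : good l T) :
    l = lst S := by
  obtain ⟨hne, hs, hz⟩ := h
  have hn : 0 < l.length := List.length_pos_iff.2 hne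
  have hnR : (0 : ℝ) < l.length := by exact_mod_cast hn
  have hnd : l.Nodup := hs.imp (fun h h' => by simp [h'] at h)
  have key : ∀ z ∈ l, 1 / ((l.length : ℝ) + 1) < unif S z := by
    intro z hzl
    obtain ⟨e, he, hq, ha⟩ := hz z hzl
    rw [← encode_query z _ hn] at hq
    obtain ⟨q, hq1, hq2⟩ := hT e he z _ (eps_pos hn) hq
    rw [hq2, above_iff _ _ hn] at ha
    have ha' : ((2 * l.length + 1 : ℝ) / (2 * l.length * (l.length + 1))) < (q : ℝ) := by
      have h := (Rat.cast_lt (K := ℝ)).2 ha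
      push_cast at h
      exact h
    have he : ((eps l.length : ℚ) : ℝ) = 1 / (2 * l.length * (l.length + 1)) := by
      simp [eps]
    rw [he] at hq1
    have := (abs_lt.1 hq1).2
    have e2 : 1 / ((l.length : ℝ) + 1) = ((2 * l.length + 1 : ℝ) / (2 * l.length * (l.length + 1)))
      - 1 / (2 * l.length * (l.length + 1)) := by
      field_simp; ring
    linarith
  have hsub : ∀ z ∈ l, z ∈ S := by
    intro z hzl
    have := key z hzl
    by_contra hc
    rw [unif, if_neg hc] at this
    have : (0 : ℝ) < 1 / ((l.length : ℝ) + 1) := by positivity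
    linarith
  have hcard : S.card ≤ l.length := by
    obtain ⟨z, hzl⟩ := List.exists_mem_of_ne_nil _ hne
    have h1 := key z hzl
    have hzS := hsub z hzl
    rw [unif, if_pos hzS] at h1
    have hc : (0 : ℝ) < S.card := by exact_mod_cast Finset.card_pos.2 ⟨z, hzS⟩
    rw [one_div_lt_one_div (by positivity) hc] at h1
    have : S.card < l.length + 1 := by exact_mod_cast h1
    omega
  refine eq_lst hs ?_
  have : l.toFinset = S := by
    refine Finset.eq_of_subset_of_card_le (fun z hz => hsub z (List.mem_toFinset.1 hz)) ?_
    rw [List.toFinset_card_of_nodup hnd]; exact hcard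
  intro z
  rw [← this, List.mem_toFinset]

theorem good_complete {S : Finset BStr} (hS : S.Nonempty) {T : List (ℕ × ℕ)} (hT : Sound S T)
    (h : ∀ z ∈ S, ∃ v, (query z S.card, v) ∈ T) : good (lst S) T := by
  have hc : 0 < S.card := Finset.card_pos.2 hS
  have hcR : (0 : ℝ) < S.card := by exact_mod_cast hc
  refine ⟨?_, lst_sorted S, ?_⟩
  · rw [← List.length_pos_iff, lst_length]; exact hc
  · intro z hz
    rw [mem_lst] at hz
    obtain ⟨v, hv⟩ := h z hz
    refine ⟨_, hv, ?_⟩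
    rw [lst_length]
    refine ⟨rfl, ?_⟩
    obtain ⟨q, hq1, hq2⟩ := hT _ hv z _ (eps_pos hc) (encode_query z _ hc).symm
    dsimp only at hq2 ⊢
    rw [hq2, above_iff _ _ hc]
    have he : ((eps S.card : ℚ) : ℝ) = 1 / (2 * S.card * (S.card + 1)) := by
      simp [eps]
    rw [he, unif, if_pos hz] at hq1
    have := (abs_lt.1 hq1).1
    have e2 : 1 / (S.card : ℝ) = ((2 * S.card + 1 : ℝ) / (2 * S.card * (S.card + 1)))
      + 1 / (2 * S.card * (S.card + 1)) := by
      field_simp; ring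
    have : ((2 * S.card + 1 : ℝ) / (2 * S.card * (S.card + 1))) < (q : ℝ) := by linarith
    rw [← Rat.cast_lt (K := ℝ)]
    push_cast
    exact this

def getl (n : ℕ) : List BStr := (decode (α := List BStr) n.unpair.1).getD []

theorem getl_prim : Primrec getl :=
  Primrec.option_getD.comp (Primrec.decode.comp (Primrec.fst.comp Primrec.unpair)) (Primrec.const [])

theorem code_prim : Primrec (fun l : List BStr => code l) := bits_prim.comp Primrec.encode

noncomputable def sp (n : ℕ) (T : List (ℕ × ℕ)) : Bool := decide (good (getl n) T)

theorem sp_prim : Primrec₂ sp := by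
  have := good_prim.decide
  exact this.comp (getl_prim.comp Primrec.fst) Primrec.snd

/-! ### recovering the set from an oracle -/

def tab (O : ℕ → ℕ) (k : ℕ) : List (ℕ × ℕ) := (List.range k).map fun m => (m, O m)

theorem take_tab (O : ℕ → ℕ) {k N : ℕ} (h : k ≤ N) : (tab O N).take k = tab O k := by
  rw [tab, ← List.map_take, List.take_range, min_eq_left h]; rfl

theorem eq_tab {O : ℕ → ℕ} {T : List (ℕ × ℕ)} (h : ∀ q ∈ T, O q.1 = q.2)
    (h' : T.map Prod.fst = List.range T.length) : T = tab O T.length := by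
  rw [tab, ← h', List.map_map]
  conv_lhs => rw [← List.map_id T]
  refine List.map_congr_left ?_
  intro q hq
  simp [h q hq]

noncomputable def srch (F : ℕ → List (ℕ × ℕ)) : Part ℕ :=
  Nat.rfind fun n => Part.some (sp n (F n.unpair.2))

theorem srch_congr {F F' : ℕ → List (ℕ × ℕ)} {n : ℕ} (h : ∀ k ≤ n, F k = F' k) (hn : n ∈ srch F) :
    n ∈ srch F' := by
  have h0 := Nat.mem_rfind.1 hn
  refine Nat.mem_rfind.2 ⟨?_, fun {m} hm => ?_⟩
  · have e := h _ (Nat.unpair_right_le n)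
    show true ∈ Part.some (sp n (F' n.unpair.2))
    rw [← e]; exact h0.1
  · have e := h _ ((Nat.unpair_right_le m).trans hm.le)
    show false ∈ Part.some (sp m (F' m.unpair.2))
    rw [← e]; exact h0.2 hm

theorem srch_sound {S : Finset BStr} {F : ℕ → List (ℕ × ℕ)} (hF : ∀ k, Sound S (F k)) {n : ℕ}
    (hn : n ∈ srch F) : getl n = lst S := by
  have h1 := (Nat.mem_rfind.1 hn).1
  have h2 : sp n (F n.unpair.2) = true := (Part.mem_some_iff.1 h1).symm
  exact good_sound (hF _) (of_decide_eq_true h2)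

theorem srch_complete {S : Finset BStr} (hS : S.Nonempty) {F : ℕ → List (ℕ × ℕ)} (hF : ∀ k, Sound S (F k))
    {k : ℕ} (h : ∀ z ∈ S, ∃ v, (query z S.card, v) ∈ F k) : ∃ n ∈ srch F, getl n = lst S := by
  have hd : (srch F).Dom := by
    refine Nat.rfind_dom.2 ⟨Nat.pair (encode (lst S)) k, ?_, fun _ => trivial⟩
    have : sp (Nat.pair (encode (lst S)) k) (F (Nat.pair (encode (lst S)) k).unpair.2) = true := by
      refine decide_eq_true ?_
      have : getl (Nat.pair (encode (lst S)) k) = lst S := by simp [getl, encodek]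
      rw [this, Nat.unpair_pair]
      exact good_complete hS (hF _) h
    rw [this]; exact Part.mem_some _
  obtain ⟨n, hn⟩ := Part.dom_iff_mem.1 hd
  exact ⟨n, hn, srch_sound hF hn⟩

noncomputable def recTable (U : UniversalPrefixMachine) (a : List (ℕ × ℕ) × BStr × BStr) : Part BStr :=
  (srch fun k => a.1.take k).bind fun n =>
    cond (decide (n < a.1.length) && decide (a.1.map Prod.fst = List.range a.1.length))
      (U.eval a.2.1 (code (getl n))) Part.none

theorem recTable_partrec (U : UniversalPrefixMachine) : Partrec (recTable U) := by
  have h1 : Partrec fun a : List (ℕ × ℕ) × BStr × BStr => srch fun k => a.1.take k := by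
    have hp : Primrec fun x : (List (ℕ × ℕ) × BStr × BStr) × ℕ => sp x.2 (x.1.1.take x.2.unpair.2) :=
      sp_prim.comp Primrec.snd (Primrec.list_take.comp (Primrec.snd.comp (Primrec.unpair.comp Primrec.snd))
        (Primrec.fst.comp Primrec.fst))
    have hc : Partrec₂ fun (a : List (ℕ × ℕ) × BStr × BStr) (n : ℕ) =>
        (Part.some (sp n (a.1.take n.unpair.2)) : Part Bool) := hp.to_comp
    exact Partrec.rfind hc
  have hb : Primrec fun x : (List (ℕ × ℕ) × BStr × BStr) × ℕ => decide (x.2 < x.1.1.length) :=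
    (Primrec.nat_lt.comp Primrec.snd (Primrec.list_length.comp (Primrec.fst.comp Primrec.fst))).decide
  have hb' : Primrec fun x : (List (ℕ × ℕ) × BStr × BStr) × ℕ =>
      decide (x.1.1.map Prod.fst = List.range x.1.1.length) := by
    refine (PrimrecPred.decide (Primrec.eq.comp ?_ ?_))
    · exact Primrec.list_map (Primrec.fst.comp Primrec.fst) (Primrec.fst.comp Primrec.snd).to₂
    · exact Primrec.list_range.comp (Primrec.list_length.comp (Primrec.fst.comp Primrec.fst))
  have c1 : Computable fun x : (List (ℕ × ℕ) × BStr × BStr) × ℕ => x.1.2.1 :=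
    (Primrec.fst.comp (Primrec.snd.comp Primrec.fst)).to_comp
  have c2 : Computable fun x : (List (ℕ × ℕ) × BStr × BStr) × ℕ => code (getl x.2) :=
    (code_prim.comp (getl_prim.comp Primrec.snd)).to_comp
  have h2 : Partrec fun x : (List (ℕ × ℕ) × BStr × BStr) × ℕ => U.eval x.1.2.1 (code (getl x.2)) :=
    Partrec.comp (f := fun p : BStr × BStr => U.eval p.1 p.2)
      (g := fun x : (List (ℕ × ℕ) × BStr × BStr) × ℕ => (x.1.2.1, code (getl x.2))) U.partrec' (c1.pair c2)
  have h3 := Partrec.cond (Primrec.and.comp hb hb').to_comp h2 Partrec.none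
  exact h1.bind h3

noncomputable def recMachine (U : UniversalPrefixMachine) : OraclePrefixMachine where
  eval O p _ := (srch (tab O)).bind fun n => U.eval p (code (getl n))
  prefixFree := by
    intro O y p q hp hq h
    obtain ⟨h1, h2⟩ := hp
    obtain ⟨h3, h4⟩ := hq
    exact U.prefixFree _ p q h2 h4 h
  table := recTable U
  table_partrec := recTable_partrec U
  eval_spec := by
    intro O p y x
    constructor
    · intro h
      obtain ⟨n, hn, hx⟩ := Part.mem_bind_iff.1 h
      refine ⟨tab O (n + 1), ?_, ?_⟩
      · intro q hq
        obtain ⟨m, _, rfl⟩ := List.mem_map.1 hq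
        rfl
      · refine Part.mem_bind_iff.2 ⟨n, ?_, ?_⟩
        · refine srch_congr ?_ hn
          intro k hk
          exact (take_tab O (by omega)).symm
        · have : (decide (n < (tab O (n + 1)).length) &&
            decide ((tab O (n + 1)).map Prod.fst = List.range (tab O (n + 1)).length)) = true := by
            have hlen : (tab O (n + 1)).length = n + 1 := by simp [tab]
            rw [hlen]
            have : (tab O (n + 1)).map Prod.fst = List.range (n + 1) := by
              rw [tab, List.map_map]
              exact List.map_id _
            simp [this]
          dsimp only
          rw [this]; exact hx
    · rintro ⟨T, hT, h⟩
      obtain ⟨n, hn, hx⟩ := Part.mem_bind_iff.1 h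
      dsimp only at hn hx
      cases hb : (decide (n < T.length) && decide (T.map Prod.fst = List.range T.length)) with
      | false =>
        rw [hb] at hx; exact absurd hx (Part.notMem_none _)
      | true =>
        rw [hb] at hx
        rw [Bool.and_eq_true, decide_eq_true_iff, decide_eq_true_iff] at hb
        have e := eq_tab hT hb.2
        refine Part.mem_bind_iff.2 ⟨n, ?_, hx⟩
        refine srch_congr ?_ hn
        intro k hk
        rw [e]
        exact take_tab O (by omega)

theorem tab_sound {S : Finset BStr} {A : BStr → ℚ → ℚ} (hA : Approximates A (unif S)) (k : ℕ) :
    Sound S (tab (oracleOfApprox A) k) := by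
  intro e he z ε hε h
  obtain ⟨m, _, rfl⟩ := List.mem_map.1 he
  dsimp only at h ⊢
  refine ⟨A z ε, hA z ε hε, ?_⟩
  rw [h, oracleOfApprox, encodek]
  rfl

theorem finite_bound {S : Finset BStr} (R : BStr → ℕ → Prop) (h : ∀ z ∈ S, ∃ k, ∀ k' ≥ k, R z k') :
    ∃ k, ∀ z ∈ S, R z k := by
  choose! g hg using h
  exact ⟨S.sup g, fun z hz => hg z hz _ (Finset.le_sup (f := g) hz)⟩

theorem recMachine_spec (U : UniversalPrefixMachine) (V : UniversalOracleMachine) :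
    ∃ c, ∀ (x : BStr) (S : Finset BStr), x ∈ S → ∃ p : BStr, p.length ≤ U.KcS x S + c ∧
      ∀ A, Approximates A (unif S) → x ∈ V.eval (oracleOfApprox A) p [] := by
  obtain ⟨s, hs⟩ := V.universal (recMachine U)
  refine ⟨s.length, fun x S hx => ?_⟩
  obtain ⟨p, hp, hpx⟩ := exists_Kc U x (code S)
  refine ⟨s ++ p, ?_, fun A hA => ?_⟩
  · rw [List.length_append, hp, UniversalPrefixMachine.KcS]; omega
  · rw [hs]
    obtain ⟨k, hk⟩ := finite_bound (S := S) (fun z k => ∃ v, (query z S.card, v) ∈ tab (oracleOfApprox A) k)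
      (fun z _ => ⟨query z S.card + 1, fun k' hk' =>
        ⟨_, List.mem_map.2 ⟨query z S.card, List.mem_range.2 (by omega), rfl⟩⟩⟩)
    obtain ⟨n, hn, hg⟩ := srch_complete ⟨x, hx⟩ (tab_sound hA) hk
    refine Part.mem_bind_iff.2 ⟨n, hn, ?_⟩
    rw [hg, code_lst]; exact hpx

/-! ### recovering the set from a program for the density -/

def ptab (s : BStr × BStr → ℕ → Option BStr) (p : BStr) (k : ℕ) : List (ℕ × ℕ) :=
  (List.range k).filterMap fun m => (s (p, Nat.bits m) k).map fun w => (m, unbits w + 1)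

theorem ptab_prim {s : BStr × BStr → ℕ → Option BStr} (hs : Primrec₂ s) : Primrec₂ (ptab s) := by
  refine Primrec₂.mk (Primrec.listFilterMap (Primrec.list_range.comp Primrec.snd) ?_)
  refine Primrec₂.mk (Primrec.option_map ?_ ?_)
  · exact hs.comp ((Primrec.fst.comp Primrec.fst).pair (bits_prim.comp Primrec.snd))
      (Primrec.snd.comp Primrec.fst)
  · exact Primrec₂.mk ((Primrec.snd.comp Primrec.fst).pair (Primrec.succ.comp (unbits_prim.comp Primrec.snd)))

noncomputable def pdfMachine (U : UniversalPrefixMachine) (s : BStr × BStr → ℕ → Option BStr) (hs : Primrec₂ s) :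
    PrefixMachine where
  eval p _ := (U.eval p (code (([] : BStr), (1 : ℚ)))).bind fun _ =>
    (srch (ptab s p)).map fun n => code (getl n)
  partrec' := by
    have h1 : Partrec fun a : BStr × BStr => U.eval a.1 (code (([] : BStr), (1 : ℚ))) :=
      Partrec.comp (f := fun p : BStr × BStr => U.eval p.1 p.2)
        (g := fun a : BStr × BStr => (a.1, code (([] : BStr), (1 : ℚ)))) U.partrec'
        (Computable.fst.pair (Computable.const _))
    have h2 : Partrec fun a : (BStr × BStr) × BStr => srch (ptab s a.1.1) := by
      have hp : Primrec fun x : ((BStr × BStr) × BStr) × ℕ => sp x.2 (ptab s x.1.1.1 x.2.unpair.2) :=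
        sp_prim.comp Primrec.snd ((ptab_prim hs).comp (Primrec.fst.comp (Primrec.fst.comp Primrec.fst))
          (Primrec.snd.comp (Primrec.unpair.comp Primrec.snd)))
      have hc : Partrec₂ fun (a : (BStr × BStr) × BStr) (n : ℕ) =>
          (Part.some (sp n (ptab s a.1.1 n.unpair.2)) : Part Bool) := hp.to_comp
      exact Partrec.rfind hc
    have h3 : Computable₂ fun (_ : (BStr × BStr) × BStr) (n : ℕ) => code (getl n) :=
      ((code_prim.comp getl_prim).comp Primrec.snd).to_comp
    exact h1.bind (h2.map h3)
  prefixFree := by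
    intro y p q hp hq h
    obtain ⟨h1, _⟩ := hp
    obtain ⟨h2, _⟩ := hq
    exact U.prefixFree _ p q h1 h2 h

theorem pdfMachine_spec (U : UniversalPrefixMachine) :
    ∃ c, ∀ (S : Finset BStr) (p : BStr), S.Nonempty → (∀ (z : BStr) (ε : ℚ), 0 < ε →
      ∃ q : ℚ, code q ∈ U.eval p (code (z, ε)) ∧ |((q : ℚ) : ℝ) - unif S z| < (ε : ℝ)) →
      U.Kset S ≤ p.length + c := by
  obtain ⟨s, hs, hs1, hs2⟩ := exists_step U.partrec'
  obtain ⟨t, ht⟩ := U.universal (pdfMachine U s hs)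
  refine ⟨t.length, fun S p hS hp => ?_⟩
  have hsound : ∀ k, Sound S (ptab s p k) := by
    intro k e he z ε hε h
    obtain ⟨m, _, hm⟩ := List.mem_filterMap.1 he
    obtain ⟨w, hw, rfl⟩ := Option.map_eq_some_iff.1 hm
    dsimp only at h ⊢
    obtain ⟨q, hq, hq'⟩ := hp z ε hε
    refine ⟨q, hq', ?_⟩
    have h1 : w ∈ U.eval p (Nat.bits m) := (hs1 (p, Nat.bits m) w).2 ⟨k, hw⟩
    rw [h] at h1
    have := Part.mem_unique h1 hq
    rw [this, unbits_code]
  have hc : 0 < S.card := Finset.card_pos.2 hS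
  obtain ⟨k, hk⟩ := finite_bound (S := S) (fun z k => ∃ v, (query z S.card, v) ∈ ptab s p k) (by
    intro z _
    obtain ⟨q, hq, _⟩ := hp z _ (eps_pos hc)
    have hq' : code q ∈ U.eval p (Nat.bits (query z S.card)) := by
      rw [← encode_query z _ hc]; exact hq
    obtain ⟨k0, hk0⟩ := (hs1 (p, Nat.bits (query z S.card)) (code q)).1 hq'
    refine ⟨max k0 (query z S.card + 1), fun k' hk' => ⟨unbits (code q) + 1, ?_⟩⟩
    have h1 : k0 ≤ k' := (le_max_left _ _).trans hk'
    have h2 : query z S.card + 1 ≤ k' := (le_max_right _ _).trans hk'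
    refine List.mem_filterMap.2 ⟨query z S.card, List.mem_range.2 h2, ?_⟩
    rw [hs2 _ _ _ _ h1 hk0]; rfl)
  obtain ⟨n, hn, hg⟩ := srch_complete hS hsound hk
  obtain ⟨q0, hq0, _⟩ := hp [] 1 one_pos
  have : code S ∈ U.eval (t ++ p) [] := by
    rw [ht]
    refine Part.mem_bind_iff.2 ⟨_, hq0, (Part.mem_map_iff _).2 ⟨n, hn, ?_⟩⟩
    rw [hg, code_lst]
  have h1 := Kc_le U this
  rw [List.length_append] at h1
  rw [UniversalPrefixMachine.Kset, UniversalPrefixMachine.K]; omega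

/-! ### decoding of rationals -/

theorem int_natAbs_symm (i : ℕ) : (Equiv.intEquivNat.symm i).natAbs = (i + 1) / 2 := by
  obtain ⟨j, rfl⟩ := Equiv.intEquivNat.surjective i
  rw [Equiv.symm_apply_apply]
  cases j with
  | ofNat n =>
    show n = (2 * n + 1) / 2
    omega
  | negSucc n =>
    show n + 1 = (2 * n + 1 + 1) / 2
    omega

theorem decode_int (i : ℕ) : (decode i : Option ℤ) = some (Equiv.intEquivNat.symm i) := by
  show @decode _ (Encodable.ofEquiv _ Equiv.intEquivNat) i = _
  rw [decode_ofEquiv]; rfl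

theorem decode_rat_isSome (n : ℕ) : (decode (α := ℚ) n).isSome = true ↔
    0 < n.unpair.2 ∧ Nat.Coprime ((n.unpair.1 + 1) / 2) n.unpair.2 := by
  have h1 : (decode (α := ℚ) n).isSome =
      (decode (α := Σ n : ℤ, { d : ℕ // 0 < d ∧ n.natAbs.Coprime d }) n).isSome := by
    unfold Rat.instEncodable
    rw [decode_ofEquiv, Option.isSome_map]
  rw [h1, decode_sigma_val, decode_int]
  rw [Option.bind_some, Option.isSome_map]
  rw [← int_natAbs_symm]
  show (Encodable.decodeSubtype n.unpair.2).isSome = true ↔ _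
  unfold Encodable.decodeSubtype
  rw [decode_nat, Option.bind_some]
  split_ifs with h
  · simpa using h
  · simpa using h

def noCommon (a d : ℕ) : Prop := ∀ k < d + 1, ¬ (k ≠ 1 ∧ a % k = 0 ∧ d % k = 0)

theorem noCommon_iff {a d : ℕ} (hd : 0 < d) : noCommon a d ↔ Nat.Coprime a d := by
  constructor
  · intro h
    by_contra hc
    refine h (Nat.gcd a d) (Nat.lt_succ_of_le (Nat.gcd_le_right _ hd)) ⟨hc, ?_, ?_⟩
    · exact Nat.mod_eq_zero_of_dvd (Nat.gcd_dvd_left _ _)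
    · exact Nat.mod_eq_zero_of_dvd (Nat.gcd_dvd_right _ _)
  · rintro h k _ ⟨h1, h2, h3⟩
    exact h1 (Nat.Coprime.eq_one_of_dvd (Nat.Coprime.coprime_dvd_left (Nat.dvd_of_mod_eq_zero h2) h)
      (Nat.dvd_of_mod_eq_zero h3))

theorem noCommon_prim : PrimrecRel noCommon := by
  have h1 : PrimrecRel fun (k : ℕ) (b : ℕ × ℕ) => ¬ (k ≠ 1 ∧ b.1 % k = 0 ∧ b.2 % k = 0) := by
    have hp : PrimrecPred fun a : ℕ × (ℕ × ℕ) => ¬ (a.1 ≠ 1 ∧ a.2.1 % a.1 = 0 ∧ a.2.2 % a.1 = 0) := by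
      refine PrimrecPred.not (PrimrecPred.and (PrimrecPred.not (Primrec.eq.comp Primrec.fst (Primrec.const 1)))
        (PrimrecPred.and ?_ ?_))
      · exact Primrec.eq.comp (Primrec.nat_mod.comp (Primrec.fst.comp Primrec.snd) Primrec.fst) (Primrec.const 0)
      · exact Primrec.eq.comp (Primrec.nat_mod.comp (Primrec.snd.comp Primrec.snd) Primrec.fst) (Primrec.const 0)
    exact hp
  have h2 := h1.forall_mem_list
  have hp : PrimrecPred fun a : ℕ × ℕ => noCommon a.1 a.2 := by
    refine (h2.comp (Primrec.list_range.comp (Primrec.succ.comp Primrec.snd))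
      (Primrec.fst.pair Primrec.snd)).of_eq ?_
    intro a
    simp only [noCommon, List.mem_range, Nat.succ_eq_add_one]
  exact hp

def ratOk (n : ℕ) : Prop := 0 < n.unpair.2 ∧ noCommon ((n.unpair.1 + 1) / 2) n.unpair.2

theorem ratOk_iff (n : ℕ) : ratOk n ↔ (decode (α := ℚ) n).isSome = true := by
  rw [decode_rat_isSome]
  constructor
  · rintro ⟨h, h'⟩; exact ⟨h, (noCommon_iff h).1 h'⟩
  · rintro ⟨h, h'⟩; exact ⟨h, (noCommon_iff h).2 h'⟩

theorem ratOk_prim : PrimrecPred ratOk := by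
  have h1 : Primrec fun n : ℕ => n.unpair.1 := Primrec.fst.comp Primrec.unpair
  have h2 : Primrec fun n : ℕ => n.unpair.2 := Primrec.snd.comp Primrec.unpair
  refine PrimrecPred.and (Primrec.nat_lt.comp (Primrec.const 0) h2) ?_
  exact noCommon_prim.comp (Primrec.nat_div.comp (Primrec.succ.comp h1) (Primrec.const 2)) h2

theorem mem_prim : PrimrecRel fun (z : BStr) (l : List BStr) => z ∈ l := by
  have h1 : PrimrecRel fun (a b : BStr) => a = b := Primrec.eq
  have h2 := h1.exists_mem_list
  have hp : PrimrecPred fun a : BStr × List BStr => a.1 ∈ a.2 := by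
    refine (h2.comp Primrec.snd Primrec.fst).of_eq ?_
    intro a; simp
  exact hp

/-- code of the value of the uniform density -/
noncomputable def val (w z : BStr) : ℕ := if z ∈ rd w then Nat.pair 2 (rd w).length else Nat.pair 0 1

theorem val_prim : Primrec₂ val := by
  have hr : Primrec fun a : BStr × BStr => rd a.1 := rd_prim.comp Primrec.fst
  refine Primrec₂.mk (Primrec.ite (mem_prim.comp Primrec.snd hr) ?_ (Primrec.const _))
  exact Primrec₂.natPair.comp (Primrec.const 2) (Primrec.list_length.comp hr)

noncomputable def qv (S : Finset BStr) (z : BStr) : ℚ := if z ∈ S then 1 / (S.card : ℚ) else 0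

theorem qv_cast (S : Finset BStr) (z : BStr) : ((qv S z : ℚ) : ℝ) = unif S z := by
  unfold qv unif
  split_ifs <;> simp

theorem val_code (S : Finset BStr) (z : BStr) : val (code S) z = encode (qv S z) := by
  by_cases h : z ∈ S
  · have h' : z ∈ rd (code S) := by rw [rd_code]; exact (mem_lst S).2 h
    rw [val, if_pos h', rd_code, lst_length, qv, if_pos h]
    exact (encode_inv _ (Finset.card_pos.2 ⟨z, h⟩)).symm
  · have h' : z ∉ rd (code S) := by rw [rd_code]; exact fun hz => h ((mem_lst S).1 hz)
    rw [val, if_neg h', qv, if_neg h]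
    exact encode_ratzero.symm

noncomputable def Ga (w y : BStr) : BStr :=
  Nat.bits (val w ((decode (α := BStr) (unbits y).unpair.1).getD []))

theorem Ga_comp : Computable₂ Ga := by
  have : Primrec₂ Ga := by
    refine Primrec₂.mk (bits_prim.comp (val_prim.comp Primrec.fst ?_))
    refine Primrec.option_getD.comp (Primrec.decode.comp ?_) (Primrec.const [])
    exact Primrec.fst.comp (Primrec.unpair.comp (unbits_prim.comp Primrec.snd))
  exact this.to_comp

theorem Ga_code (S : Finset BStr) (z : BStr) (ε : ℚ) : Ga (code S) (code (z, ε)) = code (qv S z) := by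
  rw [Ga, unbits_code, encode_prod_val, Nat.unpair_pair, encodek, Option.getD_some, val_code]; rfl

def Gb (w d : BStr) : BStr := ((rd w)[didx d]?).getD w

theorem Gb_prim : Primrec₂ Gb := by
  refine Primrec₂.mk (Primrec.option_getD.comp ?_ Primrec.fst)
  exact Primrec.list_getElem?.comp (rd_prim.comp Primrec.fst) (didx_prim.comp Primrec.snd)

theorem Gb_dstr (S : Finset BStr) (n : ℕ) : Gb (code S) (dstr n) = ((lst S)[n]?).getD (code S) := by
  rw [Gb, rd_code, didx_dstr]

theorem oracleF_prim : Primrec₂ fun (y : BStr) (m : ℕ) => oracleOfFun (Gb y) m := by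
  refine Primrec₂.mk (Primrec.encode.comp (Primrec.option_map (Primrec.decode.comp Primrec.snd) ?_))
  exact Primrec₂.mk (Gb_prim.comp (Primrec.fst.comp Primrec.fst) Primrec.snd)

noncomputable def Oa (y : BStr) (m : ℕ) : ℕ :=
  if ratOk m.unpair.2 then
    encode ((decode (α := BStr) m.unpair.1).map fun z => val y z) else 0

theorem Oa_prim : Primrec₂ Oa := by
  have h1 : Primrec fun a : BStr × ℕ => a.2.unpair.1 := Primrec.fst.comp (Primrec.unpair.comp Primrec.snd)
  have h2 : Primrec fun a : BStr × ℕ => a.2.unpair.2 := Primrec.snd.comp (Primrec.unpair.comp Primrec.snd)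
  refine Primrec₂.mk (Primrec.ite (ratOk_prim.comp h2) ?_ (Primrec.const 0))
  refine Primrec.encode.comp (Primrec.option_map (Primrec.decode.comp h1) ?_)
  exact Primrec₂.mk (val_prim.comp (Primrec.fst.comp Primrec.fst) Primrec.snd)

theorem Oa_code (S : Finset BStr) : Oa (code S) = oracleOfApprox (fun z _ => qv S z) := by
  funext m
  rw [Oa, oracleOfApprox, decode_prod_val, ratOk_iff]
  cases h1 : (decode (α := BStr) m.unpair.1) with
  | none => simp
  | some z =>
    cases h2 : (decode (α := ℚ) m.unpair.2) with
    | none => simp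
    | some q => simp [val_code]

theorem unif_cpdf {S : Finset BStr} (hS : S.Nonempty) : IsCPDF (unif S) := by
  have hc : (S.card : ℝ) ≠ 0 := by
    have := Finset.card_pos.2 hS
    positivity
  refine ⟨?_, ?_, ?_⟩
  · intro z; unfold unif; split_ifs <;> positivity
  · rw [tsum_eq_sum (s := S)]
    · rw [Finset.sum_congr rfl (g := fun _ => 1 / (S.card : ℝ))]
      · rw [Finset.sum_const, nsmul_eq_mul]; field_simp
      · intro z hz; rw [unif, if_pos hz]
    · intro z hz; rw [unif, if_neg hz]
  · refine ⟨fun a => qv S a.1, ?_, ?_⟩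
    · have hp : PrimrecPred fun a : BStr × ℚ => a.1 ∈ S := by
        refine (mem_prim.comp Primrec.fst (Primrec.const (lst S))).of_eq ?_
        intro a; exact mem_lst S
      exact (Primrec.ite hp (Primrec.const (1 / (S.card : ℚ))) (Primrec.const 0)).to_comp
    · intro z ε hε
      rw [qv_cast, sub_self, abs_zero]
      exact_mod_cast hε

theorem approx_qv (S : Finset BStr) : Approximates (fun z _ => qv S z) (unif S) := by
  intro z ε hε
  rw [qv_cast, sub_self, abs_zero]
  exact_mod_cast hε

theorem KPdf_bound (U : UniversalPrefixMachine) : ∃ c : ℕ, ∀ S : Finset BStr, S.Nonempty →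
    KPdf U (unif S) ≤ U.Kset S + c ∧ U.Kset S ≤ KPdf U (unif S) + c := by
  obtain ⟨c1, h1⟩ := mapMachine_spec U Ga Ga_comp
  obtain ⟨c2, h2⟩ := pdfMachine_spec U
  refine ⟨c1 + c2, fun S hS => ?_⟩
  obtain ⟨p, hp, hpe⟩ := h1 (code S)
  have hmem : ∀ (z : BStr) (ε : ℚ), 0 < ε →
      ∃ q : ℚ, code q ∈ U.eval p (code (z, ε)) ∧ |((q : ℚ) : ℝ) - unif S z| < (ε : ℝ) := by
    intro z ε hε
    refine ⟨qv S z, ?_, approx_qv S z ε hε⟩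
    rw [← Ga_code S z ε]; exact hpe _
  have hle : KPdf U (unif S) ≤ p.length := Nat.sInf_le ⟨p, rfl, hmem⟩
  have hin : KPdf U (unif S) ∈ {m | ∃ p : BStr, p.length = m ∧ ∀ (z : BStr) (ε : ℚ), 0 < ε →
    ∃ q : ℚ, code q ∈ U.eval p (code (z, ε)) ∧ |((q : ℚ) : ℝ) - unif S z| < (ε : ℝ)} :=
    Nat.sInf_mem ⟨_, p, rfl, hmem⟩
  obtain ⟨p', hp', h'⟩ := hin
  have := h2 S p' hS h'
  have hK : U.Kset S = U.K (code S) := rfl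
  constructor <;> omega

theorem KFn_bound (U : UniversalPrefixMachine) : ∃ c : ℕ, ∀ S : Finset BStr,
    KFn U (Gb (code S)) ≤ U.Kset S + c ∧ U.Kset S ≤ KFn U (Gb (code S)) + c := by
  obtain ⟨c1, h1⟩ := mapMachine_spec U Gb Gb_prim.to_comp
  obtain ⟨c2, h2⟩ := repMachine_spec U
  refine ⟨c1 + c2, fun S => ?_⟩
  obtain ⟨p, hp, hpe⟩ := h1 (code S)
  have hle : KFn U (Gb (code S)) ≤ p.length := Nat.sInf_le ⟨p, rfl, hpe⟩
  have hin : KFn U (Gb (code S)) ∈ {m | ∃ p : BStr, p.length = m ∧ ∀ d : BStr, Gb (code S) d ∈ U.eval p d} :=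
    Nat.sInf_mem ⟨_, p, rfl, hpe⟩
  obtain ⟨p', hp', h'⟩ := hin
  have := h2 (lst S) (code S) p' (lst_nodup S) (fun n => by rw [← Gb_dstr]; exact h' _)
  have hK : U.Kset S = U.K (code S) := rfl
  constructor <;> omega

theorem lenx_bound {x : BStr} {S : Finset BStr} (hx : x ∈ S) :
    (lenx (Gb (code S)) x : ℝ) ≤ Real.logb 2 (S.card : ℝ) := by
  obtain ⟨i, hi, he⟩ := List.getElem_of_mem ((mem_lst S).2 hx)
  have h1 : lenx (Gb (code S)) x ≤ (dstr i).length := by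
    refine Nat.sInf_le ⟨dstr i, rfl, ?_⟩
    rw [Gb_dstr, List.getElem?_eq_getElem hi, he]; rfl
  have h2 := pow_dstr i
  rw [lst_length] at hi
  have h3 : 2 ^ (lenx (Gb (code S)) x) ≤ S.card :=
    (Nat.pow_le_pow_right (by norm_num) h1).trans (by omega)
  have hc : (0 : ℝ) < S.card := by exact_mod_cast (by omega : 0 < S.card)
  rw [Real.le_logb_iff_rpow_le (by norm_num) hc, Real.rpow_natCast]
  exact_mod_cast h3

theorem KcondFun_bound (U : UniversalPrefixMachine) (V : UniversalOracleMachine) : ∃ c : ℕ,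
    ∀ (x : BStr) (S : Finset BStr), U.KcS x S ≤ KcondFun V x (Gb (code S)) + c := by
  obtain ⟨c, h⟩ := simMachine_spec U V.toOraclePrefixMachine oracleF_prim
  refine ⟨c, fun x S => ?_⟩
  obtain ⟨p0, h0⟩ := exists_oracle_prog U V (oracleOfFun (Gb (code S))) x
  have hin : KcondFun V x (Gb (code S)) ∈
      {m | ∃ p : BStr, p.length = m ∧ x ∈ V.eval (oracleOfFun (Gb (code S))) p []} :=
    Nat.sInf_mem ⟨_, p0, rfl, h0⟩
  obtain ⟨p, hp, hx⟩ := hin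
  rw [← hp]
  exact h x (code S) p hx

theorem KcondPdf_bound (U : UniversalPrefixMachine) (V : UniversalOracleMachine) : ∃ c : ℕ,
    ∀ (x : BStr) (S : Finset BStr), x ∈ S →
      U.KcS x S ≤ KcondPdf V x (unif S) + c ∧ KcondPdf V x (unif S) ≤ U.KcS x S + c := by
  obtain ⟨c1, h1⟩ := simMachine_spec U V.toOraclePrefixMachine Oa_prim
  obtain ⟨c2, h2⟩ := recMachine_spec U V
  refine ⟨c1 + c2, fun x S hxS => ?_⟩
  obtain ⟨p0, hl, h0⟩ := h2 x S hxS
  have hle : KcondPdf V x (unif S) ≤ p0.length := Nat.sInf_le ⟨p0, rfl, h0⟩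
  have hin : KcondPdf V x (unif S) ∈ {m | ∃ p : BStr, p.length = m ∧
    ∀ A : BStr → ℚ → ℚ, Approximates A (unif S) → x ∈ V.eval (oracleOfApprox A) p []} :=
    Nat.sInf_mem ⟨_, p0, rfl, h0⟩
  obtain ⟨p, hp, hx⟩ := hin
  have h3 := hx _ (approx_qv S)
  rw [← Oa_code] at h3
  have h4 : U.KcS x S ≤ p.length + c1 := h1 x (code S) p h3
  constructor <;> omega

end S15

/-- There is a constant `c` such that for every string `x` and
finite set `S ∋ x`: (a) there is a computable probability density function `P`
with `-log P(x) = log|S|`, `|δ(x|P) − δ(x|S)| ≤ c` and `|K(P) − K(S)| ≤ c`;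
and (b) there is a total recursive function `p` with `l_x(p) ≤ log|S|`,
`δ(x|p) ≤ δ(x|S) + c` and `|K(p) − K(S)| ≤ c`. -/
theorem statement15 (U : UniversalPrefixMachine) (V : UniversalOracleMachine) :
    ∃ c : ℕ, ∀ (x : BStr) (S : Finset BStr), x ∈ S →
      (∃ P : BStr → ℝ, IsCPDF P ∧
        -Real.logb 2 (P x) = Real.logb 2 (S.card : ℝ) ∧
        |deltaPdf V x P - U.deficiency x S| ≤ (c : ℝ) ∧
        |(KPdf U P : ℝ) - (U.Kset S : ℝ)| ≤ (c : ℝ)) ∧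
      (∃ f : BStr → BStr, Computable f ∧
        (lenx f x : ℝ) ≤ Real.logb 2 (S.card : ℝ) ∧
        deltaFun V x f ≤ U.deficiency x S + (c : ℝ) ∧
        |(KFn U f : ℝ) - (U.Kset S : ℝ)| ≤ (c : ℝ)) := by
  obtain ⟨c1, h1⟩ := S15.KPdf_bound U
  obtain ⟨c2, h2⟩ := S15.KFn_bound U
  obtain ⟨c3, h3⟩ := S15.KcondFun_bound U V
  obtain ⟨c4, h4⟩ := S15.KcondPdf_bound U V
  refine ⟨c1 + c2 + c3 + c4, fun x S hx => ⟨⟨S15.unif S, S15.unif_cpdf ⟨x, hx⟩, ?_, ?_, ?_⟩,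
    ⟨S15.Gb (code S), ?_, S15.lenx_bound hx, ?_, ?_⟩⟩⟩
  · rw [S15.unif, if_pos hx, one_div, Real.logb_inv, neg_neg]
  · have hlog : -Real.logb 2 (S15.unif S x) = Real.logb 2 (S.card : ℝ) := by
      rw [S15.unif, if_pos hx, one_div, Real.logb_inv, neg_neg]
    obtain ⟨ha, hb⟩ := h4 x S hx
    have ha' : (U.KcS x S : ℝ) ≤ KcondPdf V x (S15.unif S) + c4 := by exact_mod_cast ha
    have hb' : (KcondPdf V x (S15.unif S) : ℝ) ≤ U.KcS x S + c4 := by exact_mod_cast hb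
    rw [deltaPdf, hlog, UniversalPrefixMachine.deficiency, abs_le]
    push_cast
    have := Nat.cast_nonneg (α := ℝ) c1
    have := Nat.cast_nonneg (α := ℝ) c2
    have := Nat.cast_nonneg (α := ℝ) c3
    constructor <;> linarith
  · obtain ⟨ha, hb⟩ := h1 S ⟨x, hx⟩
    have ha' : (KPdf U (S15.unif S) : ℝ) ≤ U.Kset S + c1 := by exact_mod_cast ha
    have hb' : (U.Kset S : ℝ) ≤ KPdf U (S15.unif S) + c1 := by exact_mod_cast hb
    rw [abs_le]
    push_cast
    have := Nat.cast_nonneg (α := ℝ) c4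
    have := Nat.cast_nonneg (α := ℝ) c2
    have := Nat.cast_nonneg (α := ℝ) c3
    constructor <;> linarith
  · exact (S15.Gb_prim.comp (Primrec.const (code S)) Primrec.id).to_comp
  · have ha' : (U.KcS x S : ℝ) ≤ KcondFun V x (S15.Gb (code S)) + c3 := by exact_mod_cast h3 x S
    have hl := S15.lenx_bound hx
    rw [deltaFun, UniversalPrefixMachine.deficiency]
    push_cast
    have := Nat.cast_nonneg (α := ℝ) c1
    have := Nat.cast_nonneg (α := ℝ) c2
    have := Nat.cast_nonneg (α := ℝ) c4
    linarith
  · obtain ⟨ha, hb⟩ := h2 S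
    have ha' : (KFn U (S15.Gb (code S)) : ℝ) ≤ U.Kset S + c2 := by exact_mod_cast ha
    have hb' : (U.Kset S : ℝ) ≤ KFn U (S15.Gb (code S)) + c2 := by exact_mod_cast hb
    rw [abs_le]
    push_cast
    have := Nat.cast_nonneg (α := ℝ) c4
    have := Nat.cast_nonneg (α := ℝ) c1
    have := Nat.cast_nonneg (α := ℝ) c3
    constructor <;> linarith
end
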